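/- arXiv:2502.19139 — 2 statements merged into one kernel-verified Lean document; each statement's English description precedes it below -/
import Mathlib

section
/- Suppose V = ⊕_{λ∈ℂ} V_λ is a simple cuspidal module over the superconformal current algebra ĝ. Then the central elements C and C₁ act on V by zero. -/
/-!
Representations of the superconformal current algebra
`ĝ = 𝔰 ⋉ (ġ ⊗ A ⊕ ℂC₁)` are encoded by the families of operators giving the
action of the basis elements `L i`, `G i`, `C`, `C₁`, `x ⊗ tⁱ` (operator `E i x`)
and `x ⊗ tⁱξ` (operator `F i x`), subject to the supercommutator relations.
-/

noncomputable section

open Module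

variable (𝕘 : Type) [LieRing 𝕘] [LieAlgebra ℂ 𝕘]

/-- The operators `L, G, C, C₁, E, F` on `M` form a representation of the
superconformal current algebra `ĝ` (with invariant form `Φ` on `ġ`):
all supercommutator relations of `ĝ` hold (commutators for pairs with at least one
even element, anticommutators for pairs of odd elements). -/
structure IsSCCRep {M : Type} [AddCommGroup M] [Module ℂ M]
    (Φ : 𝕘 →ₗ[ℂ] 𝕘 →ₗ[ℂ] ℂ)
    (L G : ℤ → End ℂ M) (C C1 : End ℂ M)
    (E F : ℤ → 𝕘 →ₗ[ℂ] End ℂ M) : Prop where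
  comm_LL : ∀ i j : ℤ, L i * L j - L j * L i
      = ((j : ℂ) - (i : ℂ)) • L (i + j)
        + (if i + j = 0 then ((i : ℂ) ^ 3 - (i : ℂ)) / 12 else 0) • C
  comm_LG : ∀ i j : ℤ, L i * G j - G j * L i = ((j : ℂ) - (i : ℂ) / 2) • G (i + j)
  comm_GG : ∀ i j : ℤ, G i * G j + G j * G i
      = (-2 : ℂ) • L (i + j)
        + (if i + j = 0 then (4 * (i : ℂ) ^ 2 - 1) / 12 else 0) • C
  comm_LE : ∀ (i j : ℤ) (x : 𝕘), L i * E j x - E j x * L i = (j : ℂ) • E (i + j) x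
  comm_LF : ∀ (i j : ℤ) (x : 𝕘),
      L i * F j x - F j x * L i = ((j : ℂ) + (i : ℂ) / 2) • F (i + j) x
  comm_GE : ∀ (i j : ℤ) (x : 𝕘), G i * E j x - E j x * G i = (j : ℂ) • F (i + j) x
  comm_GF : ∀ (i j : ℤ) (x : 𝕘), G i * F j x + F j x * G i = - E (i + j) x
  comm_EE : ∀ (i j : ℤ) (x y : 𝕘), E i x * E j y - E j y * E i x
      = E (i + j) ⁅x, y⁆ + (if i + j = 0 then (i : ℂ) * Φ x y else 0) • C1
  comm_FE : ∀ (i j : ℤ) (x y : 𝕘), F i x * E j y - E j y * F i x = F (i + j) ⁅x, y⁆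
  comm_FF : ∀ (i j : ℤ) (x y : 𝕘), F i x * F j y + F j y * F i x
      = (if i + j = 0 then Φ x y else 0) • C1
  central_C_L : ∀ i, C * L i = L i * C
  central_C_G : ∀ i, C * G i = G i * C
  central_C_E : ∀ (i : ℤ) (x : 𝕘), C * E i x = E i x * C
  central_C_F : ∀ (i : ℤ) (x : 𝕘), C * F i x = F i x * C
  central_C_C1 : C * C1 = C1 * C
  central_C1_L : ∀ i, C1 * L i = L i * C1
  central_C1_G : ∀ i, C1 * G i = G i * C1
  central_C1_E : ∀ (i : ℤ) (x : 𝕘), C1 * E i x = E i x * C1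
  central_C1_F : ∀ (i : ℤ) (x : 𝕘), C1 * F i x = F i x * C1

/-- An endomorphism has parity `p` with respect to a `ℤ/2`-grading. -/
def MapsGr {M : Type} [AddCommGroup M] [Module ℂ M]
    (gr : Fin 2 → Submodule ℂ M) (p : Fin 2) (f : End ℂ M) : Prop :=
  ∀ q, (gr q).map f ≤ gr (q + p)

/-- The grading `gr` makes `M` into a super vector space on which the operator
families act with the correct parities. -/
structure IsSCCSuper {M : Type} [AddCommGroup M] [Module ℂ M]
    (gr : Fin 2 → Submodule ℂ M)
    (L G : ℤ → End ℂ M) (C C1 : End ℂ M)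
    (E F : ℤ → 𝕘 →ₗ[ℂ] End ℂ M) : Prop where
  internal : DirectSum.IsInternal gr
  hL : ∀ i, MapsGr gr 0 (L i)
  hG : ∀ i, MapsGr gr 1 (G i)
  hC : MapsGr gr 0 C
  hC1 : MapsGr gr 0 C1
  hE : ∀ (i : ℤ) (x : 𝕘), MapsGr gr 0 (E i x)
  hF : ∀ (i : ℤ) (x : 𝕘), MapsGr gr 1 (F i x)

/-- `M` is a weight module: `L₀` acts diagonalizably. -/
def IsWeightMod {M : Type} [AddCommGroup M] [Module ℂ M] (L0 : End ℂ M) : Prop :=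
  ⨆ μ : ℂ, L0.eigenspace μ = ⊤

/-- `M` is a Harish-Chandra module: a weight module with finite-dimensional
weight spaces. -/
def IsHarishChandra {M : Type} [AddCommGroup M] [Module ℂ M] (L0 : End ℂ M) : Prop :=
  IsWeightMod L0 ∧ ∀ μ : ℂ, FiniteDimensional ℂ (L0.eigenspace μ)

/-- `M` is cuspidal (uniformly bounded): a weight module whose weight space
dimensions admit a uniform finite bound. -/
def IsCuspidalMod {M : Type} [AddCommGroup M] [Module ℂ M] (L0 : End ℂ M) : Prop :=
  IsWeightMod L0 ∧ ∃ N : ℕ, ∀ μ : ℂ, Module.rank ℂ (L0.eigenspace μ) ≤ N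

/-- The set of all operators in the image of the representation. -/
def sccOps {M : Type} [AddCommGroup M] [Module ℂ M]
    (L G : ℤ → End ℂ M) (C C1 : End ℂ M)
    (E F : ℤ → 𝕘 →ₗ[ℂ] End ℂ M) : Set (End ℂ M) :=
  Set.range L ∪ Set.range G ∪ {C, C1}
    ∪ {f | ∃ (i : ℤ) (x : 𝕘), f = E i x} ∪ {f | ∃ (i : ℤ) (x : 𝕘), f = F i x}

/-- A subspace is invariant under a set of operators. -/
def InvariantUnder {M : Type} [AddCommGroup M] [Module ℂ M]
    (S : Set (End ℂ M)) (N : Submodule ℂ M) : Prop :=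
  ∀ f ∈ S, N.map f ≤ N

/-- A subspace is graded (homogeneous) with respect to the grading `gr`. -/
def GradedSub {M : Type} [AddCommGroup M] [Module ℂ M]
    (gr : Fin 2 → Submodule ℂ M) (N : Submodule ℂ M) : Prop :=
  N ≤ (N ⊓ gr 0) ⊔ (N ⊓ gr 1)

/-- Simplicity: `M ≠ 0` and the only graded subspaces invariant under all the
operators are `0` and `M`. -/
def IsSimpleRep {M : Type} [AddCommGroup M] [Module ℂ M]
    (S : Set (End ℂ M)) (gr : Fin 2 → Submodule ℂ M) : Prop :=
  (∃ v : M, v ≠ 0) ∧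
    ∀ N : Submodule ℂ M, InvariantUnder S N → GradedSub gr N → N = ⊥ ∨ N = ⊤

section Determinants

open Matrix

variable {ι : Type} [Fintype ι] [DecidableEq ι]

/-- The determinant of a perturbation `1 + y M(y)` of the identity is polynomial in `y`, with
first-order coefficient `tr M(0)`. -/
lemma exists_polynomial_det_one_add_smul (s : ℂ) (X Y : Matrix ι ι ℂ) :
    ∃ Q : Polynomial ℂ, Q.coeff 0 = 1 ∧ Q.coeff 1 = Fintype.card ι * s ∧
      ∀ y : ℂ, (1 + y • (s • (1 : Matrix ι ι ℂ) + y • X + y ^ 2 • Y)).det = Q.eval y := by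
  set M : Matrix ι ι (Polynomial ℂ) :=
    (s • (1 : Matrix ι ι ℂ)).map Polynomial.C + (Polynomial.X : Polynomial ℂ) • X.map Polynomial.C
      + (Polynomial.X ^ 2 : Polynomial ℂ) • Y.map Polynomial.C with hM
  have hev : ∀ y : ℂ, M.map (Polynomial.eval y) = s • (1 : Matrix ι ι ℂ) + y • X + y ^ 2 • Y := by
    intro y
    ext i j
    simp [hM]
    ring
  have htr : (M.trace).coeff 0 = Fintype.card ι * s := by
    have h0 := hev 0
    rw [Polynomial.coeff_zero_eq_eval_zero, ← Polynomial.coe_evalRingHom,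
      AddMonoidHom.map_trace (Polynomial.evalRingHom (0 : ℂ))]
    simp only [Polynomial.coe_evalRingHom]
    rw [h0]
    simp [mul_comm]
  refine ⟨(1 + (Polynomial.X : Polynomial ℂ) • M).det, ?_, ?_, fun y => ?_⟩
  · rw [det_one_add_smul]
    simp [pow_two, Polynomial.mul_coeff_zero]
  · rw [det_one_add_smul, Polynomial.coeff_add, Polynomial.coeff_add, Polynomial.coeff_mul_X,
      htr, Polynomial.coeff_mul_X_pow']
    simp [Polynomial.coeff_one]
  · rw [← Polynomial.coe_evalRingHom, RingHom.map_det]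
    congr 1
    rw [← hev y]
    ext i j
    simp [Matrix.one_apply, apply_ite (Polynomial.eval y)]

lemma exists_polynomial_det_cubic (s : ℂ) (X Y : Matrix ι ι ℂ) :
    ∃ Q : Polynomial ℂ, Q.coeff 0 = 1 ∧ Q.coeff 1 = Fintype.card ι * s ∧
      ∀ x : ℂ, x ≠ 0 → ((x ^ 3 + s * x ^ 2) • (1 : Matrix ι ι ℂ) + x • X + Y).det
        = (x ^ Fintype.card ι) ^ 3 * Q.eval x⁻¹ := by
  obtain ⟨Q, h0, h1, hQ⟩ := exists_polynomial_det_one_add_smul s X Y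
  refine ⟨Q, h0, h1, fun x hx => ?_⟩
  rw [← hQ, ← pow_mul, mul_comm (Fintype.card ι), pow_mul, ← det_smul]
  congr 1
  ext i j
  simp only [Matrix.add_apply, Matrix.smul_apply, smul_eq_mul]
  field_simp
  ring

lemma exists_polynomial_det_quadratic (s : ℂ) (X : Matrix ι ι ℂ) :
    ∃ Q : Polynomial ℂ, Q.coeff 0 = 1 ∧ Q.coeff 1 = Fintype.card ι * s ∧
      ∀ x : ℂ, x ≠ 0 → ((x ^ 2 + s * x) • (1 : Matrix ι ι ℂ) + X).det
        = (x ^ Fintype.card ι) ^ 2 * Q.eval x⁻¹ := by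
  obtain ⟨Q, h0, h1, hQ⟩ := exists_polynomial_det_one_add_smul s X 0
  refine ⟨Q, h0, h1, fun x hx => ?_⟩
  rw [← hQ, ← pow_mul, mul_comm (Fintype.card ι), pow_mul, ← det_smul]
  congr 1
  ext i j
  simp only [Matrix.add_apply, Matrix.smul_apply, smul_eq_mul, Matrix.zero_apply]
  field_simp
  ring

lemma det_eq_of_mul_eq_mul {A X Y : Matrix ι ι ℂ} (hA : A.det ≠ 0) (h : X * A = A * Y) :
    X.det = Y.det := by
  have := congrArg det h
  rw [det_mul, det_mul, mul_comm] at this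
  exact mul_left_cancel₀ hA this

/-- Matrices `a n, b n, e n, f n` satisfying the relations between `L₁, L₋₁, L₂, L₋₂` on weight
spaces of common positive dimension force the central charge to vanish: each of the products
`f a a`, `e b b`, `b a`, `f e` has a determinant polynomial in `n`, and the multiplicativity of
the determinant relates their subleading coefficients. -/
lemma central_charge_eq_zero_of_matrices [Nonempty ι] (l c : ℂ) (a b e f : ℕ → Matrix ι ι ℂ)
    (ha : ∀ n, (a n).det ≠ 0) (hb : ∀ n, (b n).det ≠ 0) (he : ∀ m, (e (2 * m)).det ≠ 0)
    (hba : ∀ n : ℕ, b (n + 1) * a (n + 1) - a n * b n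
      = (2 * (l + n + 1)) • (1 : Matrix ι ι ℂ))
    (hfe : ∀ n : ℕ, f (n + 2) * e (n + 2) - e n * f n
      = (4 * (l + n + 2) - c / 2) • (1 : Matrix ι ι ℂ))
    (haf : ∀ n, a n * f n - f (n + 1) * a (n + 2) = (-3 : ℂ) • b (n + 1))
    (hbe : ∀ n, b (n + 2) * e (n + 1) - e n * b n = (3 : ℂ) • a (n + 1)) :
    c = 0 := by
  -- products of the `a n`, `b n`, `e n` along chains
  let A : ℕ → Matrix ι ι ℂ := fun n => Nat.rec 1 (fun k M => a k * M) n
  let B : ℕ → Matrix ι ι ℂ := fun n => Nat.rec 1 (fun k M => M * b (k + 2)) n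
  let D : ℕ → Matrix ι ι ℂ := fun n => Nat.rec 1 (fun k M => e (2 * k) * M) n
  have hA0 : A 0 = 1 := rfl
  have hB0 : B 0 = 1 := rfl
  have hD0 : D 0 = 1 := rfl
  have hAs : ∀ n, A (n + 1) = a n * A n := fun n => rfl
  have hBs : ∀ n, B (n + 1) = B n * b (n + 2) := fun n => rfl
  have hDs : ∀ n, D (n + 1) = e (2 * n) * D n := fun n => rfl
  have hA : ∀ n, (A n).det ≠ 0 := by
    intro n
    induction n with
    | zero => simp [hA0]
    | succ n ih => rw [hAs, det_mul]; exact mul_ne_zero (ha n) ih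
  have hB : ∀ n, (B n).det ≠ 0 := by
    intro n
    induction n with
    | zero => simp [hB0]
    | succ n ih => rw [hBs, det_mul]; exact mul_ne_zero ih (hb _)
  have hD : ∀ n, (D n).det ≠ 0 := by
    intro n
    induction n with
    | zero => simp [hD0]
    | succ n ih => rw [hDs, det_mul]; exact mul_ne_zero (he n) ih
  -- the products `b a`, `f a a`, `a b`, `e b b`, `f e` in these frames
  have hh : ∀ n : ℕ, (b n * a n) * A n
      = A n * (((n : ℂ) ^ 2 + (1 + 2 * l) * n) • (1 : Matrix ι ι ℂ) + b 0 * a 0) := by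
    intro n
    induction n with
    | zero => simp [hA0]
    | succ n ih =>
      have h1 : b (n + 1) * a (n + 1) * A (n + 1)
          = a n * (b n * a n * A n) + (2 * (l + n + 1)) • (a n * A n) := by
        rw [eq_add_of_sub_eq (hba n), hAs, add_mul, smul_mul_assoc, one_mul]
        noncomm_ring
      rw [h1, ih, hAs]
      push_cast
      simp only [mul_add, mul_smul_comm, mul_one, ← mul_assoc]
      module
  have hZ : ∀ n : ℕ, (f n * a (n + 1) * a n) * A n
      = A n * (((n : ℂ) ^ 3 + (3 + 3 * l) * n ^ 2) • (1 : Matrix ι ι ℂ)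
        + (n : ℂ) • ((3 : ℂ) • (b 0 * a 0) + (2 + 3 * l) • (1 : Matrix ι ι ℂ))
        + f 0 * a 1 * a 0) := by
    intro n
    induction n with
    | zero => simp [hA0]
    | succ n ih =>
      have h0 : f (n + 1) * a (n + 2) = a n * f n + (3 : ℂ) • b (n + 1) := by
        have := haf n
        rw [sub_eq_iff_eq_add] at this
        rw [this]
        module
      have h1 : f (n + 1) * a (n + 1 + 1) * a (n + 1) * A (n + 1)
          = a n * (f n * a (n + 1) * a n * A n)
            + (3 : ℂ) • (b (n + 1) * a (n + 1) * A (n + 1)) := by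
        rw [h0, hAs]
        simp only [add_mul, smul_mul_assoc]
        noncomm_ring
      rw [h1, ih, hh, hAs]
      push_cast
      simp only [mul_add, mul_smul_comm, mul_one, ← mul_assoc, smul_add, smul_smul]
      module
  have hk : ∀ n : ℕ, B n * (a (n + 1) * b (n + 1))
      = (((n : ℂ) ^ 2 + (3 + 2 * l) * n) • (1 : Matrix ι ι ℂ) + a 1 * b 1) * B n := by
    intro n
    induction n with
    | zero => simp [hB0]
    | succ n ih =>
      have h1 : B (n + 1) * (a (n + 1 + 1) * b (n + 1 + 1))
          = B n * (a (n + 1) * b (n + 1)) * b (n + 2)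
            + (2 * (l + n + 2)) • (B n * b (n + 2)) := by
        have h2 := eq_add_of_sub_eq (hba (n + 1))
        have h3 : B (n + 1) * (a (n + 1 + 1) * b (n + 1 + 1))
          = B n * (b (n + 1 + 1) * a (n + 1 + 1)) * b (n + 2) := by
          rw [hBs]; noncomm_ring
        rw [h3, h2]
        push_cast
        simp only [mul_add, add_mul, mul_smul_comm, smul_mul_assoc, mul_one, ← mul_assoc]
        module
      rw [h1, ih, hBs]
      push_cast
      simp only [add_mul, smul_mul_assoc, one_mul, ← mul_assoc]
      module
  have hY : ∀ n : ℕ, B n * (e n * b n * b (n + 1))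
      = (((n : ℂ) ^ 3 + (3 + 3 * l) * n ^ 2) • (1 : Matrix ι ι ℂ)
        + (n : ℂ) • ((3 : ℂ) • (a 1 * b 1) + (- 4 - 3 * l) • (1 : Matrix ι ι ℂ))
        + e 0 * b 0 * b 1) * B n := by
    intro n
    induction n with
    | zero => simp [hB0]
    | succ n ih =>
      have h1 : B (n + 1) * (e (n + 1) * b (n + 1) * b (n + 1 + 1))
          = B n * (e n * b n * b (n + 1)) * b (n + 2)
            + (3 : ℂ) • (B n * (a (n + 1) * b (n + 1)) * b (n + 2)) := by
        have h3 : B (n + 1) * (e (n + 1) * b (n + 1) * b (n + 1 + 1))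
          = B n * (b (n + 2) * e (n + 1)) * b (n + 1) * b (n + 2) := by
          rw [hBs]; noncomm_ring
        rw [h3, eq_add_of_sub_eq (hbe n)]
        simp only [mul_add, add_mul, mul_smul_comm, smul_mul_assoc, ← mul_assoc]
        module
      rw [h1, ih, hk, hBs]
      push_cast
      simp only [add_mul, smul_mul_assoc, one_mul, ← mul_assoc, smul_add, smul_smul]
      module
  have hW : ∀ m : ℕ, (f (2 * m) * e (2 * m)) * D m
      = D m * ((((2 * m : ℕ) : ℂ) ^ 2 + (2 + 2 * l - c / 4) * (2 * m : ℕ))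
        • (1 : Matrix ι ι ℂ) + f 0 * e 0) := by
    intro m
    induction m with
    | zero => simp [hD0]
    | succ m ih =>
      have h1 : f (2 * (m + 1)) * e (2 * (m + 1)) * D (m + 1)
          = e (2 * m) * (f (2 * m) * e (2 * m) * D m)
            + (4 * (l + 2 * m + 2) - c / 2) • (e (2 * m) * D m) := by
        rw [show 2 * (m + 1) = 2 * m + 2 by ring, eq_add_of_sub_eq (hfe (2 * m)), hDs, add_mul,
          smul_mul_assoc, one_mul]
        push_cast
        noncomm_ring
      rw [h1, ih, hDs]
      push_cast
      simp only [mul_add, mul_smul_comm, mul_one, ← mul_assoc]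
      module
  obtain ⟨Q₁, h10, h11, hQ₁⟩ := exists_polynomial_det_cubic (3 + 3 * l)
    ((3 : ℂ) • (b 0 * a 0) + (2 + 3 * l) • (1 : Matrix ι ι ℂ)) (f 0 * a 1 * a 0)
  obtain ⟨Q₂, h20, h21, hQ₂⟩ := exists_polynomial_det_cubic (3 + 3 * l)
    ((3 : ℂ) • (a 1 * b 1) + (- 4 - 3 * l) • (1 : Matrix ι ι ℂ)) (e 0 * b 0 * b 1)
  obtain ⟨Q₃, h30, h31, hQ₃⟩ := exists_polynomial_det_quadratic (1 + 2 * l) (b 0 * a 0)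
  obtain ⟨Q₄, h40, h41, hQ₄⟩ := exists_polynomial_det_quadratic (3 + 2 * l) (a 1 * b 1)
  obtain ⟨Q₅, h50, h51, hQ₅⟩ := exists_polynomial_det_quadratic (2 + 2 * l - c / 4) (f 0 * e 0)
  have key : Q₁ * Q₂ = Q₃ * Q₄ * Q₅ := by
    refine Polynomial.eq_of_infinite_eval_eq _ _ (Set.Infinite.mono ?_ (Set.infinite_range_of_injective
      (f := fun m : ℕ => (((2 * (m + 1) : ℕ) : ℂ))⁻¹) ?_))
    · rintro _ ⟨m, rfl⟩
      set n := 2 * (m + 1) with hn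
      have hx : ((n : ℕ) : ℂ) ≠ 0 := by simp [hn]; norm_cast
      have e1 := (det_eq_of_mul_eq_mul (hA n) (hZ n)).trans (hQ₁ _ hx)
      have e2 := (det_eq_of_mul_eq_mul (hB n) (hY n).symm).symm.trans (hQ₂ _ hx)
      have e3 := (det_eq_of_mul_eq_mul (hA n) (hh n)).trans (hQ₃ _ hx)
      have e4 := (det_eq_of_mul_eq_mul (hB n) (hk n).symm).symm.trans (hQ₄ _ hx)
      have e5 := (det_eq_of_mul_eq_mul (hD (m + 1)) (hW (m + 1))).trans (hQ₅ _ hx)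
      simp only [det_mul, ← hn] at e1 e2 e3 e4 e5
      simp only [Set.mem_ofPred_eq, Polynomial.eval_mul]
      have hp : ((n : ℂ) ^ Fintype.card ι) ^ 6 ≠ 0 := pow_ne_zero _ (pow_ne_zero _ hx)
      refine mul_left_cancel₀ hp ?_
      calc _ = (((n : ℂ) ^ Fintype.card ι) ^ 3 * Q₁.eval (n : ℂ)⁻¹)
            * (((n : ℂ) ^ Fintype.card ι) ^ 3 * Q₂.eval (n : ℂ)⁻¹) := by ring
        _ = (((n : ℂ) ^ Fintype.card ι) ^ 2 * Q₃.eval (n : ℂ)⁻¹)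
            * (((n : ℂ) ^ Fintype.card ι) ^ 2 * Q₄.eval (n : ℂ)⁻¹)
            * (((n : ℂ) ^ Fintype.card ι) ^ 2 * Q₅.eval (n : ℂ)⁻¹) := by
          rw [← e1, ← e2, ← e3, ← e4, ← e5]; ring
        _ = _ := by ring
    · intro m m' h
      have := inv_injective h
      norm_cast at this
      omega
  have h1 := congrArg (fun P => Polynomial.coeff P 1) key
  simp only [Polynomial.mul_coeff_one, Polynomial.mul_coeff_zero, h10, h20, h30, h40, h50, h11,
    h21, h31, h41, h51] at h1
  have hcard : (Fintype.card ι : ℂ) ≠ 0 := by simp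
  have : (Fintype.card ι : ℂ) * c = 0 := by linear_combination 4 * h1
  exact (mul_eq_zero.mp this).resolve_left hcard

end Determinants

section Virasoro

variable {V : Type} [AddCommGroup V] [Module ℂ V]

/-- Vectors that are killed by distinct powers of `e` are linearly independent. -/
lemma linearIndepOn_of_pow_apply (e : End ℂ V) (w : ℕ → V) (s : Finset ℕ)
    (h0 : ∀ k ∈ s, (e ^ k) (w k) ≠ 0) (h1 : ∀ k ∈ s, (e ^ (k + 1)) (w k) = 0) :
    LinearIndepOn ℂ w (s : Set ℕ) := by
  rw [linearIndepOn_finset_iff]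
  intro g hg
  by_contra! hne
  obtain ⟨i, hi, hgi⟩ := hne
  obtain ⟨k, hk, hmax⟩ := (s.filter fun i => g i ≠ 0).exists_max_image id ⟨i, by simp [hi, hgi]⟩
  simp only [Finset.mem_filter, id] at hk hmax
  have h := congrArg (e ^ k) hg
  rw [map_sum, map_zero, Finset.sum_eq_single k] at h
  · rw [map_smul, smul_eq_zero] at h
    exact h.elim hk.2 (h0 k hk.1)
  · intro j hj hjk
    by_cases hgj : g j = 0
    · simp [hgj]
    have hlt : j < k := lt_of_le_of_ne (hmax j ⟨hj, hgj⟩) hjk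
    obtain ⟨r, rfl⟩ := Nat.exists_eq_add_of_lt hlt
    rw [map_smul, show j + r + 1 = r + (j + 1) by ring, pow_add, Module.End.mul_apply, h1 j hj]
    simp
  · exact fun hks => absurd hk.1 hks

/-- The operators `L i` form a representation of the Virasoro algebra of central charge `c`. -/
def IsVirasoroRep (L : ℤ → End ℂ V) (c : ℂ) : Prop :=
  ∀ i j : ℤ, L i * L j - L j * L i = ((j : ℂ) - (i : ℂ)) • L (i + j)
    + (if i + j = 0 then ((i : ℂ) ^ 3 - (i : ℂ)) / 12 * c else 0) • (1 : End ℂ V)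

namespace IsVirasoroRep

variable {L : ℤ → End ℂ V} {c : ℂ}

lemma mapsTo_eigenspace (h : IsVirasoroRep L c) (i : ℤ) {μ : ℂ} {v : V}
    (hv : v ∈ (L 0).eigenspace μ) : L i v ∈ (L 0).eigenspace (μ + i) := by
  rw [Module.End.mem_eigenspace_iff] at hv ⊢
  have h1 := LinearMap.congr_fun (h 0 i) v
  simp only [LinearMap.sub_apply, Module.End.mul_apply, hv, map_smul, LinearMap.add_apply,
    LinearMap.smul_apply, zero_add, Int.cast_zero, sub_zero] at h1
  rw [sub_eq_iff_eq_add] at h1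
  rw [h1]
  split_ifs with hi
  · simp [hi]
  · module

lemma pow_mapsTo_eigenspace (h : IsVirasoroRep L c) (i : ℤ) (k : ℕ) {μ : ℂ} {v : V}
    (hv : v ∈ (L 0).eigenspace μ) : (L i ^ k) v ∈ (L 0).eigenspace (μ + k * i) := by
  induction k with
  | zero => simpa using hv
  | succ k ih =>
    rw [pow_succ', Module.End.mul_apply]
    convert h.mapsTo_eigenspace i ih using 2
    push_cast; ring

lemma commutator_neg_apply (h : IsVirasoroRep L c) (i : ℤ) {μ : ℂ} {v : V}
    (hv : v ∈ (L 0).eigenspace μ) :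
    L i (L (-i) v) = L (-i) (L i v) + (-2 * i * μ + ((i : ℂ) ^ 3 - i) / 12 * c) • v := by
  rw [Module.End.mem_eigenspace_iff] at hv
  have h1 := LinearMap.congr_fun (h i (-i)) v
  simp only [LinearMap.sub_apply, Module.End.mul_apply, LinearMap.add_apply,
    LinearMap.smul_apply, add_neg_cancel, hv, if_true, Module.End.one_apply] at h1
  rw [sub_eq_iff_eq_add'] at h1
  rw [h1]
  push_cast
  module

/-- The operator `L i` applied to the `(k + 1)`-st power of `L (-i)` on a vector of weight `μ`
killed by `L i`. -/
lemma apply_pow_succ (h : IsVirasoroRep L c) (i : ℤ) {μ : ℂ} {v : V}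
    (hv : v ∈ (L 0).eigenspace μ) (h0 : L i v = 0) (k : ℕ) :
    L i ((L (-i) ^ (k + 1)) v) = (((k : ℂ) + 1) *
      (-2 * i * μ + (i : ℂ) ^ 2 * k + ((i : ℂ) ^ 3 - i) / 12 * c)) • (L (-i) ^ k) v := by
  induction k with
  | zero => simp [h.commutator_neg_apply i hv, h0]
  | succ k ih =>
    rw [pow_succ' _ (k + 1), Module.End.mul_apply,
      h.commutator_neg_apply i (h.pow_mapsTo_eigenspace (-i) (k + 1) hv), ih, map_smul,
      ← Module.End.mul_apply, ← pow_succ', ← add_smul]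
    congr 1
    push_cast
    ring

lemma pow_apply_pow (h : IsVirasoroRep L c) (i : ℤ) {μ : ℂ} {v : V}
    (hv : v ∈ (L 0).eigenspace μ) (hv0 : v ≠ 0) (h0 : L i v = 0) (k : ℕ)
    (hne : ∀ j < k, -2 * i * μ + (i : ℂ) ^ 2 * j + ((i : ℂ) ^ 3 - i) / 12 * c ≠ 0) :
    (L i ^ k) ((L (-i) ^ k) v) ≠ 0 ∧ (L i ^ (k + 1)) ((L (-i) ^ k) v) = 0 := by
  have key : ∀ j ≤ k, ∃ r : ℂ, r ≠ 0 ∧ (L i ^ j) ((L (-i) ^ j) v) = r • v := by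
    intro j
    induction j with
    | zero => exact fun _ => ⟨1, one_ne_zero, by simp⟩
    | succ j ih =>
      intro hj
      obtain ⟨r, hr, hrv⟩ := ih (by omega)
      refine ⟨_, mul_ne_zero (mul_ne_zero (Nat.cast_add_one_ne_zero j) (hne j (by omega))) hr, ?_⟩
      rw [pow_succ (L i), Module.End.mul_apply, h.apply_pow_succ i hv h0, map_smul, hrv, smul_smul]
  obtain ⟨r, hr, hrv⟩ := key k le_rfl
  refine ⟨by rw [hrv]; exact smul_ne_zero hr hv0, ?_⟩
  rw [pow_succ', Module.End.mul_apply, hrv, map_smul, h0, smul_zero]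

/-- The number of weights `ν + k i` carrying a kernel vector of `L i` that survives descending to
weight `ν` is at most the dimension of the weight space of weight `ν`. -/
lemma card_le_of_kernel_vectors (h : IsVirasoroRep L c) (i : ℤ) (ν : ℂ) (N : ℕ)
    (hN : Module.rank ℂ ((L 0).eigenspace ν) ≤ N) (s : Finset ℕ)
    (hs : ∀ k ∈ s, ∃ v ∈ (L 0).eigenspace (ν + k * i), v ≠ 0 ∧ L i v = 0)
    (hne : ∀ k ∈ s, ∀ j < k,
      -2 * i * (ν + k * i) + (i : ℂ) ^ 2 * j + ((i : ℂ) ^ 3 - i) / 12 * c ≠ 0) :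
    s.card ≤ N := by
  choose! v hv hv0 hLv using hs
  have hli := linearIndepOn_of_pow_apply (L i) (fun k => (L (-i) ^ k) (v k)) s
    (fun k hk => (h.pow_apply_pow i (hv k hk) (hv0 k hk) (hLv k hk) k (hne k hk)).1)
    (fun k hk => (h.pow_apply_pow i (hv k hk) (hv0 k hk) (hLv k hk) k (hne k hk)).2)
  have hmem : ∀ k : s, (L (-i) ^ (k : ℕ)) (v k) ∈ (L 0).eigenspace ν := by
    intro k
    convert h.pow_mapsTo_eigenspace (-i) k (hv k k.2) using 2
    push_cast; ring
  have hli' : LinearIndependent ℂ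
      (fun k : s => (⟨(L (-i) ^ (k : ℕ)) (v k), hmem k⟩ : (L 0).eigenspace ν)) := by
    refine LinearIndependent.of_comp ((L 0).eigenspace ν).subtype ?_
    exact hli
  have := hli'.cardinal_le_rank.trans hN
  simpa using this

lemma finite_of_card_le {S : Set ℕ} {N : ℕ}
    (h : ∀ s : Finset ℕ, (s : Set ℕ) ⊆ S → s.card ≤ N) : S.Finite := by
  by_contra hS
  obtain ⟨s, hs, hcard⟩ := Set.Infinite.exists_subset_card_eq hS (N + 1)
  have := h s hs
  omega

/-- `L i` is injective on all but finitely many weight spaces in the direction of `i`. -/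
lemma finite_kernel_raising (h : IsVirasoroRep L c) (i : ℕ) (hi : 0 < i) (ν : ℂ) (N : ℕ)
    (hN : ∀ μ, Module.rank ℂ ((L 0).eigenspace μ) ≤ N)
    (hν : ((i : ℝ) ^ 2 - 1) / 24 * c.re < ν.re) :
    {k : ℕ | ∃ v ∈ (L 0).eigenspace (ν + k * i), v ≠ 0 ∧ L i v = 0}.Finite := by
  refine finite_of_card_le (N := N) fun s hs =>
    h.card_le_of_kernel_vectors i ν N (hN ν) s (fun k hk => by simpa using hs hk)
      fun k _ j hj h0 => ?_
  have h1 := congrArg Complex.re h0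
  have hi' : (0 : ℝ) < i := by exact_mod_cast hi
  have hj' : (j : ℝ) + 1 ≤ k := by exact_mod_cast hj
  have h2 : -2 * i * (ν + k * i) + (i : ℂ) ^ 2 * j + ((i : ℂ) ^ 3 - i) / 12 * c
      = ((-2 * i : ℝ) : ℂ) * ν + (((i : ℝ) ^ 3 - i) / 12 : ℝ) * c
        + ((-2 * i * k * i + (i : ℝ) ^ 2 * j : ℝ) : ℂ) := by
    push_cast; ring
  push_cast at h1
  rw [h2, Complex.add_re, Complex.add_re, Complex.re_ofReal_mul, Complex.re_ofReal_mul,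
    Complex.ofReal_re, Complex.zero_re] at h1
  have h3 : (2 * i) * (ν.re - ((i : ℝ) ^ 2 - 1) / 24 * c.re) + (i : ℝ) ^ 2 * (2 * k - j) = 0 := by
    linear_combination -h1
  have h4 : 0 < (2 * i) * (ν.re - ((i : ℝ) ^ 2 - 1) / 24 * c.re) :=
    mul_pos (by positivity) (by linarith)
  have h5 : 0 ≤ (i : ℝ) ^ 2 * (2 * k - j) :=
    mul_nonneg (by positivity) (by linarith [(Nat.cast_nonneg k : (0 : ℝ) ≤ k)])
  linarith

/-- `L₋₁` is injective on all but finitely many weight spaces in the positive direction. -/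
lemma finite_kernel_lowering (h : IsVirasoroRep L c) (ν : ℂ) (N : ℕ)
    (hN : ∀ μ, Module.rank ℂ ((L 0).eigenspace μ) ≤ N) (hν : 0 < ν.re) :
    {k : ℕ | ∃ v ∈ (L 0).eigenspace (ν + k), v ≠ 0 ∧ L (-1) v = 0}.Finite := by
  refine finite_of_card_le (N := N) fun s hs => ?_
  set M := s.sup id with hM
  have hle : ∀ k ∈ s, k ≤ M := fun k hk => Finset.le_sup (f := id) hk
  have hinj : Set.InjOn (fun k => M - k) (s : Set ℕ) := by
    intro x hx y hy hxy
    have := hle x hx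
    have := hle y hy
    simp only at hxy
    omega
  rw [← Finset.card_image_of_injOn hinj]
  refine h.card_le_of_kernel_vectors (-1) (ν + M) N (hN _) _ (fun k hk => ?_)
    fun k hk j hj h0 => ?_
  · obtain ⟨r, hr, rfl⟩ := Finset.mem_image.mp hk
    obtain ⟨v, hv, hv'⟩ := hs hr
    refine ⟨v, ?_, hv'⟩
    convert hv using 2
    rw [Nat.cast_sub (hle r hr)]
    push_cast; ring
  · obtain ⟨r, hr, rfl⟩ := Finset.mem_image.mp hk
    rw [Nat.cast_sub (hle r hr)] at h0
    have h1 : 2 * (ν + r) + j = 0 := by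
      push_cast at h0
      linear_combination h0
    have h2 := congrArg Complex.re h1
    simp at h2
    have : (0 : ℝ) ≤ r := Nat.cast_nonneg r
    have : (0 : ℝ) ≤ j := Nat.cast_nonneg j
    linarith

end IsVirasoroRep

end Virasoro

section VirasoroCentralCharge

variable {V : Type} [AddCommGroup V] [Module ℂ V]

lemma exists_eventually_const_of_bounded {D : ℕ → ℕ} {K N : ℕ}
    (hmono : ∀ n, K ≤ n → D n ≤ D (n + 1)) (hN : ∀ n, D n ≤ N) :
    ∃ n₀ ≥ K, ∃ d, ∀ n ≥ n₀, D n = d := by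
  have hbdd : BddAbove (Set.range fun n => D (K + n)) := ⟨N, by rintro _ ⟨n, rfl⟩; exact hN _⟩
  obtain ⟨m, hm⟩ := Nat.sSup_mem (Set.range_nonempty fun n => D (K + n)) hbdd
  simp only at hm
  refine ⟨K + m, by omega, _, fun n hn => le_antisymm (le_csSup hbdd ⟨n - K, ?_⟩) ?_⟩
  · simp only
    congr 1
    omega
  · rw [← hm]
    induction n, hn using Nat.le_induction with
    | base => exact le_rfl
    | succ n hn ih => exact ih.trans (hmono n (by omega))

namespace IsVirasoroRep

variable {L : ℤ → End ℂ V} {c : ℂ}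

/-- If the weight spaces of weights `l + n` all have the same positive dimension and `L₁, L₋₁, L₂`
are injective on them, then the central charge vanishes. -/
lemma central_charge_eq_zero_of_finrank_eq (h : IsVirasoroRep L c) (l : ℂ) (d : ℕ) (hd : 0 < d)
    (hfd : ∀ n : ℕ, FiniteDimensional ℂ ((L 0).eigenspace (l + n)))
    (hdim : ∀ n : ℕ, finrank ℂ ((L 0).eigenspace (l + n)) = d)
    (h1 : ∀ n : ℕ, ∀ v ∈ (L 0).eigenspace (l + n), L 1 v = 0 → v = 0)
    (h1' : ∀ n : ℕ, ∀ v ∈ (L 0).eigenspace (l + n), L (-1) v = 0 → v = 0)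
    (h2 : ∀ m : ℕ, ∀ v ∈ (L 0).eigenspace (l + (2 * m : ℕ)), L 2 v = 0 → v = 0) : c = 0 := by
  have hex : ∀ n : ℕ, ∃ (ι : (Fin d → ℂ) →ₗ[ℂ] V) (π : V →ₗ[ℂ] (Fin d → ℂ)),
      (∀ u, ι u ∈ (L 0).eigenspace (l + n)) ∧ (∀ u, π (ι u) = u) ∧
      ∀ v ∈ (L 0).eigenspace (l + n), ι (π v) = v := by
    intro n
    have := hfd n
    let φ : (Fin d → ℂ) ≃ₗ[ℂ] (L 0).eigenspace (l + n) :=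
      LinearEquiv.ofFinrankEq _ _ (by rw [hdim n]; simp)
    obtain ⟨π, hπ⟩ := LinearMap.exists_leftInverse_of_injective
      (((L 0).eigenspace (l + n)).subtype ∘ₗ φ.toLinearMap)
      (LinearMap.ker_eq_bot.mpr (Subtype.val_injective.comp φ.injective))
    have hπ' : ∀ u, π ((φ u : (L 0).eigenspace (l + n)) : V) = u :=
      fun u => LinearMap.congr_fun hπ u
    refine ⟨((L 0).eigenspace (l + n)).subtype ∘ₗ φ.toLinearMap, π, fun u => (φ u).2, hπ', fun v hv => ?_⟩
    obtain ⟨u, hu⟩ := φ.surjective ⟨v, hv⟩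
    have hv' : v = (φ u : V) := by rw [hu]
    rw [hv', hπ']
    rfl
  choose ι π hι hπι hιπ using hex
  let M (i j : ℕ) (f : End ℂ V) : Matrix (Fin d) (Fin d) ℂ :=
    LinearMap.toMatrix' (π j ∘ₗ f ∘ₗ ι i)
  have hmul : ∀ (i j k : ℕ) (s : ℤ) (g : End ℂ V), (j : ℤ) = i + s →
      M j k g * M i j (L s) = M i k (g * L s) := by
    intro i j k s g hs
    simp only [M]
    rw [← LinearMap.toMatrix'_comp]
    congr 1
    ext1 u
    ext1
    simp only [LinearMap.comp_apply, Module.End.mul_apply]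
    rw [hιπ]
    convert h.mapsTo_eigenspace s (hι i _) using 2
    have : (j : ℂ) = i + s := by exact_mod_cast congrArg (Int.cast : ℤ → ℂ) hs
    rw [this]; ring
  have hsub : ∀ i j f g, M i j (f - g) = M i j f - M i j g := by
    intro i j f g
    simp only [M, ← map_sub, LinearMap.sub_comp, LinearMap.comp_sub]
  have hdet : ∀ (i j : ℕ) (s : ℤ), (j : ℤ) = i + s →
      (∀ v ∈ (L 0).eigenspace (l + i), L s v = 0 → v = 0) → (M i j (L s)).det ≠ 0 := by
    intro i j s hs hinj h0
    obtain ⟨u, hu, hu0⟩ := Matrix.exists_mulVec_eq_zero_iff.mpr h0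
    simp only [M, LinearMap.toMatrix'_mulVec, LinearMap.comp_apply] at hu0
    have hmem : L s (ι i u) ∈ (L 0).eigenspace (l + j) := by
      convert h.mapsTo_eigenspace s (hι i u) using 2
      have : (j : ℂ) = i + s := by exact_mod_cast congrArg (Int.cast : ℤ → ℂ) hs
      rw [this]; ring
    have h3 := hιπ j _ hmem
    rw [hu0, map_zero] at h3
    apply hu
    rw [← hπι i u, hinj _ (hι i u) h3.symm, map_zero]
  have hsmul : ∀ i j (r : ℂ) f, M i j (r • f) = r • M i j f := by
    intro i j r f
    simp only [M, ← map_smul, LinearMap.smul_comp, LinearMap.comp_smul]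
  have hneg : ∀ i j f, M i j (-f) = -M i j f := by
    intro i j f
    simpa using hsmul i j (-1) f
  have hadd : ∀ i j f g, M i j (f + g) = M i j f + M i j g := by
    intro i j f g
    simp only [M, ← map_add, LinearMap.add_comp, LinearMap.comp_add]
  have hone : ∀ i, M i i 1 = 1 := by
    intro i
    simp only [M]
    rw [← LinearMap.toMatrix'_id]
    congr 1
    ext1 u
    ext1
    simp [hπι]
  have hzero : ∀ i : ℕ, M i i (L 0) = (l + i) • (1 : Matrix (Fin d) (Fin d) ℂ) := by
    intro i
    rw [← hone i, ← hsmul]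
    simp only [M]
    congr 1
    ext1 u
    ext1
    simp only [LinearMap.comp_apply, LinearMap.smul_apply, Module.End.one_apply]
    rw [Module.End.mem_eigenspace_iff.mp (hι i _)]
  have : Nonempty (Fin d) := ⟨⟨0, hd⟩⟩
  refine central_charge_eq_zero_of_matrices l c (fun n => M n (n + 1) (L 1))
    (fun n => M (n + 1) n (L (-1))) (fun n => M n (n + 2) (L 2)) (fun n => M (n + 2) n (L (-2)))
    (fun n => hdet _ _ _ (by push_cast; ring) (h1 n))
    (fun n => hdet _ _ _ (by push_cast; ring) (h1' (n + 1)))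
    (fun m => hdet _ _ _ (by push_cast; ring) (h2 m)) ?_ ?_ ?_ ?_
  · intro n
    rw [hmul _ _ _ _ _ (by push_cast; ring), hmul _ _ _ _ _ (by push_cast; ring), ← hsub, h]
    norm_num [hsmul, hzero, smul_smul]
    ring_nf
  · intro n
    rw [hmul _ _ _ _ _ (by push_cast; ring), hmul _ _ _ _ _ (by push_cast; ring), ← hsub, h]
    norm_num [hsmul, hadd, hneg, hone, hzero, smul_smul, ← add_smul, ← neg_smul]
    ring
  · intro n
    rw [hmul _ _ _ _ _ (by push_cast; ring), hmul _ _ _ _ _ (by push_cast; ring), ← hsub, h]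
    norm_num [hsmul, hneg]
  · intro n
    rw [hmul _ _ _ _ _ (by push_cast; ring), hmul _ _ _ _ _ (by push_cast; ring), ← hsub, h]
    norm_num [hsmul, hneg]

lemma central_charge_eq_zero_of_infinite (h : IsVirasoroRep L c) (N : ℕ)
    (hN : ∀ μ, Module.rank ℂ ((L 0).eigenspace μ) ≤ N) (ν : ℂ)
    (hinf : {n : ℕ | (L 0).eigenspace (ν + n) ≠ ⊥}.Infinite) : c = 0 := by
  have hfd : ∀ μ, FiniteDimensional ℂ ((L 0).eigenspace μ) := fun μ =>
    Module.rank_lt_aleph0_iff.mp ((hN μ).trans_lt (Cardinal.natCast_lt_aleph0))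
  have hfr : ∀ μ, finrank ℂ ((L 0).eigenspace μ) ≤ N := fun μ =>
    finrank_le_of_rank_le (hN μ)
  obtain ⟨M₀, hM₀⟩ := exists_nat_gt (max (-ν.re) (c.re / 8 - ν.re))
  have hp : 0 < (ν + M₀).re := by
    simp only [Complex.add_re, Complex.natCast_re]
    linarith [le_max_left (-ν.re) (c.re / 8 - ν.re)]
  have hq : c.re / 8 < (ν + M₀).re := by
    simp only [Complex.add_re, Complex.natCast_re]
    linarith [le_max_right (-ν.re) (c.re / 8 - ν.re)]
  have hS := ((h.finite_kernel_raising 1 one_pos (ν + M₀) N hN (by norm_num; simpa using hp)).union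
    (h.finite_kernel_raising 2 two_pos (ν + M₀) N hN (by norm_num at hq ⊢; linarith))).union
    (h.finite_kernel_lowering (ν + M₀) N hN hp)
  obtain ⟨K, hK⟩ := hS.bddAbove
  have k1 : ∀ n > K, ∀ v ∈ (L 0).eigenspace (ν + M₀ + n), L 1 v = 0 → v = 0 := by
    intro n hn v hv hLv
    by_contra hv0
    exact absurd (hK (Or.inl (Or.inl ⟨v, by simpa using hv, hv0, by simpa using hLv⟩))) (by omega)
  have k2 : ∀ n > K, ∀ v ∈ (L 0).eigenspace (ν + M₀ + (2 * n : ℕ)), L 2 v = 0 → v = 0 := by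
    intro n hn v hv hLv
    by_contra hv0
    refine absurd (hK (Or.inl (Or.inr ⟨v, ?_, hv0, by simpa using hLv⟩))) (not_le.mpr hn)
    convert hv using 2
    push_cast; ring
  have k3 : ∀ n > K, ∀ v ∈ (L 0).eigenspace (ν + M₀ + n), L (-1) v = 0 → v = 0 := by
    intro n hn v hv hLv
    by_contra hv0
    exact absurd (hK (Or.inr ⟨v, hv, hv0, hLv⟩)) (by omega)
  obtain ⟨n₀, hn₀, d, hd⟩ := exists_eventually_const_of_bounded
    (D := fun n => finrank ℂ ((L 0).eigenspace (ν + M₀ + n))) (K := K + 1) (N := N)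
    (fun n hn => by
      have hmaps : ∀ v ∈ (L 0).eigenspace (ν + M₀ + n),
          L 1 v ∈ (L 0).eigenspace (ν + M₀ + (n + 1 : ℕ)) := by
        intro v hv
        convert h.mapsTo_eigenspace 1 hv using 2
        push_cast; ring
      have := hfd (ν + M₀ + (n + 1 : ℕ))
      refine LinearMap.finrank_le_finrank_of_injective (f := (L 1).restrict hmaps) ?_
      rw [← LinearMap.ker_eq_bot, LinearMap.ker_eq_bot']
      intro v hv
      exact Subtype.ext (k1 n hn v v.2 (congrArg Subtype.val hv)))
    (fun n => hfr _)
  have hshift : ∀ n : ℕ, ν + M₀ + (2 * n₀ : ℕ) + n = ν + M₀ + (2 * n₀ + n : ℕ) := by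
    intro n; push_cast; ring
  refine h.central_charge_eq_zero_of_finrank_eq (ν + M₀ + (2 * n₀ : ℕ)) d ?_ (fun n => hfd _)
    (fun n => ?_) (fun n v hv => ?_) (fun n v hv => ?_) (fun n v hv => ?_)
  · obtain ⟨n, hn, hlt⟩ := hinf.exists_gt (M₀ + n₀)
    rw [← hd (n - M₀) (by omega)]
    have := hfd (ν + n)
    have hpos := Submodule.one_le_finrank_iff.mpr hn
    rw [Nat.cast_sub (by omega), show ν + M₀ + ((n : ℂ) - M₀) = ν + n by ring]
    exact hpos
  · rw [hshift]
    exact hd _ (by omega)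
  · rw [hshift] at hv
    exact k1 _ (by omega) v hv
  · rw [hshift] at hv
    exact k3 _ (by omega) v hv
  · rw [hshift, ← mul_add] at hv
    exact k2 _ (by omega) v hv

/-- The twist of a representation by the automorphism `Lᵢ ↦ -L₋ᵢ`. -/
lemma neg_comp_neg (h : IsVirasoroRep L c) : IsVirasoroRep (fun i => -L (-i)) (-c) := by
  intro i j
  have h1 := h (-i) (-j)
  simp only [neg_mul_neg]
  rw [h1, show -i + -j = -(i + j) by ring]
  simp only [neg_eq_zero]
  push_cast
  split_ifs <;> module

/-- A weight representation of the Virasoro algebra with bounded weight multiplicities has central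
charge zero. -/
theorem central_charge_eq_zero (h : IsVirasoroRep L c) (N : ℕ)
    (hN : ∀ μ, Module.rank ℂ ((L 0).eigenspace μ) ≤ N) (ν : ℂ)
    (hν : (L 0).eigenspace ν ≠ ⊥) : c = 0 := by
  have heig : ∀ μ, (-L (-0)).eigenspace μ = (L 0).eigenspace (-μ) := by
    intro μ
    ext v
    simp only [Module.End.mem_eigenspace_iff, neg_zero, LinearMap.neg_apply, neg_smul]
    rw [neg_eq_iff_eq_neg]
  by_cases hpos : {n : ℕ | (L 0).eigenspace (ν + n) ≠ ⊥}.Infinite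
  · exact h.central_charge_eq_zero_of_infinite N hN ν hpos
  by_cases hneg : {n : ℕ | (L 0).eigenspace (ν - n) ≠ ⊥}.Infinite
  · refine neg_eq_zero.mp (h.neg_comp_neg.central_charge_eq_zero_of_infinite N
      (fun μ => by rw [heig]; exact hN _) (-ν) ?_)
    simp only [heig]
    convert hneg using 5 with n
    ring_nf
  obtain ⟨K, hK⟩ := ((Set.not_infinite.mp hpos).union (Set.not_infinite.mp hneg)).bddAbove
  obtain ⟨v, hv, hv0⟩ := Submodule.exists_mem_ne_zero_of_ne_bot hν
  have key : ∀ n : ℕ, K < n → -2 * n * ν + ((n : ℂ) ^ 3 - n) / 12 * c = 0 := by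
    intro n hn
    have hp : (L 0).eigenspace (ν + n) = ⊥ := by
      by_contra hne
      exact absurd (hK (Or.inl hne)) (by omega)
    have hm : (L 0).eigenspace (ν - n) = ⊥ := by
      by_contra hne
      exact absurd (hK (Or.inr hne)) (by omega)
    have h1 : L n v = 0 := by
      have := h.mapsTo_eigenspace n hv
      rw [Int.cast_natCast, hp] at this
      simpa using this
    have h2 : L (-n) v = 0 := by
      have := h.mapsTo_eigenspace (-n) hv
      rw [Int.cast_neg, Int.cast_natCast, ← sub_eq_add_neg, hm] at this
      simpa using this
    have h3 := h.commutator_neg_apply n hv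
    rw [h1, h2, map_zero, map_zero, zero_add, eq_comm, smul_eq_zero] at h3
    simpa using h3.resolve_right hv0
  have key' : ∀ n : ℕ, K < n → -24 * ν + ((n : ℂ) ^ 2 - 1) * c = 0 := by
    intro n hn
    have hn0 : (n : ℂ) ≠ 0 := by exact_mod_cast (by omega : n ≠ 0)
    refine (mul_eq_zero.mp ?_).resolve_left hn0
    linear_combination 12 * key n hn
  have e1 := key' (K + 1) (by omega)
  have e2 := key' (K + 2) (by omega)
  have h3 : ((2 * K + 3 : ℕ) : ℂ) * c = 0 := by
    push_cast at e1 e2 ⊢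
    linear_combination e2 - e1
  exact (mul_eq_zero.mp h3).resolve_left (by exact_mod_cast (by omega : 2 * K + 3 ≠ 0))

end IsVirasoroRep

end VirasoroCentralCharge

section Clifford

variable {V : Type} [AddCommGroup V] [Module ℂ V]

/-- Operators `ψ i` of weight `i` satisfying the Clifford relations `ψᵢψⱼ + ψⱼψᵢ = κ δᵢ₊ⱼ` on a
nonzero weight representation with bounded weight multiplicities exist only for `κ = 0`. -/
lemma clifford_level_eq_zero (L₀ : End ℂ V) (ψ : ℤ → End ℂ V) (κ : ℂ)
    (hψ : ∀ i j : ℤ, ψ i * ψ j + ψ j * ψ i = (if i + j = 0 then κ else 0) • (1 : End ℂ V))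
    (hL : ∀ (i : ℤ) (μ : ℂ), ∀ v ∈ L₀.eigenspace μ, ψ i v ∈ L₀.eigenspace (μ + i))
    (N : ℕ) (hN : ∀ μ, Module.rank ℂ (L₀.eigenspace μ) ≤ N) (ν : ℂ)
    (hν : L₀.eigenspace ν ≠ ⊥) : κ = 0 := by
  by_contra hκ
  have hanti : ∀ i j : ℤ, ∀ v, ψ i (ψ j v) = (if i + j = 0 then κ else 0) • v - ψ j (ψ i v) := by
    intro i j v
    have := LinearMap.congr_fun (hψ i j) v
    simp only [LinearMap.add_apply, Module.End.mul_apply, LinearMap.smul_apply,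
      Module.End.one_apply] at this
    rw [← this]
    abel
  have hvac : ∀ m : ℕ, ∃ μ : ℂ, ∃ w ∈ L₀.eigenspace μ, w ≠ 0 ∧
      ∀ i : ℕ, 1 ≤ i → i ≤ m → ψ i w = 0 := by
    intro m
    induction m with
    | zero =>
      obtain ⟨w, hw, hw0⟩ := Submodule.exists_mem_ne_zero_of_ne_bot hν
      exact ⟨ν, w, hw, hw0, fun i h1 h2 => by omega⟩
    | succ m ih =>
      obtain ⟨μ, w, hw, hw0, hkill⟩ := ih
      by_cases h0 : ψ (m + 1 : ℕ) w = 0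
      · refine ⟨μ, w, hw, hw0, fun i h1 h2 => ?_⟩
        rcases Nat.lt_or_ge m i with h3 | h3
        · rw [show i = m + 1 by omega]
          exact h0
        · exact hkill i h1 h3
      · refine ⟨_, ψ (m + 1 : ℕ) w, hL _ μ w hw, h0, fun i h1 h2 => ?_⟩
        rcases Nat.lt_or_ge m i with h3 | h3
        · have h4 := hanti (m + 1 : ℕ) (m + 1 : ℕ) w
          rw [if_neg (by omega), zero_smul, zero_sub, eq_neg_iff_add_eq_zero, ← two_smul ℂ] at h4
          rw [show i = m + 1 by omega]
          exact (smul_eq_zero.mp h4).resolve_left two_ne_zero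
        · rw [hanti, if_neg (by omega), hkill i h1 h3]
          simp
  obtain ⟨μ, w, hw, hw0, hkill⟩ := hvac (2 * N + 2)
  let u : Fin (N + 1) → V := fun i =>
    ψ (-((i : ℕ) + 1 : ℕ)) (ψ (-((2 * N + 2 - i : ℕ) : ℤ)) w)
  have hu : ∀ i, u i ∈ L₀.eigenspace (μ - (2 * N + 3 : ℕ)) := by
    intro i
    convert hL _ _ _ (hL _ _ _ hw) using 2
    have := i.2
    push_cast [Nat.cast_sub (show (i : ℕ) ≤ 2 * N + 2 by omega)]
    ring
  have hlow : ∀ i j : ℕ, 1 ≤ i → i ≤ 2 * N + 2 →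
      ψ i (ψ (-(j : ℤ)) w) = (if i = j then κ else 0) • w := by
    intro i j h1 h2
    rw [hanti, hkill i h1 h2, map_zero, sub_zero]
    congr 1
    split_ifs <;> first | rfl | omega
  have hdual : ∀ i j : Fin (N + 1),
      ψ (2 * N + 2 - j : ℕ) (ψ ((j : ℕ) + 1 : ℕ) (u i)) = if i = j then (κ * κ) • w else 0 := by
    intro i j
    have := i.2
    have := j.2
    have h1 : ψ ((j : ℕ) + 1 : ℕ) (u i)
        = if i = j then κ • ψ (-((2 * N + 2 - i : ℕ) : ℤ)) w else 0 := by
      simp only [u]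
      rw [hanti, hlow _ _ (by omega) (by omega), if_neg (by omega : ¬ (j : ℕ) + 1 = 2 * N + 2 - i),
        zero_smul, map_zero, sub_zero]
      by_cases hij : i = j
      · rw [if_pos hij, if_pos (by rw [hij]; ring)]
      · rw [if_neg hij, if_neg, zero_smul]
        intro h
        apply hij
        apply Fin.ext
        omega
    rw [h1]
    split_ifs with hij
    · rw [map_smul, hlow _ _ (by omega) (by omega), if_pos (by rw [hij]), smul_smul]
    · exact map_zero _
  have hli : LinearIndependent ℂ (fun i => (⟨u i, hu i⟩ : L₀.eigenspace _)) := by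
    refine LinearIndependent.of_comp (L₀.eigenspace _).subtype ?_
    rw [Fintype.linearIndependent_iff]
    intro g hg j
    have h1 := congrArg (fun v => ψ (2 * N + 2 - j : ℕ) (ψ ((j : ℕ) + 1 : ℕ) v)) hg
    simp only [Function.comp_apply, Submodule.subtype_apply, map_sum, map_smul, hdual, map_zero,
      smul_ite, smul_zero, Finset.sum_ite_eq', Finset.mem_univ, if_true] at h1
    exact (smul_eq_zero.mp h1).resolve_right (smul_ne_zero (mul_ne_zero hκ hκ) hw0)
  have := hli.cardinal_le_rank.trans (hN _)
  simp at this

end Clifford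

section Schur

variable {V : Type} [AddCommGroup V] [Module ℂ V]

lemma gradedSub_eigenspace (gr : Fin 2 → Submodule ℂ V) (hgr : DirectSum.IsInternal gr)
    (T : End ℂ V) (hT : MapsGr gr 0 T) (c : ℂ) : GradedSub gr (T.eigenspace c) := by
  intro v hv
  have hcompl : IsCompl (gr 0) (gr 1) :=
    (DirectSum.isInternal_submodule_iff_isCompl gr (i := 0) (j := 1) (by decide)
      (by ext i; fin_cases i <;> simp)).mp hgr
  have hv' : v ∈ gr 0 ⊔ gr 1 := by rw [hcompl.sup_eq_top]; trivial
  obtain ⟨x, hx, y, hy, rfl⟩ := Submodule.mem_sup.mp hv'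
  have hTx : T x - c • x ∈ gr 0 :=
    sub_mem (by simpa using hT 0 (Submodule.mem_map_of_mem hx)) (Submodule.smul_mem _ _ hx)
  have hTy : T y - c • y ∈ gr 1 :=
    sub_mem (by simpa using hT 1 (Submodule.mem_map_of_mem hy)) (Submodule.smul_mem _ _ hy)
  rw [Module.End.mem_eigenspace_iff, map_add, smul_add] at hv
  have hsum : T x - c • x = -(T y - c • y) := by
    rw [eq_neg_iff_add_eq_zero]
    rw [sub_add_sub_comm, sub_eq_zero]
    exact hv
  have hx0 : T x - c • x = 0 := by
    refine (Submodule.disjoint_def.mp hcompl.disjoint) _ hTx ?_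
    rw [hsum]
    exact neg_mem hTy
  have hy0 : T y - c • y = 0 := by
    rw [hx0, eq_comm, neg_eq_zero] at hsum
    exact hsum
  exact Submodule.add_mem_sup
    ⟨Module.End.mem_eigenspace_iff.mpr (sub_eq_zero.mp hx0), hx⟩
    ⟨Module.End.mem_eigenspace_iff.mpr (sub_eq_zero.mp hy0), hy⟩

/-- Schur's lemma: an even operator commuting with an irreducible family of operators and with
`L₀`, where `L₀` has a nonzero finite-dimensional weight space, is a scalar. -/
lemma IsSimpleRep.exists_eq_smul_one {S : Set (End ℂ V)} {gr : Fin 2 → Submodule ℂ V}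
    (hS : IsSimpleRep S gr) (hgr : DirectSum.IsInternal gr) (T L₀ : End ℂ V)
    (hT : MapsGr gr 0 T) (hcomm : ∀ f ∈ S, T * f = f * T) (hL : T * L₀ = L₀ * T) (ν : ℂ)
    (hν : L₀.eigenspace ν ≠ ⊥) [FiniteDimensional ℂ (L₀.eigenspace ν)] :
    ∃ c : ℂ, T = c • (1 : End ℂ V) := by
  have hmaps : ∀ v ∈ L₀.eigenspace ν, T v ∈ L₀.eigenspace ν := by
    intro v hv
    rw [Module.End.mem_eigenspace_iff] at hv ⊢
    rw [← Module.End.mul_apply, ← hL, Module.End.mul_apply, hv, map_smul]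
  have : Nontrivial (L₀.eigenspace ν) := Submodule.nontrivial_iff_ne_bot.mpr hν
  obtain ⟨c, hc⟩ := Module.End.exists_eigenvalue (T.restrict hmaps)
  obtain ⟨v, hv, hv0⟩ := hc.exists_hasEigenvector
  have hTv : T v = c • (v : V) := congrArg Subtype.val (Module.End.mem_eigenspace_iff.mp hv)
  have hinv : InvariantUnder S (T.eigenspace c) := by
    rintro f hf _ ⟨w, hw, rfl⟩
    rw [SetLike.mem_coe, Module.End.mem_eigenspace_iff] at hw
    rw [Module.End.mem_eigenspace_iff, ← Module.End.mul_apply, hcomm f hf, Module.End.mul_apply,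
      hw, map_smul]
  refine ⟨c, ?_⟩
  rcases hS.2 _ hinv (gradedSub_eigenspace gr hgr T hT c) with h | h
  · refine absurd (Subtype.ext ?_) hv0
    have : (v : V) ∈ T.eigenspace c := Module.End.mem_eigenspace_iff.mpr hTv
    rwa [h, Submodule.mem_bot] at this
  · ext w
    have : w ∈ T.eigenspace c := by rw [h]; trivial
    simpa using Module.End.mem_eigenspace_iff.mp this

end Schur

lemma exists_apply_self_ne_zero {W : Type} [AddCommGroup W] [Module ℂ W] [Nontrivial W]
    (Φ : W →ₗ[ℂ] W →ₗ[ℂ] ℂ) (hsymm : ∀ x y, Φ x y = Φ y x)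
    (hnd : ∀ x, (∀ y, Φ x y = 0) → x = 0) : ∃ x, Φ x x ≠ 0 := by
  by_contra! h
  obtain ⟨x, hx⟩ := exists_ne (0 : W)
  refine hx (hnd x fun y => ?_)
  have := h (x + y)
  simp only [map_add, LinearMap.add_apply, h, hsymm y x] at this
  simpa using this

section SuperconformalCurrent

variable {𝕘}

lemma IsSCCRep.isVirasoroRep {M : Type} [AddCommGroup M] [Module ℂ M]
    {Φ : 𝕘 →ₗ[ℂ] 𝕘 →ₗ[ℂ] ℂ} {L G : ℤ → End ℂ M} {C C1 : End ℂ M}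
    {E F : ℤ → 𝕘 →ₗ[ℂ] End ℂ M} (h : IsSCCRep 𝕘 Φ L G C C1 E F) {c : ℂ}
    (hC : C = c • (1 : End ℂ M)) : IsVirasoroRep L c := by
  intro i j
  rw [h.comm_LL, hC, smul_smul, ite_mul, zero_mul]

lemma IsSCCRep.central_C_commutes {M : Type} [AddCommGroup M] [Module ℂ M]
    {Φ : 𝕘 →ₗ[ℂ] 𝕘 →ₗ[ℂ] ℂ} {L G : ℤ → End ℂ M} {C C1 : End ℂ M}
    {E F : ℤ → 𝕘 →ₗ[ℂ] End ℂ M} (h : IsSCCRep 𝕘 Φ L G C C1 E F) :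
    ∀ f ∈ sccOps 𝕘 L G C C1 E F, C * f = f * C := by
  rintro f ((((⟨i, rfl⟩ | ⟨i, rfl⟩) | (rfl | rfl)) | ⟨i, x, rfl⟩) | ⟨i, x, rfl⟩)
  exacts [h.central_C_L i, h.central_C_G i, rfl, h.central_C_C1, h.central_C_E i x,
    h.central_C_F i x]

lemma IsSCCRep.central_C1_commutes {M : Type} [AddCommGroup M] [Module ℂ M]
    {Φ : 𝕘 →ₗ[ℂ] 𝕘 →ₗ[ℂ] ℂ} {L G : ℤ → End ℂ M} {C C1 : End ℂ M}
    {E F : ℤ → 𝕘 →ₗ[ℂ] End ℂ M} (h : IsSCCRep 𝕘 Φ L G C C1 E F) :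
    ∀ f ∈ sccOps 𝕘 L G C C1 E F, C1 * f = f * C1 := by
  rintro f ((((⟨i, rfl⟩ | ⟨i, rfl⟩) | (rfl | rfl)) | ⟨i, x, rfl⟩) | ⟨i, x, rfl⟩)
  exacts [h.central_C1_L i, h.central_C1_G i, h.central_C_C1.symm, rfl, h.central_C1_E i x,
    h.central_C1_F i x]

lemma IsSCCRep.F_mapsTo_eigenspace {M : Type} [AddCommGroup M] [Module ℂ M]
    {Φ : 𝕘 →ₗ[ℂ] 𝕘 →ₗ[ℂ] ℂ} {L G : ℤ → End ℂ M} {C C1 : End ℂ M}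
    {E F : ℤ → 𝕘 →ₗ[ℂ] End ℂ M} (h : IsSCCRep 𝕘 Φ L G C C1 E F) (i : ℤ) (x : 𝕘) (μ : ℂ)
    (v : M) (hv : v ∈ (L 0).eigenspace μ) : F i x v ∈ (L 0).eigenspace (μ + i) := by
  rw [Module.End.mem_eigenspace_iff] at hv ⊢
  have h1 := LinearMap.congr_fun (h.comm_LF 0 i x) v
  simp only [LinearMap.sub_apply, Module.End.mul_apply, hv, map_smul, LinearMap.smul_apply,
    zero_add, Int.cast_zero, zero_div, add_zero] at h1
  rw [eq_add_of_sub_eq h1, add_smul, add_comm]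

end SuperconformalCurrent

/-- **Statement 4.** Suppose `V = ⊕_{λ∈ℂ} V_λ` is a simple cuspidal module over the
superconformal current algebra `ĝ`.  Then the central elements `C` and `C₁` act on
`V` by zero. -/
theorem central_acts_trivially_on_simple_cuspidal
    (𝕘 : Type) [LieRing 𝕘] [LieAlgebra ℂ 𝕘] [FiniteDimensional ℂ 𝕘]
    [LieAlgebra.IsSimple ℂ 𝕘]
    (Φ : 𝕘 →ₗ[ℂ] 𝕘 →ₗ[ℂ] ℂ)
    (hΦsymm : ∀ x y : 𝕘, Φ x y = Φ y x)
    (hΦinv : ∀ x y z : 𝕘, Φ ⁅x, y⁆ z = Φ x ⁅y, z⁆)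
    (hΦnd : ∀ x : 𝕘, (∀ y : 𝕘, Φ x y = 0) → x = 0)
    (V : Type) [AddCommGroup V] [Module ℂ V]
    (L G : ℤ → End ℂ V) (C C1 : End ℂ V)
    (E F : ℤ → 𝕘 →ₗ[ℂ] End ℂ V)
    (gr : Fin 2 → Submodule ℂ V)
    (hrep : IsSCCRep 𝕘 Φ L G C C1 E F)
    (hsuper : IsSCCSuper 𝕘 gr L G C C1 E F)
    (hsimple : IsSimpleRep (sccOps 𝕘 L G C C1 E F) gr)
    (hcusp : IsCuspidalMod (L 0)) :
    C = 0 ∧ C1 = 0 := by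
  obtain ⟨hwt, N, hN⟩ := hcusp
  obtain ⟨ν, hν⟩ : ∃ ν : ℂ, (L 0).eigenspace ν ≠ ⊥ := by
    by_contra! h0
    obtain ⟨v, hv⟩ := hsimple.1
    have htop : (⊥ : Submodule ℂ V) = ⊤ := by
      rw [← show ⨆ μ : ℂ, (L 0).eigenspace μ = ⊤ from hwt]
      simp [h0]
    exact hv ((Submodule.mem_bot ℂ).mp (htop ▸ Submodule.mem_top))
  have : FiniteDimensional ℂ ((L 0).eigenspace ν) :=
    Module.rank_lt_aleph0_iff.mp ((hN ν).trans_lt Cardinal.natCast_lt_aleph0)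
  obtain ⟨c, hc⟩ := hsimple.exists_eq_smul_one hsuper.internal C (L 0) hsuper.hC
    hrep.central_C_commutes (hrep.central_C_L 0) ν hν
  obtain ⟨c₁, hc₁⟩ := hsimple.exists_eq_smul_one hsuper.internal C1 (L 0) hsuper.hC1
    hrep.central_C1_commutes (hrep.central_C1_L 0) ν hν
  constructor
  · rw [hc, (hrep.isVirasoroRep hc).central_charge_eq_zero N hN ν hν, zero_smul]
  · have : Nontrivial 𝕘 := by
      by_contra hnt
      rw [not_nontrivial_iff_subsingleton] at hnt
      exact LieAlgebra.IsSimple.non_abelian ℂ (L := 𝕘) ⟨fun x y => Subsingleton.elim _ _⟩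
    obtain ⟨x, hx⟩ := exists_apply_self_ne_zero Φ hΦsymm hΦnd
    have hlevel : Φ x x * c₁ = 0 :=
      clifford_level_eq_zero (L 0) (fun i => F i x) (Φ x x * c₁)
        (fun i j => by rw [hrep.comm_FF, hc₁, smul_smul, ite_mul, zero_mul])
        (fun i μ v hv => hrep.F_mapsTo_eigenspace i x μ v hv) N hN ν hν
    rw [hc₁, (mul_eq_zero.mp hlevel).resolve_left hx, zero_smul]
end
end

section
/- Let M be a cuspidal g-module. Then there exists m ∈ ℕ such that for all k,p ∈ ℤ and x ∈ ġ, the operators Σ_{i=0}^{m} (−1)^i (m choose i) (x⊗t^{k−i}) L_{p+i} and Σ_{i=0}^{m} (−1)^i (m choose i) (x⊗t^{k−i}ξ) L_{p+i} annihilate M. -/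
/-!
Representations of the centerless superconformal current algebra
`g = s̄ ⋉ (ġ ⊗ A)`, where `s̄` is the centerless `N = 1` Ramond algebra and
`A = ℂ[t^{±1}] ⊗ Λ(ξ)`.  A representation is encoded by the operators by which
the basis elements `L i`, `G i`, `x ⊗ tⁱ` (operator `E i x`) and `x ⊗ tⁱξ`
(operator `F i x`) act, subject to the supercommutator relations.
-/

noncomputable section

open Module

variable (𝕘 : Type) [LieRing 𝕘] [LieAlgebra ℂ 𝕘]

/-- The operators `L, G, E, F` on `M` form a representation of
`g = s̄ ⋉ (ġ ⊗ A)`. -/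
structure IsGRep {M : Type} [AddCommGroup M] [Module ℂ M]
    (L G : ℤ → End ℂ M) (E F : ℤ → 𝕘 →ₗ[ℂ] End ℂ M) : Prop where
  comm_LL : ∀ i j : ℤ, L i * L j - L j * L i = ((j : ℂ) - (i : ℂ)) • L (i + j)
  comm_LG : ∀ i j : ℤ, L i * G j - G j * L i = ((j : ℂ) - (i : ℂ) / 2) • G (i + j)
  comm_GG : ∀ i j : ℤ, G i * G j + G j * G i = (-2 : ℂ) • L (i + j)
  comm_LE : ∀ (i j : ℤ) (x : 𝕘), L i * E j x - E j x * L i = (j : ℂ) • E (i + j) x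
  comm_LF : ∀ (i j : ℤ) (x : 𝕘),
      L i * F j x - F j x * L i = ((j : ℂ) + (i : ℂ) / 2) • F (i + j) x
  comm_GE : ∀ (i j : ℤ) (x : 𝕘), G i * E j x - E j x * G i = (j : ℂ) • F (i + j) x
  comm_GF : ∀ (i j : ℤ) (x : 𝕘), G i * F j x + F j x * G i = - E (i + j) x
  comm_EE : ∀ (i j : ℤ) (x y : 𝕘), E i x * E j y - E j y * E i x = E (i + j) ⁅x, y⁆
  comm_FE : ∀ (i j : ℤ) (x y : 𝕘), F i x * E j y - E j y * F i x = F (i + j) ⁅x, y⁆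
  comm_FF : ∀ (i j : ℤ) (x y : 𝕘), F i x * F j y + F j y * F i x = 0

/-- The grading `gr` makes `M` into a super vector space on which the operator
families act with the correct parities. -/
structure IsGSuper {M : Type} [AddCommGroup M] [Module ℂ M]
    (gr : Fin 2 → Submodule ℂ M)
    (L G : ℤ → End ℂ M) (E F : ℤ → 𝕘 →ₗ[ℂ] End ℂ M) : Prop where
  internal : DirectSum.IsInternal gr
  hL : ∀ i, MapsGr gr 0 (L i)
  hG : ∀ i, MapsGr gr 1 (G i)
  hE : ∀ (i : ℤ) (x : 𝕘), MapsGr gr 0 (E i x)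
  hF : ∀ (i : ℤ) (x : 𝕘), MapsGr gr 1 (F i x)

/-- The set of all operators in the image of a representation of `g`. -/
def gOps {M : Type} [AddCommGroup M] [Module ℂ M]
    (L G : ℤ → End ℂ M) (E F : ℤ → 𝕘 →ₗ[ℂ] End ℂ M) : Set (End ℂ M) :=
  Set.range L ∪ Set.range G
    ∪ {f | ∃ (i : ℤ) (x : 𝕘), f = E i x} ∪ {f | ∃ (i : ℤ) (x : 𝕘), f = F i x}

/-! ### Finite differences -/

section FiniteDifferences

variable {Γ V W : Type} [AddCommGroup Γ] [AddCommGroup V] [Module ℂ V] [AddCommGroup W] [Module ℂ W]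

/-- Translation by `g` on functions `Γ → V`. -/
def shiftEnd (g : Γ) : End ℂ (Γ → V) := LinearMap.funLeft ℂ V (· + g)

/-- The difference operator `φ ↦ φ (· + g) - φ`. -/
def diffEnd (g : Γ) : End ℂ (Γ → V) := shiftEnd g - 1

@[simp] theorem shiftEnd_apply (g : Γ) (φ : Γ → V) (b : Γ) : shiftEnd g φ b = φ (b + g) := rfl

@[simp] theorem diffEnd_apply (g : Γ) (φ : Γ → V) (b : Γ) :
    diffEnd g φ b = φ (b + g) - φ b := rfl

theorem shiftEnd_commute (g g' : Γ) : Commute (shiftEnd g : End ℂ (Γ → V)) (shiftEnd g') := by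
  ext φ b
  simp [add_right_comm]

theorem diffEnd_commute_shiftEnd (g g' : Γ) :
    Commute (diffEnd g : End ℂ (Γ → V)) (shiftEnd g') :=
  (shiftEnd_commute g g').sub_left (Commute.one_left _)

theorem diffEnd_commute (g g' : Γ) : Commute (diffEnd g : End ℂ (Γ → V)) (diffEnd g') :=
  (diffEnd_commute_shiftEnd g g').sub_right (Commute.one_right _)

theorem diffEnd_pow_comp (f : V →ₗ[ℂ] W) (g : Γ) (m : ℕ) (φ : Γ → V) :
    (diffEnd g ^ m) (fun b => f (φ b)) = fun b => f ((diffEnd g ^ m) φ b) := by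
  induction m generalizing φ with
  | zero => rfl
  | succ m ih =>
    rw [pow_succ, pow_succ, Module.End.mul_apply, Module.End.mul_apply, ← ih]
    congr 1
    ext b
    simp

/-- Functions `ℤ → V` whose `m`-th difference takes values in `T`. -/
def polySub (T : Submodule ℂ V) (m : ℕ) : Submodule ℂ (ℤ → V) :=
  (Submodule.pi Set.univ fun _ => T).comap (diffEnd 1 ^ m)

theorem mem_polySub {T : Submodule ℂ V} {m : ℕ} {φ : ℤ → V} :
    φ ∈ polySub T m ↔ ∀ b, (diffEnd 1 ^ m) φ b ∈ T := by
  simp [polySub, Submodule.mem_pi]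

theorem mem_polySub_zero {T : Submodule ℂ V} {φ : ℤ → V} : φ ∈ polySub T 0 ↔ ∀ b, φ b ∈ T := by
  simp [mem_polySub]

theorem mem_polySub_succ {T : Submodule ℂ V} {m : ℕ} {φ : ℤ → V} :
    φ ∈ polySub T (m + 1) ↔ diffEnd 1 φ ∈ polySub T m := by
  simp [mem_polySub, pow_succ]

theorem polySub_shift {T : Submodule ℂ V} {m : ℕ} {φ : ℤ → V} (h : φ ∈ polySub T m) (i : ℤ) :
    (fun b => φ (b + i)) ∈ polySub T m := by
  rw [mem_polySub] at h ⊢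
  intro b
  have := LinearMap.congr_fun ((diffEnd_commute_shiftEnd (V := V) (1 : ℤ) i).pow_left m) φ
  have := congrFun this b
  simp only [Module.End.mul_apply, shiftEnd_apply] at this
  exact this ▸ h (b + i)

theorem polySub_le_succ (T : Submodule ℂ V) (m : ℕ) : polySub T m ≤ polySub T (m + 1) := by
  intro φ h
  rw [mem_polySub_succ]
  exact sub_mem (polySub_shift h 1) h

theorem polySub_mono (T : Submodule ℂ V) {m m' : ℕ} (h : m ≤ m') : polySub T m ≤ polySub T m' :=
  monotone_nat_of_le_succ (polySub_le_succ T) h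

theorem polySub_map {T : Submodule ℂ V} {T' : Submodule ℂ W} {m : ℕ} {φ : ℤ → V}
    (f : V →ₗ[ℂ] W) (hf : ∀ v ∈ T, f v ∈ T') (h : φ ∈ polySub T m) :
    (fun b => f (φ b)) ∈ polySub T' m := by
  rw [mem_polySub] at h ⊢
  intro b
  rw [diffEnd_pow_comp]
  exact hf _ (h b)

theorem polySub_le {T T' : Submodule ℂ V} (h : T ≤ T') (m : ℕ) : polySub T m ≤ polySub T' m :=
  fun _ hφ => polySub_map LinearMap.id (fun _ hv => h hv) hφ

theorem polySub_const (T : Submodule ℂ V) {m : ℕ} (hm : 1 ≤ m) (v : V) :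
    (fun _ => v) ∈ polySub T m := by
  refine polySub_mono T hm (mem_polySub_succ.2 (mem_polySub_zero.2 fun b => ?_))
  simp

theorem polySub_id_smul {T : Submodule ℂ V} {m : ℕ} {φ : ℤ → V} (h : φ ∈ polySub T m) :
    (fun b : ℤ => (b : ℂ) • φ b) ∈ polySub T (m + 1) := by
  induction m generalizing φ with
  | zero =>
    exact polySub_le_succ T 0 (mem_polySub_zero.2 fun b => T.smul_mem _ (mem_polySub_zero.1 h b))
  | succ m ih =>
    rw [mem_polySub_succ]
    have h1 := add_mem (ih (mem_polySub_succ.1 h)) (polySub_shift h 1)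
    convert h1 using 1
    ext b
    simp only [diffEnd_apply, Pi.add_apply]
    push_cast
    module

theorem polySub_sub_shift {T : Submodule ℂ V} {m : ℕ} {φ : ℤ → V} (h : φ ∈ polySub T (m + 1))
    (i : ℤ) : (fun b => φ (b + i) - φ b) ∈ polySub T m := by
  have key : ∀ i : ℤ, (fun b => φ (b + (i + 1)) - φ (b + i)) ∈ polySub T m := fun i => by
    convert polySub_shift (mem_polySub_succ.1 h) i using 1
    ext b
    simp [add_assoc]
  induction i with
  | zero =>
    convert (polySub T m).zero_mem using 1
    ext b
    simp
  | succ i ih =>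
    convert add_mem (key i) ih using 1
    ext b
    simp
  | pred i ih =>
    convert sub_mem ih (key (-i - 1)) using 1
    ext b
    simp

theorem polySub_smul_sub_shift {T : Submodule ℂ V} {m : ℕ} {φ : ℤ → V} (hm : 1 ≤ m)
    (h : φ ∈ polySub T m) (i : ℤ) : (fun b : ℤ => (b : ℂ) • (φ (b + i) - φ b)) ∈ polySub T m := by
  obtain ⟨m, rfl⟩ := Nat.exists_eq_add_of_le' hm
  exact polySub_id_smul (polySub_sub_shift h i)

theorem diffEnd_pow_eq_sum (φ : ℤ → V) (m : ℕ) (b : ℤ) :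
    (diffEnd 1 ^ m) φ b =
      ∑ i ∈ Finset.range (m + 1), ((-1 : ℂ) ^ (m - i) * (m.choose i : ℂ)) • φ (b + i) := by
  have : ∀ m : ℕ, (diffEnd 1 ^ m) φ = (fwdDiff 1)^[m] φ := fun m => by
    induction m with
    | zero => rfl
    | succ m ih =>
      rw [pow_succ', Function.iterate_succ', Module.End.mul_apply, ih]
      rfl
  rw [this, fwdDiff_iter_eq_sum_shift]
  refine Finset.sum_congr rfl fun i _ => ?_
  rw [← Int.cast_smul_eq_zsmul ℂ]
  simp

end FiniteDifferences

section DifferenceBrackets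

variable {A : Type} [LieRing A] [LieAlgebra ℂ A] {D : ℤ → A}

theorem diffEnd_pow_succ_apply {V : Type} [AddCommGroup V] [Module ℂ V] (φ : ℤ → V) (u : ℕ)
    (a : ℤ) : (diffEnd 1 ^ (u + 1)) φ a = (diffEnd 1 ^ u) φ (a + 1) - (diffEnd 1 ^ u) φ a := by
  rw [pow_succ', Module.End.mul_apply, diffEnd_apply]

theorem bracket_diffEnd_pow
    (hD : ∀ i j : ℤ, ⁅D i, D j⁆ = ((j : ℂ) - i) • D (i + j) - (j : ℂ) • D j + (i : ℂ) • D i)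
    (a : ℤ) (k : ℕ) (b : ℤ) :
    ⁅D a, (diffEnd 1 ^ (k + 1)) D b⁆ =
      ((b : ℂ) - a) • (diffEnd 1 ^ (k + 1)) D (a + b)
        + ((k : ℂ) + 1) • (diffEnd 1 ^ k) D (a + b + 1)
        - ((b : ℂ) • (diffEnd 1 ^ (k + 1)) D b + ((k : ℂ) + 1) • (diffEnd 1 ^ k) D (b + 1)) := by
  induction k generalizing b with
  | zero =>
    simp only [zero_add, pow_one, diffEnd_apply, lie_sub, hD, pow_zero, Module.End.one_apply,
      ← add_assoc]
    push_cast
    module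
  | succ k ih =>
    rw [diffEnd_pow_succ_apply D (k + 1), lie_sub, ih, ih]
    simp only [diffEnd_pow_succ_apply D (k + 1), diffEnd_pow_succ_apply D k, ← add_assoc]
    push_cast
    module

theorem bracket_diffEnd_pow_diffEnd_pow
    (hD : ∀ i j : ℤ, ⁅D i, D j⁆ = ((j : ℂ) - i) • D (i + j) - (j : ℂ) • D j + (i : ℂ) • D i)
    (a b : ℤ) (u k : ℕ) :
    ⁅(diffEnd 1 ^ (u + 1)) D a, (diffEnd 1 ^ (k + 1)) D b⁆ =
      ((b : ℂ) - a) • (diffEnd 1 ^ (u + k + 2)) D (a + b)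
        + ((k : ℂ) - u) • (diffEnd 1 ^ (u + k + 1)) D (a + b + 1) := by
  induction u generalizing a with
  | zero =>
    rw [diffEnd_pow_succ_apply D 0, sub_lie]
    simp only [pow_zero, Module.End.one_apply, bracket_diffEnd_pow hD, zero_add]
    rw [show a + 1 + b = a + b + 1 by ring]
    simp only [diffEnd_pow_succ_apply D (k + 1), diffEnd_pow_succ_apply D k]
    push_cast
    module
  | succ u ih =>
    rw [diffEnd_pow_succ_apply D (u + 1), sub_lie, ih, ih]
    rw [show a + 1 + b = a + b + 1 by ring, show u + 1 + k + 2 = u + k + 2 + 1 by ring,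
      show u + 1 + k + 1 = u + k + 2 by ring]
    simp only [diffEnd_pow_succ_apply D (u + k + 2), diffEnd_pow_succ_apply D (u + k + 1)]
    push_cast
    module

theorem exists_diffEnd_pow_eq_zero [FiniteDimensional ℂ A] 
    (hD : ∀ i j : ℤ, ⁅D i, D j⁆ = ((j : ℂ) - i) • D (i + j) - (j : ℂ) • D j + (i : ℂ) • D i) :
    ∃ n, 2 ≤ n ∧ n ≤ finrank ℂ A + 2 ∧ (diffEnd 1 ^ n) D (-1) = 0 := by
  by_contra! hne
  have hev : ∀ k : ℕ, ⁅diffEnd 1 D (-1), (diffEnd 1 ^ (k + 1)) D (-1)⁆ =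
      (k : ℂ) • (diffEnd 1 ^ (k + 1)) D (-1) := fun k => by
    have := bracket_diffEnd_pow_diffEnd_pow hD (-1) (-1) 0 k
    simp only [zero_add, pow_one, diffEnd_pow_succ_apply D (k + 1)] at this
    rw [this]
    norm_num
  have hli : LinearIndependent ℂ
      (fun i : Fin (finrank ℂ A + 1) => (diffEnd 1 ^ ((i : ℕ) + 2)) D (-1)) := by
    refine Module.End.eigenvectors_linearIndependent'
      (LieAlgebra.ad ℂ A (diffEnd 1 D (-1)))
      (fun i : Fin (finrank ℂ A + 1) => (((i : ℕ) + 1 : ℕ) : ℂ)) ?_ _ fun i => ?_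
    · intro i j hij
      simpa [Fin.ext_iff] using hij
    · refine ⟨Module.End.mem_eigenspace_iff.2 ?_, hne _ (by omega) (by omega)⟩
      rw [LieAlgebra.ad_apply]
      exact hev _
  have := hli.fintype_card_le_finrank
  simp at this

theorem diffEnd_pow_eq_zero [FiniteDimensional ℂ A]
    (hD : ∀ i j : ℤ, ⁅D i, D j⁆ = ((j : ℂ) - i) • D (i + j) - (j : ℂ) • D j + (i : ℂ) • D i)
    {m : ℕ} (hm : 4 * (finrank ℂ A + 2) ≤ m) : (diffEnd 1 ^ m) D = 0 := by
  obtain ⟨n, hn, hn', h0⟩ := exists_diffEnd_pow_eq_zero hD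
  obtain ⟨n, rfl⟩ := Nat.exists_eq_add_of_le' (show 1 ≤ n by omega)
  have h1 : ∀ a : ℤ, a ≠ -2 → (diffEnd 1 ^ (n + n + 2)) D a = 0 := fun a ha => by
    have := bracket_diffEnd_pow_diffEnd_pow hD (-1) (a + 1) n n
    rw [h0, zero_lie, sub_self, zero_smul, add_zero, show -1 + (a + 1) = a by ring] at this
    refine (smul_eq_zero.1 this.symm).resolve_left fun h => ha ?_
    have : ((a + 2 : ℤ) : ℂ) = 0 := by push_cast at h ⊢; linear_combination h
    have := Int.cast_eq_zero.1 this
    omega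
  have h2 : ∀ a b : ℤ, a ≠ -2 → a ≠ b →
      (diffEnd 1 ^ ((n + n + 1) + (n + n + 1) + 2)) D (a + b) = 0 := fun a b ha hab => by
    have := bracket_diffEnd_pow_diffEnd_pow hD a b (n + n + 1) (n + n + 1)
    rw [h1 a ha, zero_lie, sub_self, zero_smul, add_zero] at this
    refine (smul_eq_zero.1 this.symm).resolve_left fun h => hab ?_
    exact_mod_cast (sub_eq_zero.1 h).symm
  have h3 : (diffEnd 1 ^ ((n + n + 1) + (n + n + 1) + 2)) D = 0 := by
    ext q
    by_cases hq : q = 0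
    · simpa [hq] using h2 1 (-1) (by norm_num) (by norm_num)
    · simpa using h2 0 q (by norm_num) (Ne.symm hq)
  obtain ⟨r, rfl⟩ := Nat.exists_eq_add_of_le' (show (n + n + 1) + (n + n + 1) + 2 ≤ m by omega)
  rw [pow_add, Module.End.mul_apply, h3, map_zero]

end DifferenceBrackets

section Weights

variable {X : Type} [AddCommGroup X] [Module ℂ X]

/-- `A` is diagonalizable with eigenvalues in `lam + ℤ` and multiplicities at most `d`. -/
structure CosetBounded (A : End ℂ X) (lam : ℂ) (d : ℕ) : Prop where
  iSup_eq_top : ⨆ n : ℤ, A.eigenspace (lam + n) = ⊤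
  finite : ∀ n : ℤ, FiniteDimensional ℂ (A.eigenspace (lam + n))
  finrank_le : ∀ n : ℤ, finrank ℂ (A.eigenspace (lam + n)) ≤ d

theorem mem_of_sum_eigenvectors_mem {ι : Type} {A : End ℂ X} {K : Submodule ℂ X}
    (hK : ∀ v ∈ K, A v ∈ K) {μ : ι → ℂ} (hμ : Function.Injective μ) (s : Finset ι) {x : ι → X}
    (hx : ∀ i, A (x i) = μ i • x i) (h : ∑ i ∈ s, x i ∈ K) : ∀ i ∈ s, x i ∈ K := by
  classical
  induction s using Finset.induction_on generalizing x with
  | empty => simp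
  | insert a s ha ih =>
    rw [Finset.sum_insert ha] at h
    have h1 : ∑ i ∈ s, (μ i - μ a) • x i ∈ K := by
      have := K.sub_mem (hK _ h) (K.smul_mem (μ a) h)
      simp only [map_add, map_sum, hx, smul_add, Finset.smul_sum, add_sub_add_left_eq_sub] at this
      simpa [sub_smul, Finset.sum_sub_distrib] using this
    have h2 : ∀ i ∈ s, x i ∈ K := fun i hi => by
      have := ih (x := fun i => (μ i - μ a) • x i)
        (fun i => by rw [map_smul, hx, smul_comm]) h1 i hi
      refine (K.smul_mem_iff (sub_ne_zero.2 fun h => ?_)).1 this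
      exact ha (hμ h ▸ hi)
    intro i hi
    rcases Finset.mem_insert.1 hi with rfl | hi
    · exact (K.add_mem_iff_left (K.sum_mem h2)).1 h
    · exact h2 i hi

theorem weight_injective (lam : ℂ) : Function.Injective fun n : ℤ => lam + n := fun i j h => by
  simpa using h

theorem exists_injective_eigenspace_restrict {A : End ℂ X} {K : Submodule ℂ X}
    (hK : ∀ v ∈ K, A v ∈ K) (μ : ℂ) :
    ∃ f : Module.End.eigenspace (A.restrict hK) μ →ₗ[ℂ] A.eigenspace μ, Function.Injective f :=
  ⟨(K.subtype ∘ₗ Submodule.subtype _).codRestrict _ fun v => by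
      have := Module.End.mem_eigenspace_iff.1 v.2
      rw [Module.End.mem_eigenspace_iff]
      simpa using congrArg Subtype.val this,
    fun v w hvw => Subtype.ext (Subtype.ext (Subtype.ext_iff.1 hvw :))⟩

namespace CosetBounded

variable {A : End ℂ X} {lam : ℂ} {d : ℕ}

theorem eq_top_of_le (h : CosetBounded A lam d) {T : Submodule ℂ X}
    (hT : ∀ n : ℤ, ∀ v, A v = (lam + n) • v → v ∈ T) : T = ⊤ :=
  top_le_iff.1 (h.iSup_eq_top ▸ iSup_le fun n v hv => hT n v (Module.End.mem_eigenspace_iff.1 hv))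

theorem exists_eq_sum (h : CosetBounded A lam d) (x : X) :
    ∃ (s : Finset ℤ) (v : ℤ → X), (∀ n : ℤ, A (v n) = (lam + n) • v n) ∧ x = ∑ n ∈ s, v n := by
  have hx : x ∈ ⨆ n : ℤ, A.eigenspace (lam + n) := h.iSup_eq_top ▸ Submodule.mem_top
  obtain ⟨f, hf, hsum⟩ := (Submodule.mem_iSup_iff_exists_finsupp _ _).1 hx
  exact ⟨f.support, f, fun n => Module.End.mem_eigenspace_iff.1 (hf n), hsum.symm⟩

theorem exists_eigenvector_mem (h : CosetBounded A lam d) {K : Submodule ℂ X}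
    (hK : ∀ v ∈ K, A v ∈ K) (hne : K ≠ ⊥) :
    ∃ n : ℤ, ∃ v ∈ K, v ≠ 0 ∧ A v = (lam + n) • v := by
  obtain ⟨x, hxK, hx0⟩ := K.exists_mem_ne_zero_of_ne_bot hne
  obtain ⟨s, v, hv, rfl⟩ := h.exists_eq_sum x
  obtain ⟨n, hn, hn0⟩ := Finset.exists_ne_zero_of_sum_ne_zero hx0
  exact ⟨n, v n, mem_of_sum_eigenvectors_mem hK (weight_injective lam) s hv hxK n hn, hn0, hv n⟩

theorem add_int (h : CosetBounded A lam d) (k : ℤ) : CosetBounded A (lam + k) d := by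
  have e : ∀ n : ℤ, lam + k + n = lam + ((k + n : ℤ) : ℂ) := fun n => by push_cast; ring
  refine ⟨?_, fun n => e n ▸ h.finite _, fun n => e n ▸ h.finrank_le _⟩
  simp only [e]
  rw [← h.iSup_eq_top]
  exact (Equiv.addLeft k).iSup_comp (g := fun n : ℤ => A.eigenspace (lam + n))

theorem restrict (h : CosetBounded A lam d) {K : Submodule ℂ X} (hK : ∀ v ∈ K, A v ∈ K) :
    CosetBounded (A.restrict hK) lam d := by
  refine ⟨?_, fun n => ?_, fun n => ?_⟩
  · rw [eq_top_iff]
    rintro ⟨x, hx⟩ -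
    obtain ⟨s, v, hv, rfl⟩ := h.exists_eq_sum x
    have hvK := mem_of_sum_eigenvectors_mem hK (weight_injective lam) s hv hx
    have : (⟨∑ n ∈ s, v n, hx⟩ : K) = ∑ n ∈ s.attach, ⟨v n, hvK n n.2⟩ := by
      ext
      simp [Finset.sum_attach s v]
    rw [this]
    refine Submodule.sum_mem _ fun n _ => Submodule.mem_iSup_of_mem (n : ℤ) ?_
    rw [Module.End.mem_eigenspace_iff]
    ext
    simpa using hv n
  · obtain ⟨f, hf⟩ := exists_injective_eigenspace_restrict hK (lam + n)
    have := h.finite n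
    exact FiniteDimensional.of_injective f hf
  · obtain ⟨f, hf⟩ := exists_injective_eigenspace_restrict hK (lam + n)
    have := h.finite n
    exact (LinearMap.finrank_le_finrank_of_injective hf).trans (h.finrank_le n)

theorem exists_eigenvector_of_mapQ (h : CosetBounded A lam d) {K : Submodule ℂ X}
    (hK : ∀ v ∈ K, A v ∈ K) (n : ℤ) {q : X ⧸ K} (hq : K.mapQ K A hK q = (lam + n) • q) :
    ∃ v, A v = (lam + n) • v ∧ K.mkQ v = q := by
  classical
  obtain ⟨x, rfl⟩ := K.mkQ_surjective q
  obtain ⟨s, v, hv, rfl⟩ := h.exists_eq_sum x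
  have key : ∑ i ∈ s, ((i : ℂ) - n) • v i ∈ K := by
    rw [← K.ker_mkQ, LinearMap.mem_ker, ← sub_eq_zero.2 hq]
    simp only [map_sum, Finset.smul_sum, ← Finset.sum_sub_distrib]
    refine Finset.sum_congr rfl fun i _ => ?_
    rw [Submodule.mkQ_apply, Submodule.mkQ_apply, Submodule.mapQ_apply, hv i,
      Submodule.Quotient.mk_smul, Submodule.Quotient.mk_smul]
    module
  have hmem := mem_of_sum_eigenvectors_mem hK (weight_injective lam) s
    (x := fun i => ((i : ℂ) - n) • v i) (fun i => by rw [map_smul, hv, smul_comm]) key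
  refine ⟨if n ∈ s then v n else 0, by split_ifs <;> simp [hv], ?_⟩
  rw [← sub_eq_zero, ← map_sub, ← LinearMap.mem_ker, K.ker_mkQ, ← K.neg_mem_iff, neg_sub,
    show (if n ∈ s then v n else 0) = ∑ i ∈ s, if i = n then v i else 0 by simp,
    ← Finset.sum_sub_distrib]
  refine K.sum_mem fun i hi => ?_
  split_ifs with hin
  · simp
  · rw [sub_zero]
    exact (K.smul_mem_iff (sub_ne_zero.2 (by exact_mod_cast hin))).1 (hmem i hi)

theorem quotient (h : CosetBounded A lam (d + 1)) {K : Submodule ℂ X} (hK : ∀ v ∈ K, A v ∈ K)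
    (hne : ∀ n : ℤ, (∃ v, v ≠ 0 ∧ A v = (lam + n) • v) →
      ∃ v ∈ K, v ≠ 0 ∧ A v = (lam + n) • v) :
    CosetBounded (K.mapQ K A hK) lam d := by
  have hle : ∀ n : ℤ, Module.End.eigenspace (K.mapQ K A hK) (lam + n) ≤
      LinearMap.range (K.mkQ.domRestrict (A.eigenspace (lam + n))) := fun n q hq => by
    obtain ⟨v, hv, rfl⟩ := h.exists_eigenvector_of_mapQ hK n (Module.End.mem_eigenspace_iff.1 hq)
    exact ⟨⟨v, Module.End.mem_eigenspace_iff.2 hv⟩, rfl⟩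
  refine ⟨?_, fun n => ?_, fun n => ?_⟩
  · rw [eq_top_iff]
    intro q _
    obtain ⟨x, rfl⟩ := K.mkQ_surjective q
    obtain ⟨s, v, hv, rfl⟩ := h.exists_eq_sum x
    rw [map_sum]
    refine Submodule.sum_mem _ fun n _ => Submodule.mem_iSup_of_mem n ?_
    rw [Module.End.mem_eigenspace_iff, Submodule.mkQ_apply, Submodule.mapQ_apply, hv,
      Submodule.Quotient.mk_smul]
  · have := h.finite n
    exact Submodule.finiteDimensional_of_le (hle n)
  · have := h.finite n
    have h1 := Submodule.finrank_mono (hle n)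
    have h2 := LinearMap.finrank_range_add_finrank_ker
      (K.mkQ.domRestrict (A.eigenspace (lam + n)))
    have h3 := h.finrank_le n
    by_cases hex : ∃ v, v ≠ 0 ∧ A v = (lam + n) • v
    · obtain ⟨v, hvK, hv0, hv⟩ := hne n hex
      have : 0 < finrank ℂ (LinearMap.ker (K.mkQ.domRestrict (A.eigenspace (lam + n)))) := by
        rw [Module.finrank_pos_iff_exists_ne_zero]
        refine ⟨⟨⟨v, Module.End.mem_eigenspace_iff.2 hv⟩, ?_⟩, ?_⟩
        · simpa using hvK
        · simpa [Subtype.ext_iff] using hv0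
      omega
    · push Not at hex
      have : finrank ℂ (A.eigenspace (lam + n)) = 0 := by
        rw [Submodule.finrank_eq_zero, Submodule.eq_bot_iff]
        intro v hv
        by_contra hv0
        exact hex v hv0 (Module.End.mem_eigenspace_iff.1 hv)
      omega

theorem subsingleton (h : CosetBounded A lam 0) (x : X) : x = 0 := by
  have : (⊥ : Submodule ℂ X) = ⊤ := h.eq_top_of_le fun n v hv => by
    have := h.finite n
    have := Submodule.finrank_eq_zero.1 (Nat.le_zero.1 (h.finrank_le n))
    exact this ▸ Module.End.mem_eigenspace_iff.2 hv
  exact (Submodule.mem_bot ℂ).1 (this ▸ Submodule.mem_top)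

end CosetBounded

end Weights

section CommutativeCurrents

theorem eq_zero_of_recurrence {V : Type} [AddCommGroup V] [Module ℂ V] {d : ℤ → V}
    (heven : ∀ j, d (-j) = d j) (h0 : d 0 = 0)
    (hrec : ∀ j : ℤ, (1 - (j : ℂ)) • d j + (j : ℂ) • d (j - 1) = 0)
    (hz : ∃ k : ℤ, k ≠ 0 ∧ d k = 0) (j : ℤ) : d j = 0 := by
  have hlin : ∀ n : ℕ, d (n + 1) = ((n : ℂ) + 1) • d 1 := fun n => by
    induction n with
    | zero => simp
    | succ n ih =>
      have h := hrec (n + 1 + 1)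
      rw [add_sub_cancel_right, ih] at h
      have hn : (n : ℂ) + 1 ≠ 0 := by exact_mod_cast n.succ_ne_zero
      refine smul_right_injective V hn ?_
      push_cast at h ⊢
      linear_combination (norm := module) -h
  have hpos : ∀ i : ℤ, i ≠ 0 → ∃ n : ℕ, d i = d (n + 1) := fun i hi => by
    rcases lt_or_gt_of_ne hi with h | h
    · exact ⟨(-i - 1).toNat, by rw [← heven]; congr 1; omega⟩
    · exact ⟨(i - 1).toNat, by congr 1; omega⟩
  have h1 : d 1 = 0 := by
    obtain ⟨k, hk, hdk⟩ := hz
    obtain ⟨n, hn⟩ := hpos k hk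
    rw [hn, hlin] at hdk
    exact (smul_eq_zero.1 hdk).resolve_left (by exact_mod_cast n.succ_ne_zero)
  by_cases hj : j = 0
  · rw [hj, h0]
  · obtain ⟨n, hn⟩ := hpos j hj
    rw [hn, hlin, h1, smul_zero]

theorem mul_eq_of_currents {Q : Type} [CommRing Q] [Algebra ℂ Q] {G : ℤ → Q}
    (hS : ∀ k j, G (k - j) * G j = G (-j) * G (k + j))
    (hδ : ∀ t l : ℤ, (∀ j, G (t - j) * G j = G 0 * G t) → ∀ j : ℤ,
      ((t : ℂ) - j) • (G (t + l - j) * G j) + (j : ℂ) • (G (t - j) * G (l + j)) =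
        (t : ℂ) • (G 0 * G (t + l)))
    (k j : ℤ) : G (k - j) * G j = G 0 * G k := by
  have h1 : ∀ j, G (1 - j) * G j = G 0 * G 1 := fun j => by
    induction j with
    | zero => simp [mul_comm]
    | succ i ih =>
      rw [← ih, hS 1 i]
      ring_nf
    | pred i ih =>
      rw [← ih, hS 1 (-i - 1)]
      ring_nf
  have hrec : ∀ k j : ℤ, (1 - (j : ℂ)) • (G (k - j) * G j - G 0 * G k)
      + (j : ℂ) • (G (k - (j - 1)) * G (j - 1) - G 0 * G k) = 0 := fun k j => by
    have h := hδ 1 (k - 1) h1 j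
    have h' := hS k (j - 1)
    rw [show -(j - 1) = 1 - j by ring, show k + (j - 1) = k - 1 + j by ring] at h'
    rw [h']
    rw [show 1 + (k - 1) = k by ring] at h
    push_cast at h
    linear_combination (norm := module) h
  have heven : ∀ k j : ℤ, G (k - -j) * G (-j) - G 0 * G k = G (k - j) * G j - G 0 * G k :=
    fun k j => by rw [hS k j, sub_neg_eq_add, mul_comm]
  have hne : ∀ k : ℤ, k ≠ 0 → ∀ j, G (k - j) * G j = G 0 * G k := fun k hk j =>
    sub_eq_zero.1 (eq_zero_of_recurrence (d := fun j => G (k - j) * G j - G 0 * G k) (heven k)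
      (by simp [mul_comm]) (hrec k) ⟨k, hk, by simp⟩ j)
  by_cases hk : k = 0
  · subst hk
    refine sub_eq_zero.1 (eq_zero_of_recurrence (d := fun j => G (0 - j) * G j - G 0 * G 0)
      (heven 0) (by simp) (hrec 0) ⟨1, one_ne_zero, ?_⟩ j)
    have h := hδ 2 (-2) (hne 2 two_ne_zero) 1
    norm_num at h
    have h2 : (2 : ℂ) • (G (-1) * G 1 - G 0 * G 0) = 0 := by
      rw [mul_comm (G 1)] at h
      linear_combination (norm := module) h
    simpa using h2
  · exact hne k hk j

theorem derivation_pow_mem {R : Type} [CommRing R] [Algebra ℂ R] {I : Ideal R}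
    {D : Derivation ℂ R R} (hD : ∀ z ∈ I, D z ∈ I) (y : R) {q : Polynomial ℂ} (hq : q ≠ 0)
    {j n : ℕ} (hn : q.natDegree ≤ n) (h : Polynomial.aeval y q * D y ^ j ∈ I) :
    D y ^ (j + 2 * n) ∈ I := by
  have hconst : ∀ {q : Polynomial ℂ} {j : ℕ}, q ≠ 0 → q.natDegree = 0 →
      Polynomial.aeval y q * D y ^ j ∈ I → D y ^ j ∈ I := fun {q j} hq hn0 h => by
    obtain ⟨a, rfl⟩ := Polynomial.natDegree_eq_zero.1 hn0
    have ha : a ≠ 0 := by simpa using hq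
    have := I.mul_mem_left (algebraMap ℂ R a⁻¹) h
    rwa [Polynomial.aeval_C, ← mul_assoc, ← map_mul, inv_mul_cancel₀ ha, map_one, one_mul] at this
  induction n generalizing q j with
  | zero => exact hconst hq (Nat.le_zero.1 hn) h
  | succ n ih =>
    by_cases hn0 : q.natDegree = 0
    · rw [pow_add]
      exact I.mul_mem_right _ (hconst hq hn0 h)
    have hdeg : q.derivative.natDegree ≤ n := by
      have := q.natDegree_derivative_le
      omega
    have hne : q.derivative ≠ 0 := Polynomial.derivative_ne_zero.2 hn0
    have key : Polynomial.aeval y q.derivative * D y ^ (j + 2) =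
        D (Polynomial.aeval y q * D y ^ j) * D y
          - (j : R) * D (D y) * (Polynomial.aeval y q * D y ^ j) := by
      rcases j with _ | j
      · simp [Derivation.map_aeval]
        ring
      · simp only [Derivation.leibniz, Derivation.map_aeval, Derivation.leibniz_pow, smul_eq_mul,
          nsmul_eq_mul, Nat.add_sub_cancel]
        push_cast
        ring
    have := ih hne (j := j + 2) hdeg
      (key ▸ I.sub_mem (I.mul_mem_right _ (hD _ h)) (I.mul_mem_left _ h))
    rwa [show j + 2 * (n + 1) = j + 2 + 2 * n by ring]

theorem isNilpotent_derivation {R : Type} [CommRing R] [Algebra ℂ R] (D : Derivation ℂ R R)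
    {y : R} (hy : IsNilpotent y) : IsNilpotent (D y) := by
  obtain ⟨n, hn⟩ := hy
  exact ⟨_, (Ideal.mem_bot).1 (derivation_pow_mem (I := ⊥) (D := D) (by simp) y
    (q := Polynomial.X ^ n) (by simp) (j := 0) le_rfl (by simp [hn]))⟩

theorem isNilpotent_currents {R : Type} [CommRing R] [Algebra ℂ R] {δ : ℤ → Derivation ℂ R R}
    {H : ℤ → R} {c : ℂ} (hc : c ≠ 0) (h0 : H 0 = algebraMap ℂ R c)
    (hδ : ∀ k j, δ k (H j) = (j : ℂ) • H (k + j))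
    (hnil : ∀ k j, IsNilpotent (H (-k) * δ k (H (-j) * H j))) (a b : ℤ) :
    IsNilpotent (H a * H b - c • H (a + b)) := by
  let mk := Ideal.Quotient.mkₐ ℂ (nilradical R)
  have hmk : ∀ z, mk z = 0 ↔ IsNilpotent z := fun z =>
    Ideal.Quotient.eq_zero_iff_mem.trans mem_nilradical
  have hnd : ∀ k z, mk z = 0 → mk (δ k z) = 0 := fun k z hz =>
    (hmk _).2 (isNilpotent_derivation _ ((hmk _).1 hz))
  have hδy : ∀ k j, k ≠ 0 → mk (δ k (H (-j) * H j)) = 0 := fun k j hk => by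
    set z := δ k (H (-j) * H j) with hz
    have h1 : mk (H (-k)) * mk z = 0 := by rw [← map_mul, hmk]; exact hnil k j
    have h2 := hnd k _ ((map_mul mk _ _).trans h1)
    simp only [Derivation.leibniz, hδ, smul_eq_mul, map_add, map_mul, map_smul,
      add_neg_cancel, h0, AlgHom.commutes] at h2
    have h3 : ((-k : ℤ) : ℂ) • (algebraMap ℂ (R ⧸ nilradical R) c * mk z ^ 2) = 0 := by
      have := congrArg (· * mk z) h2
      simp only [zero_mul, add_mul, mul_smul_comm, smul_mul_assoc] at this
      rw [← this, mul_right_comm, h1, zero_mul, zero_add]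
      congr 1
      ring
    rw [← Algebra.smul_def, smul_eq_zero, smul_eq_zero] at h3
    rcases h3 with h3 | h3 | h3
    · exact absurd (Int.cast_eq_zero.1 h3) (neg_ne_zero.2 hk)
    · exact absurd h3 hc
    · rw [← map_pow, hmk] at h3
      exact (hmk _).2 ((IsNilpotent.pow_iff_pos two_ne_zero).1 h3)
  have key : ∀ k j, mk (H (k - j)) * mk (H j) = mk (H 0) * mk (H k) := by
    refine mul_eq_of_currents (G := fun j => mk (H j)) (fun k j => ?_) fun t l h j => ?_
    · by_cases hk : k = 0
      · simp [hk]
      by_cases hj : j = 0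
      · simp [hj, mul_comm]
      have := hδy k j hk
      simp only [Derivation.leibniz, hδ, smul_eq_mul, map_add, map_mul, map_smul,
        mul_smul_comm] at this
      have h3 : (j : ℂ) • (mk (H (k - j)) * mk (H j) - mk (H (-j)) * mk (H (k + j))) = 0 := by
        rw [← sub_eq_add_neg] at this
        push_cast at this
        rw [mul_comm (mk (H (k - j)))]
        linear_combination (norm := module) -this
      exact sub_eq_zero.1 ((smul_eq_zero.1 h3).resolve_left (by exact_mod_cast hj))
    · have := hnd l (H (t - j) * H j - H 0 * H t) (by rw [map_sub, map_mul, map_mul, h, sub_self])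
      simp only [Derivation.leibniz, hδ, smul_eq_mul, map_add, map_sub, map_mul, map_smul,
        mul_smul_comm, Int.cast_zero, zero_smul, mul_zero, add_zero] at this
      rw [← sub_eq_zero, ← this, show l + (t - j) = t + l - j by ring, add_comm l t,
        mul_comm (mk (H j))]
      push_cast
      module
  rw [← hmk, map_sub, map_smul, map_mul]
  have := key (a + b) b
  rw [add_sub_cancel_right, h0, AlgHom.commutes, ← Algebra.smul_def] at this
  rw [this, sub_self]

end CommutativeCurrents

section CurrentOps

variable {X : Type} [AddCommGroup X] [Module ℂ X]

/-- Operators `L i`, `h j` representing the Witt algebra acting on a loop algebra of an abelian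
one-dimensional Lie algebra, with `h 0` acting by the scalar `c`. -/
structure CurrentOps (L h : ℤ → End ℂ X) (c : ℂ) : Prop where
  comm_LL : ∀ i j : ℤ, L i * L j - L j * L i = ((j : ℂ) - (i : ℂ)) • L (i + j)
  comm_Lh : ∀ i j : ℤ, L i * h j - h j * L i = (j : ℂ) • h (i + j)
  comm_hh : ∀ i j : ℤ, Commute (h i) (h j)
  h_zero : h 0 = c • 1

theorem aeval_restrict_apply {W : Submodule ℂ X} {f : End ℂ X} (hf : ∀ v ∈ W, f v ∈ W)
    (p : Polynomial ℂ) (v : W) :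
    ((Polynomial.aeval (f.restrict hf : End ℂ W) p v : W) : X) = Polynomial.aeval f p v := by
  induction p using Polynomial.induction_on' with
  | add p q hp hq => simp [hp, hq]
  | monomial n a =>
    rw [Polynomial.aeval_monomial, Polynomial.aeval_monomial, Module.End.pow_restrict]
    simp

namespace CurrentOps

variable {L h : ℤ → End ℂ X} {c : ℂ}

theorem L_h_apply (H : CurrentOps L h c) (i j : ℤ) (v : X) :
    L i (h j v) = h j (L i v) + (j : ℂ) • h (i + j) v := by
  have := LinearMap.congr_fun (H.comm_Lh i j) v
  simp only [LinearMap.sub_apply, Module.End.mul_apply, LinearMap.smul_apply] at this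
  rw [← this]
  abel

theorem L_L_apply (H : CurrentOps L h c) (i j : ℤ) (v : X) :
    L i (L j v) = L j (L i v) + ((j : ℂ) - i) • L (i + j) v := by
  have := LinearMap.congr_fun (H.comm_LL i j) v
  simp only [LinearMap.sub_apply, Module.End.mul_apply, LinearMap.smul_apply] at this
  rw [← this]
  abel

theorem weight_h (H : CurrentOps L h c) {μ : ℂ} {v : X} (hv : L 0 v = μ • v) (j : ℤ) :
    L 0 (h j v) = (μ + j) • h j v := by
  rw [H.L_h_apply, hv, map_smul, zero_add, add_smul]

theorem weight_L (H : CurrentOps L h c) {μ : ℂ} {v : X} (hv : L 0 v = μ • v) (j : ℤ) :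
    L 0 (L j v) = (μ + j) • L j v := by
  rw [H.L_L_apply, hv, map_smul, zero_add, add_smul, Int.cast_zero, sub_zero]

theorem weight_hL (H : CurrentOps L h c) {μ : ℂ} {v : X} (hv : L 0 v = μ • v) (j : ℤ) :
    L 0 (h (-j) (L j v)) = μ • h (-j) (L j v) := by
  rw [H.weight_h (H.weight_L hv j)]
  simp

theorem comm_mem_adjoin (H : CurrentOps L h c) (k : ℤ) {z : End ℂ X}
    (hz : z ∈ Algebra.adjoin ℂ (Set.range h)) :
    L k * z - z * L k ∈ Algebra.adjoin ℂ (Set.range h) := by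
  induction hz using Algebra.adjoin_induction with
  | mem z hz =>
    obtain ⟨j, rfl⟩ := hz
    rw [H.comm_Lh]
    exact Subalgebra.smul_mem _ (Algebra.subset_adjoin (Set.mem_range_self _)) _
  | algebraMap r =>
    rw [Algebra.commutes, sub_self]
    exact Subalgebra.zero_mem _
  | add x y _ _ hx hy =>
    rw [mul_add, add_mul, add_sub_add_comm]
    exact add_mem hx hy
  | mul x y hx' hy' hx hy =>
    rw [show L k * (x * y) - x * y * L k = (L k * x - x * L k) * y + x * (L k * y - y * L k) by
      noncomm_ring]
    exact add_mem (mul_mem hx hy') (mul_mem hx' hy)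

open scoped IsMulCommutative in
theorem isNilpotent_sub (H : CurrentOps L h c) (hc : c ≠ 0) {lam : ℂ} {d : ℕ}
    (hX : CosetBounded (L 0) lam d) (a b : ℤ) : IsNilpotent (h a * h b - c • h (a + b)) := by
  have hcomm : ∀ x ∈ Set.range h, ∀ y ∈ Set.range h, x * y = y * x := by
    rintro _ ⟨i, rfl⟩ _ ⟨j, rfl⟩
    exact H.comm_hh i j
  have := Algebra.isMulCommutative_adjoin ℂ hcomm
  let g : ℤ → Algebra.adjoin ℂ (Set.range h) := fun j => ⟨h j, Algebra.subset_adjoin ⟨j, rfl⟩⟩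
  let δ : ℤ → Derivation ℂ (Algebra.adjoin ℂ (Set.range h)) (Algebra.adjoin ℂ (Set.range h)) :=
    fun k => Derivation.mk'
      { toFun := fun z => ⟨L k * z - z * L k, H.comm_mem_adjoin k z.2⟩
        map_add' := fun x y => Subtype.ext (by
          change L k * (x + y : End ℂ X) - (x + y : End ℂ X) * L k = (_ - _) + (_ - _)
          noncomm_ring)
        map_smul' := fun r x => Subtype.ext (by
          change L k * (r • x : End ℂ X) - (r • x : End ℂ X) * L k = r • (_ - _)
          rw [mul_smul_comm, smul_mul_assoc, smul_sub]) }
      (fun x y => by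
        rw [smul_eq_mul, smul_eq_mul, add_comm, mul_comm y]
        refine Subtype.ext ?_
        change L k * (x * y : End ℂ X) - (x * y : End ℂ X) * L k =
          (L k * x - x * L k : End ℂ X) * y + x * (L k * y - y * L k : End ℂ X)
        noncomm_ring)
  have hδ : ∀ k z, ((δ k z : Algebra.adjoin ℂ (Set.range h)) : End ℂ X) = L k * z - z * L k :=
    fun _ _ => rfl
  have hmul : ∀ x y : Algebra.adjoin ℂ (Set.range h), ((x * y : Algebra.adjoin ℂ (Set.range h)) :
    End ℂ X) = x * y := fun _ _ => rfl
  suffices hmain : IsNilpotent (g a * g b - c • g (a + b)) by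
    obtain ⟨n, hn⟩ := hmain
    exact ⟨n, congrArg Subtype.val hn⟩
  refine isNilpotent_currents (δ := δ) (H := g) hc ?_ ?_ ?_ a b
  · exact Subtype.ext (H.h_zero.trans (Algebra.algebraMap_eq_smul_one c).symm)
  · exact fun k j => Subtype.ext (H.comm_Lh k j)
  · intro k j
    set y := g (-j) * g j
    set D := g (-k) • δ k
    have hD : ∀ (z : Algebra.adjoin ℂ (Set.range h)) (v : X),
        (D z : End ℂ X) v = h (-k) (L k ((z : End ℂ X) v)) - (z : End ℂ X) (h (-k) (L k v)) :=
      fun z v => by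
        have hz := LinearMap.congr_fun (congrArg Subtype.val (mul_comm (g (-k)) z)) (L k v)
        change h (-k) (L k ((z : End ℂ X) v) - (z : End ℂ X) (L k v)) = _
        rw [map_sub]
        exact congrArg _ hz
    have hy : ∀ n : ℤ, ∀ v ∈ (L 0).eigenspace (lam + n),
        (y : End ℂ X) v ∈ (L 0).eigenspace (lam + n) := fun n v hv => by
      rw [Module.End.mem_eigenspace_iff] at hv ⊢
      change L 0 (h (-j) (h j v)) = _ • h (-j) (h j v)
      rw [H.weight_h (H.weight_h hv j)]
      simp
    refine ⟨0 + 2 * d, Subtype.ext (LinearMap.ker_eq_top.1 (hX.eq_top_of_le fun n v hv => ?_))⟩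
    let I : Ideal (Algebra.adjoin ℂ (Set.range h)) :=
      { carrier := {z | ∀ v, L 0 v = (lam + n) • v → (z : End ℂ X) v = 0}
        add_mem' := fun {x y} hx hy v hv => by
          change (x : End ℂ X) v + (y : End ℂ X) v = 0
          rw [hx v hv, hy v hv, add_zero]
        zero_mem' := fun v _ => rfl
        smul_mem' := fun x y hy v hv => by
          change (x : End ℂ X) ((y : End ℂ X) v) = 0
          rw [hy v hv, map_zero] }
    have hI : ∀ z ∈ I, D z ∈ I := fun z hz v hv => by
      rw [hD, hz v hv, hz _ (H.weight_hL hv k)]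
      simp
    have := hX.finite n
    have hq := derivation_pow_mem hI y (j := 0) (n := d)
      (q := (LinearMap.restrict (y : End ℂ X) (hy n)).charpoly)
      (LinearMap.charpoly_monic _).ne_zero
      (by rw [LinearMap.charpoly_natDegree]; exact hX.finrank_le n)
      (fun v hv => by
        have h1 := aeval_restrict_apply (hy n)
          (LinearMap.restrict (y : End ℂ X) (hy n)).charpoly
          ⟨v, Module.End.mem_eigenspace_iff.2 hv⟩
        rw [LinearMap.aeval_self_charpoly] at h1
        rw [pow_zero, mul_one]
        have h2 := Polynomial.aeval_algHom_apply (Algebra.adjoin ℂ (Set.range h)).val y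
          (LinearMap.restrict (y : End ℂ X) (hy n)).charpoly
        exact (LinearMap.congr_fun h2 v).symm.trans h1.symm)
    exact hq v hv

end CurrentOps

end CurrentOps

section CurrentOps

variable {X : Type} [AddCommGroup X] [Module ℂ X]

theorem exists_mem_ker_of_isNilpotent {s : End ℂ X} (hs : IsNilpotent s) {W : Submodule ℂ X}
    (hW : W ≠ ⊥) (hst : ∀ v ∈ W, s v ∈ W) : ∃ v ∈ W, v ≠ 0 ∧ s v = 0 := by
  classical
  obtain ⟨w, hwW, hw0⟩ := W.exists_mem_ne_zero_of_ne_bot hW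
  obtain ⟨n, hn⟩ := hs
  have hex : ∃ k, (s ^ k) w = 0 := ⟨n, by rw [hn, LinearMap.zero_apply]⟩
  have hpos : Nat.find hex ≠ 0 := fun h0 => hw0 (by simpa [h0] using Nat.find_spec hex)
  obtain ⟨k, hk⟩ := Nat.exists_eq_succ_of_ne_zero hpos
  refine ⟨(s ^ k) w, ?_, Nat.find_min hex (by omega), ?_⟩
  · have : ∀ k, (s ^ k) w ∈ W := fun k => by
      induction k with
      | zero => exact hwW
      | succ k ih =>
        rw [pow_succ', Module.End.mul_apply]
        exact hst _ ih
    exact this k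
  · have := Nat.find_spec hex
    rwa [hk, Nat.succ_eq_add_one, pow_succ', Module.End.mul_apply] at this

theorem exists_common_kernel {S : Set (End ℂ X)} (hcomm : ∀ s ∈ S, ∀ t ∈ S, Commute s t)
    (hnil : ∀ s ∈ S, IsNilpotent s) (W : Submodule ℂ X) [FiniteDimensional ℂ W] (hW : W ≠ ⊥)
    (hst : ∀ s ∈ S, ∀ v ∈ W, s v ∈ W) : ∃ v ∈ W, v ≠ 0 ∧ ∀ s ∈ S, s v = 0 := by
  induction hd : finrank ℂ W using Nat.strong_induction_on generalizing W with
  | _ d ih =>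
    by_cases hall : ∀ s ∈ S, ∀ v ∈ W, s v = 0
    · obtain ⟨w, hwW, hw0⟩ := W.exists_mem_ne_zero_of_ne_bot hW
      exact ⟨w, hwW, hw0, fun s hs => hall s hs w hwW⟩
    · push Not at hall
      obtain ⟨s, hs, x, hxW, hx0⟩ := hall
      have hle : W ⊓ LinearMap.ker s ≤ W := inf_le_left
      have : FiniteDimensional ℂ ↥(W ⊓ LinearMap.ker s) := Submodule.finiteDimensional_of_le hle
      have hlt : W ⊓ LinearMap.ker s < W :=
        lt_of_le_of_ne hle fun h => hx0 (LinearMap.mem_ker.1 (h.ge hxW).2)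
      obtain ⟨v, hvW, hv0, hsv⟩ := exists_mem_ker_of_isNilpotent (hnil s hs) hW (hst s hs)
      obtain ⟨v, hv, hv'⟩ := ih _ (hd ▸ Submodule.finrank_lt_finrank_of_lt hlt)
        (W ⊓ LinearMap.ker s) (Submodule.ne_bot_iff _ |>.2 ⟨v, ⟨hvW, hsv⟩, hv0⟩)
        (fun t ht v hv => ⟨hst t ht v hv.1, by
          have := LinearMap.congr_fun (hcomm s hs t ht) v
          change s (t v) = 0
          exact this.trans ((congrArg t (LinearMap.mem_ker.1 hv.2)).trans (map_zero t))⟩) rfl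
      exact ⟨v, hv.1, hv'⟩

namespace CurrentOps

variable {L h : ℤ → End ℂ X} {c lam : ℂ} {d : ℕ}

theorem eq_zero_of_h_apply_eq_zero (H : CurrentOps L h c) (hc : c ≠ 0)
    (hX : CosetBounded (L 0) lam d) {k : ℤ} {v : X} (hv : h k v = 0) : v = 0 := by
  obtain ⟨n, hn⟩ := H.isNilpotent_sub hc hX (-k) k
  rw [neg_add_cancel, H.h_zero, smul_smul] at hn
  have : ∀ n : ℕ, ((h (-k) * h k - (c * c) • 1) ^ n) v = (-(c * c)) ^ n • v := fun n => by
    induction n with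
    | zero => simp
    | succ n ih =>
      rw [pow_succ', Module.End.mul_apply, ih, map_smul, LinearMap.sub_apply,
        Module.End.mul_apply, hv, map_zero, zero_sub, LinearMap.smul_apply, Module.End.one_apply]
      module
  have h0 := this n
  rw [hn, LinearMap.zero_apply] at h0
  exact (smul_eq_zero.1 h0.symm).resolve_left (pow_ne_zero _ (neg_ne_zero.2 (mul_ne_zero hc hc)))

/-- The vectors on which the currents `h` multiply like Laurent monomials. -/
def monomialVectors (h : ℤ → End ℂ X) (c : ℂ) : Submodule ℂ X :=
  ⨅ (a : ℤ) (b : ℤ), LinearMap.ker (h a * h b - c • h (a + b))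

theorem mem_monomialVectors {v : X} :
    v ∈ monomialVectors h c ↔ ∀ a b, h a (h b v) = c • h (a + b) v := by
  simp [monomialVectors, sub_eq_zero]

theorem h_mem_monomialVectors (H : CurrentOps L h c) {v : X} (hv : v ∈ monomialVectors h c)
    (k : ℤ) : h k v ∈ monomialVectors h c := by
  rw [mem_monomialVectors] at hv ⊢
  have hcomm : ∀ i w, h i (h k w) = h k (h i w) := fun i w => LinearMap.congr_fun (H.comm_hh i k) w
  intro a b
  rw [hcomm b, hcomm a, hv, map_smul, hcomm (a + b)]

theorem L_mem_monomialVectors (H : CurrentOps L h c) {v : X} (hv : v ∈ monomialVectors h c)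
    (k : ℤ) : L k v ∈ monomialVectors h c := by
  rw [mem_monomialVectors] at hv ⊢
  intro a b
  have hk := congrArg (L k) (hv a b)
  rw [H.L_h_apply, H.L_h_apply, map_add, map_smul, map_smul, H.L_h_apply, hv, hv,
    show a + (k + b) = k + (a + b) by ring, show k + a + b = k + (a + b) by ring] at hk
  push_cast at hk
  linear_combination (norm := module) hk

theorem exists_mem_monomialVectors (H : CurrentOps L h c) (hc : c ≠ 0)
    (hX : CosetBounded (L 0) lam d) (hne : ∃ v : X, v ≠ 0) :
    ∃ v ∈ monomialVectors h c, v ≠ 0 ∧ L 0 v = lam • v := by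
  obtain ⟨v, hv0⟩ := hne
  obtain ⟨n, v, -, hv0, hv⟩ := hX.exists_eigenvector_mem (K := ⊤) (fun _ _ => trivial)
    (fun h => hv0 ((Submodule.mem_bot ℂ).1 (h ▸ Submodule.mem_top)))
  have hW : (L 0).eigenspace lam ≠ ⊥ := (Submodule.ne_bot_iff _).2
    ⟨h (-n) v, by
      rw [Module.End.mem_eigenspace_iff, H.weight_h hv]
      simp, fun h0 => hv0 (H.eq_zero_of_h_apply_eq_zero hc hX h0)⟩
  have hfin := hX.finite 0
  rw [Int.cast_zero, add_zero] at hfin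
  have hcomm : ∀ a b i, Commute (h a * h b - c • h (a + b)) (h i) := fun a b i =>
    ((H.comm_hh a i).mul_left (H.comm_hh b i)).sub_left ((H.comm_hh _ i).smul_left c)
  set S : Set (End ℂ X) := {s | ∃ a b, s = h (-(a + b)) * (h a * h b - c • h (a + b))}
  have hScomm : ∀ s ∈ S, ∀ t ∈ S, Commute s t := by
    rintro _ ⟨a, b, rfl⟩ _ ⟨a', b', rfl⟩
    have hcc : ∀ i, Commute (h (-(a + b)) * (h a * h b - c • h (a + b))) (h i) := fun i =>
      (H.comm_hh _ i).mul_left (hcomm a b i)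
    exact (hcc _).mul_right (((hcc _).mul_right (hcc _)).sub_right ((hcc _).smul_right c))
  have hSnil : ∀ s ∈ S, IsNilpotent s := by
    rintro _ ⟨a, b, rfl⟩
    exact (hcomm a b _).symm.isNilpotent_mul_left (H.isNilpotent_sub hc hX a b)
  have hSst : ∀ s ∈ S, ∀ v ∈ (L 0).eigenspace lam, s v ∈ (L 0).eigenspace lam := by
    rintro _ ⟨a, b, rfl⟩ v hv
    rw [Module.End.mem_eigenspace_iff] at hv ⊢
    have h1 := H.weight_h (H.weight_h (H.weight_h hv b) a) (-(a + b))
    have h2 := H.weight_h (H.weight_h hv (a + b)) (-(a + b))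
    simp only [Module.End.mul_apply, LinearMap.sub_apply, LinearMap.smul_apply, map_sub, map_smul,
      h1, h2]
    push_cast
    module
  obtain ⟨v, hvW, hv0, hv⟩ := exists_common_kernel hScomm hSnil _ hW hSst
  refine ⟨v, mem_monomialVectors.2 fun a b => ?_, hv0, Module.End.mem_eigenspace_iff.1 hvW⟩
  have hab := hv (h (-(a + b)) * (h a * h b - c • h (a + b))) ⟨a, b, rfl⟩
  have := H.eq_zero_of_h_apply_eq_zero hc hX hab
  simpa [sub_eq_zero] using this

theorem exists_differentiated_vector (H : CurrentOps L h c) (hc : c ≠ 0)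
    (hX : CosetBounded (L 0) lam d) (hne : ∃ v : X, v ≠ 0) {m : ℕ} (hm : 4 * (d ^ 2 + 2) ≤ m) :
    ∃ v : X, v ≠ 0 ∧ L 0 v = lam • v ∧ (∀ a b, h a (h b v) = c • h (a + b) v) ∧
      ∀ s : ℤ, (fun b => h (s - b) (L b v)) ∈ polySub ⊥ m := by
  obtain ⟨v, hvY, hv0, hv⟩ := H.exists_mem_monomialVectors hc hX hne
  refine ⟨v, hv0, hv, mem_monomialVectors.1 hvY, fun s => ?_⟩
  set W : Submodule ℂ X := monomialVectors h c ⊓ (L 0).eigenspace lam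
  have hfin := hX.finite 0
  have hrank := hX.finrank_le 0
  rw [Int.cast_zero, add_zero] at hfin hrank
  have : FiniteDimensional ℂ W := Submodule.finiteDimensional_of_le inf_le_right
  have hWd : finrank ℂ W ≤ d := (Submodule.finrank_mono inf_le_right).trans hrank
  have hstab : ∀ b : ℤ, ∀ w ∈ W, (c⁻¹ • (h (-b) * L b) : End ℂ X) w ∈ W := fun b w hw =>
    ⟨Submodule.smul_mem _ _ (H.h_mem_monomialVectors (H.L_mem_monomialVectors hw.1 b) (-b)),
      Submodule.smul_mem _ _ (Module.End.mem_eigenspace_iff.2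
        (H.weight_hL (Module.End.mem_eigenspace_iff.1 hw.2) b))⟩
  let D : ℤ → End ℂ W := fun b => LinearMap.restrict _ (hstab b)
  have hcomp : ∀ i j : ℤ, ∀ w ∈ W, h (-i) (L i (h (-j) (L j w))) =
      c • h (-(i + j)) (L i (L j w)) - ((j : ℂ) * c) • h (-j) (L j w) := fun i j w hw => by
    have h1 := mem_monomialVectors.1 (H.L_mem_monomialVectors hw.1 j)
    have h2 := mem_monomialVectors.1
      (H.L_mem_monomialVectors (H.L_mem_monomialVectors hw.1 j) i)
    rw [H.L_h_apply, map_add, map_smul, h1, h2, show -i + (i + -j) = -j by ring,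
      show -i + -j = -(i + j) by ring]
    push_cast
    module
  let _ : LieRing (End ℂ W) := LieRing.ofAssociativeRing
  have hD : ∀ i j : ℤ,
      ⁅D i, D j⁆ = ((j : ℂ) - i) • D (i + j) - (j : ℂ) • D j + (i : ℂ) • D i := fun i j => by
    ext w
    change c⁻¹ • h (-i) (L i (c⁻¹ • h (-j) (L j w))) - c⁻¹ • h (-j) (L j (c⁻¹ • h (-i) (L i w))) =
      ((j : ℂ) - i) • c⁻¹ • h (-(i + j)) (L (i + j) w) - (j : ℂ) • c⁻¹ • h (-j) (L j w)
        + (i : ℂ) • c⁻¹ • h (-i) (L i w)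
    simp only [map_smul, hcomp _ _ _ w.2]
    rw [H.L_L_apply i j, add_comm j i, map_add, map_smul]
    match_scalars <;> field_simp
    ring
  have hzero : (diffEnd 1 ^ m) D = 0 := diffEnd_pow_eq_zero hD (by
    rw [Module.finrank_linearMap]
    nlinarith)
  have hDv : (fun b => D b ⟨v, hvY, Module.End.mem_eigenspace_iff.2 hv⟩) ∈
      polySub (⊥ : Submodule ℂ W) m := mem_polySub.2 fun b => by
    have := diffEnd_pow_comp (LinearMap.applyₗ (⟨v, hvY, Module.End.mem_eigenspace_iff.2 hv⟩ : W))
      1 m D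
    rw [hzero] at this
    exact (Submodule.mem_bot ℂ).2 (congrFun this b)
  convert polySub_map (h s ∘ₗ W.subtype) (T' := ⊥) (by simp) hDv using 1
  ext b
  change _ = h s (c⁻¹ • h (-b) (L b v))
  rw [map_smul, mem_monomialVectors.1 (H.L_mem_monomialVectors hvY b), inv_smul_smul₀ hc,
    sub_eq_add_neg]

end CurrentOps

end CurrentOps

section LoopRep

variable {𝔰 M : Type} [LieRing 𝔰] [LieAlgebra ℂ 𝔰] [AddCommGroup M] [Module ℂ M]

/-- Operators `L i`, `E j x` representing the semidirect product of the Witt algebra and the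
loop algebra of `𝔰`. -/
structure LoopRep (L : ℤ → End ℂ M) (E : ℤ → 𝔰 →ₗ[ℂ] End ℂ M) : Prop where
  comm_LL : ∀ i j : ℤ, L i * L j - L j * L i = ((j : ℂ) - i) • L (i + j)
  comm_LE : ∀ (i j : ℤ) (x : 𝔰), L i * E j x - E j x * L i = (j : ℂ) • E (i + j) x
  comm_EE : ∀ (i j : ℤ) (x y : 𝔰), E i x * E j y - E j y * E i x = E (i + j) ⁅x, y⁆

/-- Subspaces stable under all the operators `L i` and `E j x`. -/
structure LoopStable (L : ℤ → End ℂ M) (E : ℤ → 𝔰 →ₗ[ℂ] End ℂ M) (K : Submodule ℂ M) : Prop where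
  L_mem : ∀ i : ℤ, ∀ v ∈ K, L i v ∈ K
  E_mem : ∀ (j : ℤ) (x : 𝔰), ∀ v ∈ K, E j x v ∈ K

/-- The vectors killed by the loop algebra. -/
def loopInvariants (E : ℤ → 𝔰 →ₗ[ℂ] End ℂ M) : Submodule ℂ M :=
  ⨅ (j : ℤ) (x : 𝔰), LinearMap.ker (E j x)

theorem mem_loopInvariants {E : ℤ → 𝔰 →ₗ[ℂ] End ℂ M} {v : M} :
    v ∈ loopInvariants E ↔ ∀ j x, E j x v = 0 := by
  simp [loopInvariants]

/-- The vectors on which the differentiated products `E E` and `E L` of order `m` take values in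
the loop invariants. -/
def differentiatedVectors (L : ℤ → End ℂ M) (E : ℤ → 𝔰 →ₗ[ℂ] End ℂ M) (m : ℕ) :
    Submodule ℂ M where
  carrier := {v |
    (∀ (x y : 𝔰) (s : ℤ), (fun b => E (s - b) x (E b y v)) ∈ polySub (loopInvariants E) m) ∧
    ∀ (x : 𝔰) (s : ℤ), (fun b => E (s - b) x (L b v)) ∈ polySub (loopInvariants E) m}
  add_mem' := fun {v w} hv hw => by
    refine ⟨fun x y s => ?_, fun x s => ?_⟩
    · simp only [map_add]
      exact add_mem (hv.1 x y s) (hw.1 x y s)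
    · simp only [map_add]
      exact add_mem (hv.2 x s) (hw.2 x s)
  zero_mem' := by
    refine ⟨fun x y s => ?_, fun x s => ?_⟩ <;> simp only [map_zero] <;> exact zero_mem _
  smul_mem' := fun c v hv => by
    refine ⟨fun x y s => ?_, fun x s => ?_⟩
    · simp only [map_smul]
      exact Submodule.smul_mem _ c (hv.1 x y s)
    · simp only [map_smul]
      exact Submodule.smul_mem _ c (hv.2 x s)

namespace LoopRep

variable {L : ℤ → End ℂ M} {E : ℤ → 𝔰 →ₗ[ℂ] End ℂ M}

theorem L_L_apply (H : LoopRep L E) (i j : ℤ) (v : M) :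
    L i (L j v) = L j (L i v) + ((j : ℂ) - i) • L (i + j) v := by
  have := LinearMap.congr_fun (H.comm_LL i j) v
  simp only [LinearMap.sub_apply, Module.End.mul_apply, LinearMap.smul_apply] at this
  rw [← this]
  abel

theorem E_L_apply (H : LoopRep L E) (i j : ℤ) (x : 𝔰) (v : M) :
    E j x (L i v) = L i (E j x v) - (j : ℂ) • E (i + j) x v := by
  have := LinearMap.congr_fun (H.comm_LE i j x) v
  simp only [LinearMap.sub_apply, Module.End.mul_apply, LinearMap.smul_apply] at this
  rw [← this]
  abel

theorem E_E_apply (H : LoopRep L E) (i j : ℤ) (x y : 𝔰) (v : M) :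
    E i x (E j y v) = E j y (E i x v) + E (i + j) ⁅x, y⁆ v := by
  have := LinearMap.congr_fun (H.comm_EE i j x y) v
  simp only [LinearMap.sub_apply, Module.End.mul_apply] at this
  rw [← this]
  abel

theorem stable_loopInvariants (H : LoopRep L E) : LoopStable L E (loopInvariants E) where
  L_mem i v hv := mem_loopInvariants.2 fun j x => by
    rw [H.E_L_apply, mem_loopInvariants.1 hv, mem_loopInvariants.1 hv]
    simp
  E_mem j x v hv := by
    rw [mem_loopInvariants.1 hv]
    exact zero_mem _

theorem stable_differentiatedVectors (H : LoopRep L E) {m : ℕ} (hm : 1 ≤ m) :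
    LoopStable L E (differentiatedVectors L E m) where
  L_mem i v hv := by
    have hT := H.stable_loopInvariants.L_mem i
    refine ⟨fun x y s => ?_, fun x s => ?_⟩
    · have h1 := polySub_map (L i) hT (hv.1 x y s)
      have h2 := Submodule.smul_mem _ (s : ℂ) (hv.1 x y (s + i))
      have h3 := polySub_smul_sub_shift hm (hv.1 x y (s + i)) i
      convert sub_mem (sub_mem h1 h2) h3 using 1
      ext b
      simp only [Pi.sub_apply, Pi.smul_apply, H.E_L_apply, map_sub, map_smul]
      rw [show i + (s - b) = s + i - b by ring, show s + i - (b + i) = s - b by ring, add_comm i b]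
      push_cast
      module
    · have h1 := polySub_map (L i) hT (hv.2 x s)
      have h2 := Submodule.smul_mem _ (s : ℂ) (hv.2 x (s + i))
      have h3 := polySub_smul_sub_shift hm (hv.2 x (s + i)) i
      have h4 := Submodule.smul_mem _ (i : ℂ) (polySub_shift (hv.2 x (s + i)) i)
      convert add_mem (sub_mem (sub_mem h1 h2) h3) h4 using 1
      ext b
      simp only [Pi.sub_apply, Pi.add_apply, Pi.smul_apply]
      rw [H.L_L_apply b i, map_add, map_smul, H.E_L_apply,
        show i + (s - b) = s + i - b by ring, show s + i - (b + i) = s - b by ring]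
      push_cast
      module
  E_mem j z v hv := by
    have hT := H.stable_loopInvariants.E_mem j z
    refine ⟨fun x y s => ?_, fun x s => ?_⟩
    · have h1 := polySub_map (E j z) hT (hv.1 x y s)
      have h2 := hv.1 ⁅x, z⁆ y (s + j)
      have h3 := polySub_shift (hv.1 x ⁅y, z⁆ (s + j)) j
      convert add_mem (add_mem h1 h2) h3 using 1
      ext b
      simp only [Pi.add_apply]
      rw [H.E_E_apply b j, map_add, H.E_E_apply (s - b) j,
        show s - b + j = s + j - b by ring, show s + j - (b + j) = s - b by ring]
    · have h1 := polySub_map (E j z) hT (hv.2 x s)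
      have h2 := hv.2 ⁅x, z⁆ (s + j)
      have h3 := Submodule.smul_mem _ (j : ℂ) (polySub_shift (hv.1 x z (s + j)) j)
      convert add_mem (add_mem h1 h2) h3 using 1
      ext b
      simp only [Pi.add_apply, Pi.smul_apply]
      have hLE : L b (E j z v) = E j z (L b v) + (j : ℂ) • E (b + j) z v := by
        rw [H.E_L_apply]
        module
      rw [hLE, map_add, map_smul, H.E_E_apply (s - b) j,
        show s - b + j = s + j - b by ring, show s + j - (b + j) = s - b by ring]

theorem weight_E (H : LoopRep L E) {μ : ℂ} {v : M} (hv : L 0 v = μ • v) (x : 𝔰) :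
    L 0 (E 0 x v) = μ • E 0 x v := by
  have := H.E_L_apply 0 0 x v
  rw [hv, map_smul] at this
  simpa using this.symm

end LoopRep

end LoopRep

section LoopSl2

variable {𝔰 M : Type} [LieRing 𝔰] [LieAlgebra ℂ 𝔰] [AddCommGroup M] [Module ℂ M]

/-- Inside `K`, the `r`-th term consists of weight vectors for `h` of weight `n - 2 r` which the
currents of `e` map to the previous term. -/
def loweringFiltration (E : ℤ → 𝔰 →ₗ[ℂ] End ℂ M) (K : Submodule ℂ M) (e h : 𝔰) (n : ℕ) :
    ℕ → Submodule ℂ M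
  | 0 => ⊥
  | r + 1 => K ⊓ LinearMap.ker (E 0 h - ((n : ℂ) - 2 * (r + 1)) • 1) ⊓
      ⨅ j : ℤ, (loweringFiltration E K e h n r).comap (E j e)

theorem mem_loweringFiltration_succ {E : ℤ → 𝔰 →ₗ[ℂ] End ℂ M} {K : Submodule ℂ M} {e h : 𝔰}
    {n r : ℕ} {v : M} : v ∈ loweringFiltration E K e h n (r + 1) ↔
      v ∈ K ∧ E 0 h v = ((n : ℂ) - 2 * (r + 1)) • v ∧
        ∀ j, E j e v ∈ loweringFiltration E K e h n r := by
  simp [loweringFiltration, sub_eq_zero, and_assoc]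

theorem polySub_loweringFiltration_succ {E : ℤ → 𝔰 →ₗ[ℂ] End ℂ M} {K : Submodule ℂ M} {e h : 𝔰}
    {n r m : ℕ} {φ : ℤ → M} (hK : ∀ b, φ b ∈ K)
    (hw : ∀ b, E 0 h (φ b) = ((n : ℂ) - 2 * (r + 1)) • φ b)
    (he : ∀ j, (fun b => E j e (φ b)) ∈ polySub (loweringFiltration E K e h n r) m) :
    φ ∈ polySub (loweringFiltration E K e h n (r + 1)) m := by
  have hpoly : ∀ {T : Submodule ℂ M}, (∀ b, φ b ∈ T) → φ ∈ polySub T m := fun hT =>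
    polySub_mono _ (Nat.zero_le m) (mem_polySub_zero.2 hT)
  refine mem_polySub.2 fun b => mem_loweringFiltration_succ.2
    ⟨mem_polySub.1 (hpoly hK) b, ?_, fun j => ?_⟩
  · have := mem_polySub.1 (hpoly (T := LinearMap.ker (E 0 h - ((n : ℂ) - 2 * (r + 1)) • 1))
      fun b => by simp [hw b]) b
    simpa [sub_eq_zero] using this
  · have := mem_polySub.1 (he j) b
    rwa [diffEnd_pow_comp] at this

namespace LoopRep

variable {L : ℤ → End ℂ M} {E : ℤ → 𝔰 →ₗ[ℂ] End ℂ M} {e h f : 𝔰}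

theorem E_self_apply (H : LoopRep L E) (i j : ℤ) (x : 𝔰) (v : M) :
    E i x (E j x v) = E j x (E i x v) := by
  rw [H.E_E_apply i j, lie_self, map_zero, LinearMap.zero_apply, add_zero]

theorem e_f_apply (H : LoopRep L E) (ht : IsSl2Triple h e f) (i j : ℤ) (v : M) :
    E i e (E j f v) = E j f (E i e v) + E (i + j) h v := by
  rw [H.E_E_apply i j, ht.lie_e_f]

theorem h_e_apply (H : LoopRep L E) (ht : IsSl2Triple h e f) (i j : ℤ) (v : M) :
    E i h (E j e v) = E j e (E i h v) + (2 : ℂ) • E (i + j) e v := by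
  rw [H.E_E_apply i j, ht.lie_h_e_nsmul, map_nsmul, ← Nat.cast_smul_eq_nsmul ℂ]
  rfl

theorem h_f_apply (H : LoopRep L E) (ht : IsSl2Triple h e f) (i j : ℤ) (v : M) :
    E i h (E j f v) = E j f (E i h v) - (2 : ℂ) • E (i + j) f v := by
  rw [H.E_E_apply i j, ht.lie_h_f_nsmul, map_neg, map_nsmul, ← Nat.cast_smul_eq_nsmul ℂ,
    sub_eq_add_neg]
  rfl

theorem apply_pow_apply (A : End ℂ M) (k : ℕ) (v : M) : A ((A ^ k) v) = (A ^ (k + 1)) v := by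
  rw [pow_succ', Module.End.mul_apply]

theorem h_e_pow_apply (H : LoopRep L E) (ht : IsSl2Triple h e f) (j : ℤ) (k : ℕ) (v : M) :
    E j h ((E 0 e ^ (k + 1)) v) =
      (E 0 e ^ (k + 1)) (E j h v) + (2 * (k + 1) : ℂ) • E j e ((E 0 e ^ k) v) := by
  induction k with
  | zero => simpa using H.h_e_apply ht j 0 v
  | succ k ih =>
    rw [← apply_pow_apply, H.h_e_apply ht, ih, add_zero, map_add, map_smul, apply_pow_apply,
      ← H.E_self_apply j 0, apply_pow_apply]
    push_cast
    module

theorem e_pow_f_apply (H : LoopRep L E) (ht : IsSl2Triple h e f) (k : ℕ) (v : M) :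
    (E 0 e ^ (k + 1)) (E 0 f v) = E 0 f ((E 0 e ^ (k + 1)) v) +
      (k + 1 : ℂ) • (E 0 h ((E 0 e ^ k) v) - (k : ℂ) • (E 0 e ^ k) v) := by
  induction k with
  | zero => simpa using H.e_f_apply ht 0 0 v
  | succ k ih =>
    have h1 := H.h_e_apply ht 0 0 ((E 0 e ^ k) v)
    rw [add_zero, apply_pow_apply] at h1
    rw [← apply_pow_apply, ih, map_add, H.e_f_apply ht, apply_pow_apply, map_smul, map_sub,
      map_smul, apply_pow_apply, add_zero]
    push_cast
    linear_combination (norm := module) (-(k + 1) : ℂ) • h1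

theorem exists_e_pow_eq_zero (H : LoopRep L E) (ht : IsSl2Triple h e f) {lam : ℂ} {d : ℕ}
    (hM : CosetBounded (L 0) lam d) : ∃ k : ℕ, E 0 e ^ k = 0 := by
  refine ⟨d, LinearMap.ker_eq_top.1 (hM.eq_top_of_le fun n v hv => ?_)⟩
  have := hM.finite n
  set V := (L 0).eigenspace (lam + n)
  have hst : ∀ x : 𝔰, ∀ v ∈ V, E 0 x v ∈ V := fun x v hv => by
    rw [Module.End.mem_eigenspace_iff] at hv ⊢
    exact H.weight_E hv x
  set A : End ℂ V := (E 0 e).restrict (hst e)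
  have hpow : ∀ k (v : V), ((A ^ k) v : M) = (E 0 e ^ k) v := fun k v => by
    rw [Module.End.pow_restrict]
    rfl
  have hA : IsNilpotent A := by
    by_contra hnil
    have hne : ∀ k : ℕ, A ^ k ≠ 0 := fun k hk => hnil ⟨k, hk⟩
    let B : End ℂ V := (E 0 h).restrict (hst h)
    have hB : ∀ k : ℕ, Module.End.HasEigenvector (LinearMap.mulLeft ℂ B - LinearMap.mulRight ℂ B)
        (2 * (k + 1) : ℂ) (A ^ (k + 1)) := fun k => by
      refine ⟨Module.End.mem_eigenspace_iff.2 ?_, hne _⟩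
      ext v
      have := H.h_e_pow_apply ht 0 k v
      rw [apply_pow_apply] at this
      have h1 : E 0 h ((A ^ (k + 1)) v : M) - ((A ^ (k + 1)) (B v) : V) =
          (2 * (k + 1) : ℂ) • ((A ^ (k + 1)) v : M) := by
        rw [hpow, hpow, this]
        exact add_sub_cancel_left _ _
      exact h1
    have hli := Module.End.eigenvectors_linearIndependent' _ (fun k : ℕ => (2 * (k + 1) : ℂ))
      (fun i j hij => by
        have : (2 * ((i : ℂ) + 1)) = 2 * (j + 1) := hij
        exact_mod_cast add_right_cancel (mul_left_cancel₀ two_ne_zero this)) _ hB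
    exact not_finite_iff_infinite.2 (inferInstanceAs (Infinite ℕ)) hli.finite
  obtain ⟨q, hq⟩ := Nat.exists_eq_add_of_le (hM.finrank_le n)
  have hAd : A ^ d = 0 := by
    have h0 : A ^ finrank ℂ V = 0 := by
      rw [← A.aeval_self_charpoly, (LinearMap.isNilpotent_iff_charpoly A).1 hA, map_pow,
        Polynomial.aeval_X]
    rw [hq, pow_add, h0, zero_mul]
  have := hpow d ⟨v, Module.End.mem_eigenspace_iff.2 hv⟩
  rw [hAd] at this
  exact this.symm

end LoopRep

end LoopSl2

section LoopSl2

variable {𝔰 M : Type} [LieRing 𝔰] [LieAlgebra ℂ 𝔰] [AddCommGroup M] [Module ℂ M]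

namespace LoopRep

variable {L : ℤ → End ℂ M} {E : ℤ → 𝔰 →ₗ[ℂ] End ℂ M} {e h f : 𝔰}

theorem le_loopInvariants_of_e_eq_zero (H : LoopRep L E) (ht : IsSl2Triple h e f)
    (hspan : ∀ x : 𝔰, ∃ a b c : ℂ, x = a • e + b • h + c • f) {K : Submodule ℂ M}
    (hK : LoopStable L E K) (he : ∀ v ∈ K, E 0 e v = 0) : K ≤ loopInvariants E := fun v hv => by
  have hej : ∀ j, ∀ v ∈ K, E j e v = 0 := fun j v hv => by
    have := H.h_e_apply ht j 0 v
    rw [he v hv, he _ (hK.E_mem j h v hv), map_zero, zero_add, add_zero] at this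
    exact (smul_eq_zero.1 this.symm).resolve_left two_ne_zero
  have hhj : ∀ j, ∀ v ∈ K, E j h v = 0 := fun j v hv => by
    have := H.e_f_apply ht j 0 v
    rw [hej _ v hv, hej _ _ (hK.E_mem 0 f v hv), map_zero, zero_add, add_zero] at this
    exact this.symm
  have hfj : ∀ j, ∀ v ∈ K, E j f v = 0 := fun j v hv => by
    have := H.h_f_apply ht j 0 v
    rw [hhj _ v hv, hhj _ _ (hK.E_mem 0 f v hv), map_zero, zero_sub, add_zero] at this
    exact (smul_eq_zero.1 (neg_eq_zero.1 this.symm)).resolve_left two_ne_zero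
  refine mem_loopInvariants.2 fun j x => ?_
  obtain ⟨a, b, c, rfl⟩ := hspan x
  simp [hej j v hv, hhj j v hv, hfj j v hv]

theorem stable_iSup_loweringFiltration (H : LoopRep L E) (ht : IsSl2Triple h e f)
    (hspan : ∀ x : 𝔰, ∃ a b c : ℂ, x = a • e + b • h + c • f) {K : Submodule ℂ M}
    (hK : LoopStable L E K) (n : ℕ) :
    LoopStable L E (⨆ r, loweringFiltration E K e h n r) := by
  have hL : ∀ r i, ∀ v ∈ loweringFiltration E K e h n r,
      L i v ∈ loweringFiltration E K e h n r := fun r => by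
    induction r with
    | zero =>
      rintro i v hv
      rw [(Submodule.mem_bot ℂ).1 hv, map_zero]
      exact zero_mem _
    | succ r ih =>
      intro i v hv
      obtain ⟨h1, h2, h3⟩ := mem_loweringFiltration_succ.1 hv
      refine mem_loweringFiltration_succ.2 ⟨hK.L_mem i v h1, ?_, fun j => ?_⟩
      · rw [H.E_L_apply, h2, map_smul]
        simp
      · rw [H.E_L_apply]
        exact sub_mem (ih i _ (h3 j)) (Submodule.smul_mem _ _ (h3 _))
  have hh : ∀ r i, ∀ v ∈ loweringFiltration E K e h n r,
      E i h v ∈ loweringFiltration E K e h n r := fun r => by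
    induction r with
    | zero =>
      rintro i v hv
      rw [(Submodule.mem_bot ℂ).1 hv, map_zero]
      exact zero_mem _
    | succ r ih =>
      intro i v hv
      obtain ⟨h1, h2, h3⟩ := mem_loweringFiltration_succ.1 hv
      refine mem_loweringFiltration_succ.2 ⟨hK.E_mem i h v h1, ?_, fun j => ?_⟩
      · rw [H.E_self_apply, h2, map_smul]
      · have := H.h_e_apply ht i j v
        rw [← sub_eq_iff_eq_add] at this
        rw [← this]
        exact sub_mem (ih i _ (h3 j)) (Submodule.smul_mem _ _ (h3 _))
  have he : ∀ r i, ∀ v ∈ loweringFiltration E K e h n r,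
      E i e v ∈ loweringFiltration E K e h n (r - 1) := fun r i v hv => by
    cases r with
    | zero =>
      rw [(Submodule.mem_bot ℂ).1 hv, map_zero]
      exact zero_mem _
    | succ r => exact (mem_loweringFiltration_succ.1 hv).2.2 i
  have hf : ∀ r i, ∀ v ∈ loweringFiltration E K e h n r,
      E i f v ∈ loweringFiltration E K e h n (r + 1) := fun r => by
    induction r with
    | zero =>
      rintro i v hv
      rw [(Submodule.mem_bot ℂ).1 hv, map_zero]
      exact zero_mem _
    | succ r ih =>
      intro i v hv
      obtain ⟨h1, h2, h3⟩ := mem_loweringFiltration_succ.1 hv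
      refine mem_loweringFiltration_succ.2 ⟨hK.E_mem i f v h1, ?_, fun j => ?_⟩
      · rw [H.h_f_apply ht, h2, map_smul]
        push_cast
        rw [zero_add]
        module
      · rw [H.e_f_apply ht]
        exact add_mem (ih i _ (h3 j)) (hh _ _ v hv)
  have hmap : ∀ A : End ℂ M, (∀ r, ∃ r', ∀ v ∈ loweringFiltration E K e h n r,
      A v ∈ loweringFiltration E K e h n r') →
      ∀ v ∈ ⨆ r, loweringFiltration E K e h n r, A v ∈ ⨆ r, loweringFiltration E K e h n r :=
    fun A hA v hv => by
      suffices hle : ⨆ r, loweringFiltration E K e h n r ≤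
          (⨆ r, loweringFiltration E K e h n r).comap A from hle hv
      refine iSup_le fun r v hv => ?_
      obtain ⟨r', hr'⟩ := hA r
      exact Submodule.mem_iSup_of_mem r' (hr' v hv)
  refine ⟨fun i => hmap _ fun r => ⟨r, hL r i⟩, fun j x v hv => ?_⟩
  obtain ⟨a, b, c, rfl⟩ := hspan x
  simp only [map_add, map_smul, LinearMap.add_apply, LinearMap.smul_apply]
  exact add_mem (add_mem (Submodule.smul_mem _ _ (hmap _ (fun r => ⟨_, he r j⟩) v hv))
    (Submodule.smul_mem _ _ (hmap _ (fun r => ⟨_, hh r j⟩) v hv)))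
    (Submodule.smul_mem _ _ (hmap _ (fun r => ⟨_, hf r j⟩) v hv))

theorem e_pow_eq_zero_of_mem_loweringFiltration {K : Submodule ℂ M} {n : ℕ}
    (hn : ∀ v ∈ K, E 0 h ((E 0 e ^ n) v) = (n : ℂ) • (E 0 e ^ n) v)
    {r : ℕ} {v : M} (hv : v ∈ loweringFiltration E K e h n r) : (E 0 e ^ n) v = 0 := by
  have hpow : ∀ k r, ∀ v ∈ loweringFiltration E K e h n (k + r),
      (E 0 e ^ k) v ∈ loweringFiltration E K e h n r := fun k => by
    induction k with
    | zero =>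
      intro r v hv
      simpa using hv
    | succ k ih =>
      intro r v hv
      rw [← apply_pow_apply]
      rw [add_assoc, add_comm 1 r] at hv
      exact (mem_loweringFiltration_succ.1 (ih (r + 1) v hv)).2.2 0
  rcases le_or_gt r n with hr | hr
  · obtain ⟨k, rfl⟩ := Nat.exists_eq_add_of_le hr
    have := hpow r 0 v hv
    rw [(add_comm r k : r + k = k + r), pow_add, Module.End.mul_apply,
      (Submodule.mem_bot ℂ).1 this, map_zero]
  · obtain ⟨k, rfl⟩ := Nat.exists_eq_add_of_lt hr
    have h1 := (mem_loweringFiltration_succ.1 (hpow n (k + 1) v (by rwa [← add_assoc]))).2.1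
    have hvK := (mem_loweringFiltration_succ.1 hv).1
    rw [hn v hvK, ← sub_eq_zero, ← sub_smul] at h1
    refine (smul_eq_zero.1 h1).resolve_left ?_
    have : (k : ℂ) + 1 ≠ 0 := by exact_mod_cast k.succ_ne_zero
    intro h0
    apply this
    linear_combination h0 / 2

end LoopRep

end LoopSl2

section LoopSl2

variable {𝔰 M : Type} [LieRing 𝔰] [LieAlgebra ℂ 𝔰] [AddCommGroup M] [Module ℂ M]

namespace LoopRep

variable {L : ℤ → End ℂ M} {E : ℤ → 𝔰 →ₗ[ℂ] End ℂ M} {e h f : 𝔰}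

theorem mem_differentiatedVectors_of_highest (H : LoopRep L E) (ht : IsSl2Triple h e f)
    (hspan : ∀ x : 𝔰, ∃ a b c : ℂ, x = a • e + b • h + c • f) {K : Submodule ℂ M}
    (hK : LoopStable L E K) {n : ℕ}
    (hR : ⨆ r, loweringFiltration E K e h n r ≤ loopInvariants E) {v : M} (hvK : v ∈ K)
    (hev : ∀ j, E j e v = 0) (hhv : E 0 h v = (n : ℂ) • v)
    (hhh : ∀ a b, E a h (E b h v) = (n : ℂ) • E (a + b) h v) {m : ℕ} (hm : 1 ≤ m)
    (hhL : ∀ s : ℤ, (fun b => E (s - b) h (L b v)) ∈ polySub ⊥ m) :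
    v ∈ differentiatedVectors L E m := by
  have hRm : ∀ r, polySub (loweringFiltration E K e h n r) m ≤ polySub (loopInvariants E) m :=
    fun r => polySub_le ((le_iSup _ r).trans hR) m
  have hf0 : ∀ b, E 0 h (E b f v) = ((n : ℂ) - 2) • E b f v := fun b => by
    rw [H.h_f_apply ht, hhv, map_smul, zero_add]
    module
  have hehv : ∀ i j, E i e (E j h v) = 0 := fun i j => by
    have := H.h_e_apply ht j i v
    rw [hev, hev, map_zero, smul_zero, add_zero] at this
    exact this.symm
  have heL : ∀ i j, E i e (L j v) = 0 := fun i j => by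
    rw [H.E_L_apply, hev, hev, map_zero, smul_zero, sub_zero]
  have hef : ∀ i j, E i e (E j f v) = E (i + j) h v := fun i j => by
    rw [H.e_f_apply ht, hev, map_zero, zero_add]
  have hK2 : ∀ x y s b, E (s - b) x (E b y v) ∈ K := fun x y s b =>
    hK.E_mem _ _ _ (hK.E_mem _ _ _ hvK)
  have hhf : ∀ s : ℤ, (fun b => E (s - b) h (E b f v)) ∈
      polySub (loweringFiltration E K e h n 1) m := fun s => by
    refine polySub_loweringFiltration_succ (hK2 h f s) (fun b => ?_) fun j => ?_
    · rw [H.E_self_apply, hf0, map_smul]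
      push_cast
      module
    · change _ ∈ polySub ⊥ m
      convert polySub_const ⊥ hm (((n : ℂ) - 2) • E (s + j) h v) using 1
      ext b
      have := H.h_e_apply ht (s - b) j (E b f v)
      rw [← sub_eq_iff_eq_add] at this
      rw [← this, hef, hef, hhh, show s - b + (j + b) = s + j by ring,
        show s - b + j + b = s + j by ring]
      module
  have hfh : ∀ s : ℤ, (fun b => E (s - b) f (E b h v)) ∈
      polySub (loweringFiltration E K e h n 1) m := fun s => by
    refine polySub_loweringFiltration_succ (hK2 f h s) (fun b => ?_) fun j => ?_
    · rw [H.h_f_apply ht, H.E_self_apply, hhv, map_smul, map_smul]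
      push_cast
      rw [zero_add]
      module
    · change _ ∈ polySub ⊥ m
      convert polySub_const ⊥ hm ((n : ℂ) • E (s + j) h v) using 1
      ext b
      rw [H.e_f_apply ht, hehv, map_zero, zero_add, hhh, show j + (s - b) + b = s + j by ring]
  have hff : ∀ s : ℤ, (fun b => E (s - b) f (E b f v)) ∈
      polySub (loweringFiltration E K e h n 2) m := fun s => by
    refine polySub_loweringFiltration_succ (hK2 f f s) (fun b => ?_) fun j => ?_
    · rw [H.h_f_apply ht, hf0, map_smul]
      push_cast
      rw [zero_add]
      module
    · convert add_mem (polySub_shift (hfh (s + j)) j) (hhf (s + j)) using 1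
      ext b
      simp only [Pi.add_apply]
      rw [H.e_f_apply ht, hef, show j + (s - b) = s + j - b by ring,
        show s + j - (b + j) = s - b by ring, add_comm j b]
  have hfL : ∀ s : ℤ, (fun b => E (s - b) f (L b v)) ∈
      polySub (loweringFiltration E K e h n 1) m := fun s => by
    refine polySub_loweringFiltration_succ
      (fun b => hK.E_mem _ _ _ (hK.L_mem _ _ hvK)) (fun b => ?_) fun j => ?_
    · have hLb : E 0 h (L b v) = (n : ℂ) • L b v := by
        rw [H.E_L_apply, hhv, map_smul, Int.cast_zero, zero_smul, sub_zero]
      rw [H.h_f_apply ht, hLb, map_smul, zero_add]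
      push_cast
      module
    · change _ ∈ polySub ⊥ m
      convert hhL (s + j) using 1
      ext b
      rw [H.e_f_apply ht, heL, map_zero, zero_add, show j + (s - b) = s + j - b by ring]
  have hce : ∀ (y : 𝔰) (s : ℤ), (fun b => E (s - b) y (E b e v)) ∈
      polySub (loopInvariants E) m := fun y s => by
    simp only [hev, map_zero]
    exact zero_mem _
  have heh : ∀ s : ℤ, (fun b => E (s - b) e (E b h v)) ∈ polySub (loopInvariants E) m :=
    fun s => by
      simp only [hehv]
      exact zero_mem _
  have hef' : ∀ s : ℤ, (fun b => E (s - b) e (E b f v)) ∈ polySub (loopInvariants E) m :=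
    fun s => by
      simp only [hef, sub_add_cancel]
      exact polySub_const _ hm _
  have hhh' : ∀ s : ℤ, (fun b => E (s - b) h (E b h v)) ∈ polySub (loopInvariants E) m :=
    fun s => by
      simp only [hhh, sub_add_cancel]
      exact polySub_const _ hm _
  have heL' : ∀ s : ℤ, (fun b => E (s - b) e (L b v)) ∈ polySub (loopInvariants E) m :=
    fun s => by
      simp only [heL]
      exact zero_mem _
  have hcomb : ∀ {ψ₁ ψ₂ ψ₃ : ℤ → M} (a b c : ℂ), ψ₁ ∈ polySub (loopInvariants E) m →
      ψ₂ ∈ polySub (loopInvariants E) m → ψ₃ ∈ polySub (loopInvariants E) m →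
      (fun i => a • ψ₁ i + b • ψ₂ i + c • ψ₃ i) ∈ polySub (loopInvariants E) m :=
    fun a b c h₁ h₂ h₃ => add_mem (add_mem (Submodule.smul_mem _ a h₁)
      (Submodule.smul_mem _ b h₂)) (Submodule.smul_mem _ c h₃)
  refine ⟨fun x y s => ?_, fun x s => ?_⟩
  · obtain ⟨a, b, c, rfl⟩ := hspan x
    obtain ⟨a', b', c', rfl⟩ := hspan y
    simp only [map_add, map_smul, LinearMap.add_apply, LinearMap.smul_apply]
    have h1 := hcomb a b c (hce e s) (hce h s) (hce f s)
    have h2 := hcomb a b c (heh s) (hhh' s) (hRm _ (hfh s))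
    have h3 := hcomb a b c (hef' s) (hRm _ (hhf s)) (hRm _ (hff s))
    exact hcomb a' b' c' h1 h2 h3
  · obtain ⟨a, b, c, rfl⟩ := hspan x
    simp only [map_add, map_smul, LinearMap.add_apply, LinearMap.smul_apply]
    exact hcomb a b c (heL' s) (polySub_le bot_le m (hhL s)) (hRm _ (hfL s))

end LoopRep

end LoopSl2

section LoopSl2

variable {𝔰 M : Type} [LieRing 𝔰] [LieAlgebra ℂ 𝔰] [AddCommGroup M] [Module ℂ M]

namespace LoopRep

variable {L : ℤ → End ℂ M} {E : ℤ → 𝔰 →ₗ[ℂ] End ℂ M} {e h f : 𝔰}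

theorem exists_mem_differentiatedVectors_of_e_pow (H : LoopRep L E) (ht : IsSl2Triple h e f)
    (hspan : ∀ x : 𝔰, ∃ a b c : ℂ, x = a • e + b • h + c • f) {lam : ℂ} {d : ℕ}
    (hM : CosetBounded (L 0) lam d) {m : ℕ} (hm : 4 * (d ^ 2 + 2) ≤ m) {K : Submodule ℂ M}
    (hK : LoopStable L E K) {n : ℕ} (hn0 : n ≠ 0) (hn : ∀ v ∈ K, (E 0 e ^ (n + 1)) v = 0)
    (hmin : ∀ K' : Submodule ℂ M, LoopStable L E K' → (∀ v ∈ K', (E 0 e ^ n) v = 0) →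
      K' ≤ loopInvariants E) (hKT : ¬ K ≤ loopInvariants E) :
    ∃ v ∈ differentiatedVectors L E m, v ≠ 0 ∧ L 0 v = lam • v := by
  have hhn : ∀ v ∈ K, E 0 h ((E 0 e ^ n) v) = (n : ℂ) • (E 0 e ^ n) v := fun v hv => by
    have := H.e_pow_f_apply ht n v
    rw [hn v hv, hn _ (hK.E_mem 0 f v hv), map_zero, zero_add] at this
    exact sub_eq_zero.1 ((smul_eq_zero.1 this.symm).resolve_left (by exact_mod_cast n.succ_ne_zero))
  have hen : ∀ v ∈ K, ∀ j, E j e ((E 0 e ^ n) v) = 0 := fun v hv j => by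
    have := H.h_e_pow_apply ht j n v
    rw [hn v hv, hn _ (hK.E_mem j h v hv), map_zero, zero_add] at this
    exact (smul_eq_zero.1 this.symm).resolve_left
      (mul_ne_zero two_ne_zero (by exact_mod_cast n.succ_ne_zero))
  let X : Submodule ℂ M := K ⊓ LinearMap.ker (E 0 h - (n : ℂ) • 1) ⊓ ⨅ j, LinearMap.ker (E j e)
  have hX : ∀ v, v ∈ X ↔ v ∈ K ∧ E 0 h v = (n : ℂ) • v ∧ ∀ j, E j e v = 0 := fun v => by
    simp [X, sub_eq_zero, and_assoc]
  have hXL : ∀ i, ∀ v ∈ X, L i v ∈ X := fun i v hv => by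
    obtain ⟨h1, h2, h3⟩ := (hX v).1 hv
    refine (hX _).2 ⟨hK.L_mem i v h1, ?_, fun j => ?_⟩
    · rw [H.E_L_apply, h2, map_smul]
      simp
    · rw [H.E_L_apply, h3, h3, map_zero, smul_zero, sub_zero]
  have hXh : ∀ i, ∀ v ∈ X, E i h v ∈ X := fun i v hv => by
    obtain ⟨h1, h2, h3⟩ := (hX v).1 hv
    refine (hX _).2 ⟨hK.E_mem i h v h1, ?_, fun j => ?_⟩
    · rw [H.E_self_apply, h2, map_smul]
    · have := H.h_e_apply ht i j v
      rw [h3, h3, map_zero, smul_zero, add_zero] at this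
      exact this.symm
  have hKn : ∃ v ∈ K, (E 0 e ^ n) v ≠ 0 := by
    by_contra! hall
    exact hKT (hmin K hK hall)
  obtain ⟨w, hwK, hw0⟩ := hKn
  have hpowK : ∀ k, (E 0 e ^ k) w ∈ K := fun k => by
    induction k with
    | zero => exact hwK
    | succ k ih =>
      rw [← apply_pow_apply]
      exact hK.E_mem 0 e _ ih
  have hops : CurrentOps (fun i => (L i).restrict (hXL i)) (fun i => (E i h).restrict (hXh i))
      (n : ℂ) := by
    refine ⟨fun i j => ?_, fun i j => ?_, fun i j => ?_, ?_⟩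
    · ext v
      exact LinearMap.congr_fun (H.comm_LL i j) v
    · ext v
      exact LinearMap.congr_fun (H.comm_LE i j h) v
    · ext v
      exact H.E_self_apply i j h v
    · ext v
      exact ((hX v).1 v.2).2.1
  obtain ⟨v, hv0, hv, hhh, hhL⟩ := hops.exists_differentiated_vector
    (by exact_mod_cast hn0) (hM.restrict (hXL 0))
    ⟨⟨(E 0 e ^ n) w, (hX _).2 ⟨hpowK n, hhn w hwK, hen w hwK⟩⟩,
      fun h0 => hw0 (congrArg Subtype.val h0)⟩ hm
  obtain ⟨h1, h2, h3⟩ := (hX v).1 v.2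
  refine ⟨v, H.mem_differentiatedVectors_of_highest ht hspan hK (hmin _
    (H.stable_iSup_loweringFiltration ht hspan hK n) fun u hu => ?_) h1 h3 h2
    (fun a b => congrArg Subtype.val (hhh a b)) (by omega)
    fun s => polySub_map X.subtype (by simp) (hhL s), by simpa using hv0,
    congrArg Subtype.val hv⟩
  suffices hle : ⨆ r, loweringFiltration E K e h n r ≤ LinearMap.ker (E 0 e ^ n) from hle hu
  exact iSup_le fun r u hu => e_pow_eq_zero_of_mem_loweringFiltration hhn hu

theorem exists_mem_differentiatedVectors (H : LoopRep L E) (ht : IsSl2Triple h e f)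
    (hspan : ∀ x : 𝔰, ∃ a b c : ℂ, x = a • e + b • h + c • f) {lam : ℂ} {d : ℕ}
    (hM : CosetBounded (L 0) lam d) {m : ℕ} (hm : 4 * (d ^ 2 + 2) ≤ m)
    (hne : ∃ v, v ≠ 0 ∧ L 0 v = lam • v) :
    ∃ v ∈ differentiatedVectors L E m, v ≠ 0 ∧ L 0 v = lam • v := by
  classical
  by_cases hT : (⊤ : Submodule ℂ M) ≤ loopInvariants E
  · obtain ⟨v, hv0, hv⟩ := hne
    have hT0 : ∀ j x w, E j x w = 0 := fun j x w => mem_loopInvariants.1 (hT trivial) j x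
    refine ⟨v, ⟨fun x y s => ?_, fun x s => ?_⟩, hv0, hv⟩ <;> simp only [hT0] <;> exact zero_mem _
  have hex : ∃ k : ℕ, ∃ K : Submodule ℂ M, LoopStable L E K ∧ (∀ v ∈ K, (E 0 e ^ k) v = 0) ∧
      ¬ K ≤ loopInvariants E := by
    obtain ⟨k, hk⟩ := H.exists_e_pow_eq_zero ht hM
    exact ⟨k, ⊤, ⟨fun _ _ _ => trivial, fun _ _ _ _ => trivial⟩, fun v _ => by simp [hk], hT⟩
  obtain ⟨K, hK, hKn, hKT⟩ := Nat.find_spec hex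
  have hmin : ∀ k < Nat.find hex, ∀ K' : Submodule ℂ M, LoopStable L E K' →
      (∀ v ∈ K', (E 0 e ^ k) v = 0) → K' ≤ loopInvariants E := fun k hk K' h1 h2 => by
    by_contra h3
    exact Nat.find_min hex hk ⟨K', h1, h2, h3⟩
  match hn : Nat.find hex with
  | 0 =>
    rw [hn] at hKn
    exact absurd (fun v hv => by rw [show v = 0 from hKn v hv]; exact zero_mem _) hKT
  | 1 =>
    rw [hn] at hKn
    exact absurd (H.le_loopInvariants_of_e_eq_zero ht hspan hK fun v hv => by
      simpa using hKn v hv) hKT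
  | n + 2 =>
    rw [hn] at hKn hmin
    exact H.exists_mem_differentiatedVectors_of_e_pow ht hspan hM hm hK (n := n + 1) (by omega)
      hKn (hmin (n + 1) (by omega)) hKT

end LoopRep

end LoopSl2

section Differentiators

variable {𝔰 : Type} [LieRing 𝔰] [LieAlgebra ℂ 𝔰]

section Defs

variable {M : Type} [AddCommGroup M] [Module ℂ M]

/-- The `m`-th difference in `b` of the operators `E (s - b) x * L b`. -/
def differentiator (L : ℤ → End ℂ M) (E : ℤ → 𝔰 →ₗ[ℂ] End ℂ M) (m : ℕ) (x : 𝔰) (s b : ℤ) :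
    End ℂ M :=
  (diffEnd 1 ^ m) (fun b : ℤ => E (s - b) x * L b) b

theorem differentiator_apply (L : ℤ → End ℂ M) (E : ℤ → 𝔰 →ₗ[ℂ] End ℂ M) (m : ℕ) (x : 𝔰)
    (s b : ℤ) (v : M) :
    differentiator L E m x s b v = (diffEnd 1 ^ m) (fun b : ℤ => E (s - b) x (L b v)) b :=
  (congrFun (diffEnd_pow_comp (LinearMap.applyₗ v) 1 m fun b : ℤ => E (s - b) x * L b) b).symm

/-- The vectors killed by all products of `r` differentiators. -/
def differentiatorKernel (L : ℤ → End ℂ M) (E : ℤ → 𝔰 →ₗ[ℂ] End ℂ M) (m : ℕ) : ℕ → Submodule ℂ M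
  | 0 => ⊥
  | r + 1 => ⨅ (x : 𝔰) (s : ℤ) (b : ℤ),
      (differentiatorKernel L E m r).comap (differentiator L E m x s b)

theorem mem_differentiatorKernel_succ {L : ℤ → End ℂ M} {E : ℤ → 𝔰 →ₗ[ℂ] End ℂ M} {m r : ℕ}
    {v : M} : v ∈ differentiatorKernel L E m (r + 1) ↔
      ∀ x s b, differentiator L E m x s b v ∈ differentiatorKernel L E m r := by
  simp [differentiatorKernel]

/-- The span of the differentiators. -/
def differentiatorSpan (L : ℤ → End ℂ M) (E : ℤ → 𝔰 →ₗ[ℂ] End ℂ M) (m : ℕ) :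
    Submodule ℂ (End ℂ M) :=
  Submodule.span ℂ {D | ∃ x s b, D = differentiator L E m x s b}

theorem differentiator_mem_span (L : ℤ → End ℂ M) (E : ℤ → 𝔰 →ₗ[ℂ] End ℂ M) (m : ℕ) (x : 𝔰)
    (s b : ℤ) : differentiator L E m x s b ∈ differentiatorSpan L E m :=
  Submodule.subset_span ⟨x, s, b, rfl⟩

theorem apply_eq_zero_of_mem_differentiatorSpan_pow {L : ℤ → End ℂ M}
    {E : ℤ → 𝔰 →ₗ[ℂ] End ℂ M} {m r : ℕ} {A : End ℂ M} (hA : A ∈ differentiatorSpan L E m ^ r)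
    {v : M} (hv : v ∈ differentiatorKernel L E m r) : A v = 0 := by
  induction r generalizing A v with
  | zero => rw [(Submodule.mem_bot ℂ).1 hv, map_zero]
  | succ r ih =>
    rw [Submodule.pow_succ] at hA
    have hD : ∀ D ∈ differentiatorSpan L E m, D v ∈ differentiatorKernel L E m r := fun D hD => by
      induction hD using Submodule.span_induction with
      | mem D hD =>
        obtain ⟨x, s, b, rfl⟩ := hD
        exact mem_differentiatorKernel_succ.1 hv x s b
      | zero => exact zero_mem _
      | add D D' _ _ h h' => exact add_mem h h'
      | smul c D _ h => exact Submodule.smul_mem _ c h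
    induction hA using Submodule.mul_induction_on' with
    | mem_mul_mem B hB D hD' => exact ih hB (hD D hD')
    | add B _ B' _ h h' => rw [LinearMap.add_apply, h, h', add_zero]

end Defs

namespace LoopRep

variable {M : Type} [AddCommGroup M] [Module ℂ M]
  {L : ℤ → End ℂ M} {E : ℤ → 𝔰 →ₗ[ℂ] End ℂ M} {e h f : 𝔰}

theorem differentiatedVectors_le_differentiatorKernel (H : LoopRep L E) (m : ℕ) :
    differentiatedVectors L E m ≤ differentiatorKernel L E m 2 := fun v hv => by
  refine mem_differentiatorKernel_succ.2 fun x s b => mem_differentiatorKernel_succ.2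
    fun x' s' b' => ?_
  have hT : differentiator L E m x s b v ∈ loopInvariants E := by
    rw [differentiator_apply]
    exact mem_polySub.1 (hv.2 x s) b
  rw [differentiator_apply]
  simp only [mem_loopInvariants.1 (H.stable_loopInvariants.L_mem _ _ hT)]
  exact (congrFun (map_zero (diffEnd 1 ^ m : End ℂ (ℤ → M))) b').symm ▸ zero_mem _

/-- The operators on the quotient by a stable subspace induced by a current. -/
def quotientE {K : Submodule ℂ M} (hK : LoopStable L E K) (j : ℤ) : 𝔰 →ₗ[ℂ] End ℂ (M ⧸ K) where
  toFun x := K.mapQ K (E j x) (hK.E_mem j x)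
  map_add' x y := by
    ext v
    simp
  map_smul' c x := by
    ext v
    simp

theorem quotient (H : LoopRep L E) {K : Submodule ℂ M} (hK : LoopStable L E K) :
    LoopRep (fun i => K.mapQ K (L i) (hK.L_mem i)) (quotientE hK) where
  comm_LL i j := by
    ext v
    exact congrArg K.mkQ (LinearMap.congr_fun (H.comm_LL i j) v)
  comm_LE i j x := by
    ext v
    exact congrArg K.mkQ (LinearMap.congr_fun (H.comm_LE i j x) v)
  comm_EE i j x y := by
    ext v
    exact congrArg K.mkQ (LinearMap.congr_fun (H.comm_EE i j x y) v)

theorem differentiator_quotient {K : Submodule ℂ M} (hK : LoopStable L E K) (m : ℕ) (x : 𝔰)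
    (s b : ℤ) (v : M) :
    differentiator (fun i => K.mapQ K (L i) (hK.L_mem i)) (quotientE hK) m x s b (K.mkQ v) =
      K.mkQ (differentiator L E m x s b v) := by
  rw [differentiator_apply, differentiator_apply]
  exact congrFun (diffEnd_pow_comp K.mkQ 1 m fun b : ℤ => E (s - b) x (L b v)) b

theorem mem_differentiatorKernel_add_two (H : LoopRep L E) {m : ℕ}
    (hK : LoopStable L E (differentiatedVectors L E m)) {r : ℕ} {v : M}
    (hv : (differentiatedVectors L E m).mkQ v ∈ differentiatorKernel
      (fun i => Submodule.mapQ _ _ (L i) (hK.L_mem i)) (quotientE hK) m r) :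
    v ∈ differentiatorKernel L E m (r + 2) := by
  induction r generalizing v with
  | zero =>
    refine H.differentiatedVectors_le_differentiatorKernel m ?_
    rw [← Submodule.ker_mkQ (differentiatedVectors L E m)]
    exact hv
  | succ r ih =>
    refine mem_differentiatorKernel_succ.2 fun x s b => ih ?_
    rw [← differentiator_quotient]
    exact mem_differentiatorKernel_succ.1 hv x s b

end LoopRep

theorem LoopRep.differentiatorKernel_eq_top {e h f : 𝔰} (ht : IsSl2Triple h e f)
    (hspan : ∀ x : 𝔰, ∃ a b c : ℂ, x = a • e + b • h + c • f) {lam : ℂ} {m d : ℕ}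
    (hm : 4 * (d ^ 2 + 2) ≤ m) {M : Type} [AddCommGroup M] [Module ℂ M] {L : ℤ → End ℂ M}
    {E : ℤ → 𝔰 →ₗ[ℂ] End ℂ M} (H : LoopRep L E) (hM : CosetBounded (L 0) lam d) {r : ℕ}
    (hr : 2 * d ≤ r) : differentiatorKernel L E m r = ⊤ := by
  induction d generalizing M r with
  | zero =>
    refine eq_top_iff.2 fun v _ => ?_
    rw [hM.subsingleton v]
    exact zero_mem _
  | succ d ih =>
    have hK := H.stable_differentiatedVectors (m := m) (by omega)
    have hQ := hM.quotient (hK.L_mem 0) fun n hn =>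
      H.exists_mem_differentiatedVectors ht hspan (hM.add_int n) hm hn
    obtain ⟨r, rfl⟩ := Nat.exists_eq_add_of_le' (show 2 ≤ r by omega)
    refine eq_top_iff.2 fun v _ => H.mem_differentiatorKernel_add_two hK ?_
    rw [ih (by nlinarith) (H.quotient hK) hQ (by omega)]
    trivial

end Differentiators

section DirectionalDifferences

variable {Γ V W : Type} [AddCommGroup Γ] [AddCommGroup V] [Module ℂ V] [AddCommGroup W] [Module ℂ W]

theorem diffEnd_pow_comp_of_invariant {A : Γ → V →ₗ[ℂ] W} {g : Γ} (hA : ∀ p, A (p + g) = A p)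
    (m : ℕ) (φ : Γ → V) :
    (diffEnd g ^ m) (fun p => A p (φ p)) = fun p => A p ((diffEnd g ^ m) φ p) := by
  induction m generalizing φ with
  | zero => rfl
  | succ m ih =>
    rw [pow_succ, pow_succ, Module.End.mul_apply, Module.End.mul_apply, ← ih]
    congr 1
    ext p
    simp [hA]

theorem diffEnd_pow_congr {g g' : Γ} {φ : Γ → V} (h : ∀ p, φ (p + g) = φ (p + g')) (m : ℕ) :
    (diffEnd g ^ m) φ = (diffEnd g' ^ m) φ := by
  have h1 : diffEnd g φ = diffEnd g' φ := by
    ext p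
    simp [h]
  induction m with
  | zero => rfl
  | succ m ih =>
    rw [pow_succ, Module.End.mul_apply, h1, ← Module.End.mul_apply,
      ((diffEnd_commute g g').pow_left m).eq, Module.End.mul_apply, ih, ← Module.End.mul_apply,
      ← pow_succ']

theorem diffEnd_pow_apply_path {g : Γ} {ι : ℤ → Γ} (hι : ∀ k, ι (k + 1) = ι k + g) (m : ℕ)
    (φ : Γ → V) (k : ℤ) : (diffEnd g ^ m) φ (ι k) = (diffEnd 1 ^ m) (fun k => φ (ι k)) k := by
  induction m generalizing φ with
  | zero => rfl
  | succ m ih =>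
    rw [pow_succ, pow_succ, Module.End.mul_apply, Module.End.mul_apply, ih]
    have : (fun k => diffEnd g φ (ι k)) = diffEnd 1 fun k => φ (ι k) := by
      ext k
      simp [hι]
    rw [this]

theorem diffEnd_pow_comp_addMonoidHom (σ : Γ →+ Γ) (g : Γ) (m : ℕ) (φ : Γ → V) :
    (diffEnd g ^ m) (fun p => φ (σ p)) = fun p => (diffEnd (σ g) ^ m) φ (σ p) := by
  induction m generalizing φ with
  | zero => rfl
  | succ m ih =>
    rw [pow_succ, pow_succ, Module.End.mul_apply, Module.End.mul_apply, ← ih]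
    congr 1
    ext p
    simp

theorem diffEnd_pow_smul_eq_zero {g : Γ} {φ : Γ → V} (hφ : ∀ p, φ (p + g) = φ p) (α : Γ →+ ℤ)
    {m : ℕ} (hm : 2 ≤ m) : (diffEnd g ^ m) (fun p => (α p : ℂ) • φ p) = 0 := by
  obtain ⟨m, rfl⟩ := Nat.exists_eq_add_of_le' hm
  have : (diffEnd g ^ 2) (fun p => (α p : ℂ) • φ p) = 0 := by
    ext p
    rw [pow_two, Module.End.mul_apply]
    simp only [diffEnd_apply, hφ, map_add, Int.cast_add, Pi.zero_apply]
    module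
  rw [pow_add, Module.End.mul_apply, this, map_zero]

end DirectionalDifferences

section Gluing

variable {𝔰 M : Type} [LieRing 𝔰] [LieAlgebra ℂ 𝔰] [AddCommGroup M] [Module ℂ M]
  {L : ℤ → End ℂ M} {E : ℤ → 𝔰 →ₗ[ℂ] End ℂ M}

theorem diffEnd_pow_mem_differentiatorSpan {Γ : Type} [AddCommGroup Γ] {g : Γ} (α β : Γ →+ ℤ)
    (hα : α g = -1) (hβ : β g = 1) (m : ℕ) (x : 𝔰) (p : Γ) :
    (diffEnd g ^ m) (fun p => E (α p) x * L (β p)) p ∈ differentiatorSpan L E m := by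
  have h := diffEnd_pow_apply_path (g := g) (ι := fun k : ℤ => p + (k - β p) • g)
    (fun k => by module) m (fun p => E (α p) x * L (β p)) (β p)
  simp only [map_add, map_zsmul, hα, hβ, sub_self, zero_smul, add_zero, smul_eq_mul, mul_one,
    add_sub_cancel] at h
  rw [h]
  have hk : ∀ k : ℤ, α p + (k - β p) * -1 = α p + β p - k := fun k => by ring
  simp only [hk]
  exact differentiator_mem_span L E m x (α p + β p) (β p)

theorem diffEnd_pow_mul_eq_zero {Γ : Type} [AddCommGroup Γ] {g g' : Γ} {A B : Γ → End ℂ M}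
    {S : Submodule ℂ (End ℂ M)} {m : ℕ} (hA : ∀ p, (diffEnd g ^ m) A p ∈ S)
    (hB : ∀ p, (diffEnd g' ^ m) B p ∈ S) (hA' : ∀ p, A (p + g') = A p)
    (hB' : ∀ p, B (p + g) = B p) :
    (diffEnd g ^ m * diffEnd g' ^ m : End ℂ (Γ → End ℂ M ⧸ S * S))
      (fun p => (S * S).mkQ (A p * B p)) = 0 := by
  have h1 := diffEnd_pow_comp_of_invariant (A := fun p => LinearMap.mulLeft ℂ (A p)) (g := g')
    (fun p => by simp only [hA']) m B
  have hB'' : ∀ p, (diffEnd g' ^ m) B (p + g) = (diffEnd g' ^ m) B p := fun p => by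
    have hc : shiftEnd g ((diffEnd g' ^ m) B) = (diffEnd g' ^ m) (shiftEnd g B) :=
      (LinearMap.congr_fun (((diffEnd_commute_shiftEnd g' g).pow_left m).eq) B).symm
    have hs : shiftEnd g B = B := funext hB'
    rw [hs] at hc
    exact congrFun hc p
  have h2 := diffEnd_pow_comp_of_invariant
    (A := fun p => LinearMap.mulRight ℂ ((diffEnd g' ^ m) B p)) (g := g)
    (fun p => by simp only [hB'']) m A
  simp only [LinearMap.mulLeft_apply, LinearMap.mulRight_apply] at h1 h2
  rw [Module.End.mul_apply, diffEnd_pow_comp, h1, diffEnd_pow_comp, h2]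
  ext1 p
  exact (Submodule.Quotient.mk_eq_zero _).2 (Submodule.mul_mem_mul (hA p) (hB p))

end Gluing

section QuadraticGluing

variable {𝔰 M : Type} [LieRing 𝔰] [LieAlgebra ℂ 𝔰] [AddCommGroup M] [Module ℂ M]
  {L : ℤ → End ℂ M} {E : ℤ → 𝔰 →ₗ[ℂ] End ℂ M}

theorem LoopRep.E_mul_L_mul_E_mul_L (H : LoopRep L E) (a a' b b' : ℤ) (x y : 𝔰) :
    E a x * L b * (E a' y * L b') =
      E a x * E a' y * (L b * L b') + (a' : ℂ) • (E a x * E (a' + b) y * L b') := by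
  have h : L b * E a' y = E a' y * L b + (a' : ℂ) • E (a' + b) y := by
    rw [add_comm a' b, ← H.comm_LE]
    abel
  rw [mul_assoc, ← mul_assoc (L b), h, add_mul, mul_add, smul_mul_assoc, mul_smul_comm]
  simp only [mul_assoc]

/-- The quadratic expressions `E a x * E a' y * L (b + b' + 1)`, as functions of the indices. -/
def quadraticSymbol (L : ℤ → End ℂ M) (E : ℤ → 𝔰 →ₗ[ℂ] End ℂ M) (x y : 𝔰)
    (p : ℤ × ℤ × ℤ × ℤ) : End ℂ M :=
  E p.1 x * E p.2.1 y * L (p.2.2.1 + p.2.2.2 + 1)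

theorem LoopRep.diffEnd_pow_quadraticSymbol (H : LoopRep L E) {m : ℕ} (hm : 2 ≤ m) (x y : 𝔰)
    (S : Submodule ℂ (End ℂ M)) (hS : S = differentiatorSpan L E m) :
    (diffEnd (-1, 0, 1, 0) ^ (2 * m) * diffEnd (0, -1, 1, 0) ^ (2 * m) :
        End ℂ (ℤ × ℤ × ℤ × ℤ → End ℂ M ⧸ S * S))
      (fun p => (S * S).mkQ (quadraticSymbol L E x y p)) = 0 := by
  let α : ℤ × ℤ × ℤ × ℤ →+ ℤ := AddMonoidHom.fst _ _
  let α' : ℤ × ℤ × ℤ × ℤ →+ ℤ := (AddMonoidHom.fst _ _).comp (AddMonoidHom.snd _ _)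
  let β : ℤ × ℤ × ℤ × ℤ →+ ℤ :=
    (AddMonoidHom.fst _ _).comp ((AddMonoidHom.snd _ _).comp (AddMonoidHom.snd _ _))
  let β' : ℤ × ℤ × ℤ × ℤ →+ ℤ :=
    (AddMonoidHom.snd _ _).comp ((AddMonoidHom.snd _ _).comp (AddMonoidHom.snd _ _))
  let q := (S * S).mkQ
  let X : End ℂ (ℤ × ℤ × ℤ × ℤ → End ℂ M ⧸ S * S) := diffEnd (-1, 0, 1, 0)
  let Y : End ℂ (ℤ × ℤ × ℤ × ℤ → End ℂ M ⧸ S * S) := diffEnd (0, -1, 0, 1)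
  let U : End ℂ (ℤ × ℤ × ℤ × ℤ → End ℂ M ⧸ S * S) := diffEnd (-1, 0, 0, 1)
  let V : End ℂ (ℤ × ℤ × ℤ × ℤ → End ℂ M ⧸ S * S) := diffEnd (0, -1, 1, 0)
  have hYX : Commute (Y ^ m) (X ^ m) := (diffEnd_commute _ _).pow_pow _ _
  have hUX : Commute (U ^ m) (X ^ m) := (diffEnd_commute _ _).pow_pow _ _
  have hVX : Commute (V ^ m) (X ^ m) := (diffEnd_commute _ _).pow_pow _ _
  have hUY : Commute (U ^ m) (Y ^ m) := (diffEnd_commute _ _).pow_pow _ _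
  have hVY : Commute (V ^ m) (Y ^ m) := (diffEnd_commute _ _).pow_pow _ _
  have hVU : Commute (V ^ m) (U ^ m) := (diffEnd_commute _ _).pow_pow _ _
  have hz : ∀ i j : ℤ, i + -1 + (j + 1) = i + j := fun i j => by ring
  have h1 : (X ^ m * Y ^ m) (fun p => q (E (α p) x * L (β p) * (E (α' p) y * L (β' p)))) = 0 := by
    refine diffEnd_pow_mul_eq_zero (A := fun p => E (α p) x * L (β p))
      (B := fun p => E (α' p) y * L (β' p)) (fun p => ?_) (fun p => ?_) (fun p => ?_) fun p => ?_
    · exact hS ▸ diffEnd_pow_mem_differentiatorSpan α β rfl rfl m x p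
    · exact hS ▸ diffEnd_pow_mem_differentiatorSpan α' β' rfl rfl m y p
    · simp [α, β]
    · simp [α', β']
  have h2 : (U ^ m * V ^ m) (fun p => q (E (α p) x * L (β' p) * (E (α' p) y * L (β p)))) = 0 := by
    refine diffEnd_pow_mul_eq_zero (A := fun p => E (α p) x * L (β' p))
      (B := fun p => E (α' p) y * L (β p)) (fun p => ?_) (fun p => ?_) (fun p => ?_) fun p => ?_
    · exact hS ▸ diffEnd_pow_mem_differentiatorSpan α β' rfl rfl m x p
    · exact hS ▸ diffEnd_pow_mem_differentiatorSpan α' β rfl rfl m y p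
    · simp [α, β']
    · simp [α', β]
  have h3 : (V ^ m) (fun p => (α' p : ℂ) • q (E (α p) x * E (α' p + β p) y * L (β' p))) = 0 :=
    diffEnd_pow_smul_eq_zero (fun p => by simp [α, α', β, β', hz]) α' hm
  have h4 : (Y ^ m) (fun p => (α' p : ℂ) • q (E (α p) x * E (α' p + β' p) y * L (β p))) = 0 :=
    diffEnd_pow_smul_eq_zero (fun p => by simp [α, α', β, β', hz]) α' hm
  let P : End ℂ (ℤ × ℤ × ℤ × ℤ → End ℂ M ⧸ S * S) := X ^ m * Y ^ m * (U ^ m * V ^ m)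
  let Θ : ℤ × ℤ × ℤ × ℤ → End ℂ M ⧸ S * S := fun p =>
    ((β' p : ℂ) - β p) • q (E (α p) x * E (α' p) y * L (β p + β' p))
  have hPΘ : P Θ = 0 := by
    have hΘ : Θ = (fun p => q (E (α p) x * L (β p) * (E (α' p) y * L (β' p))))
        - (fun p => q (E (α p) x * L (β' p) * (E (α' p) y * L (β p))))
        - (fun p => (α' p : ℂ) • q (E (α p) x * E (α' p + β p) y * L (β' p)))
        + (fun p => (α' p : ℂ) • q (E (α p) x * E (α' p + β' p) y * L (β p))) := by
      ext1 p
      simp only [Pi.sub_apply, Pi.add_apply, Θ]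
      rw [← map_smul, ← map_smul, ← map_smul, ← map_sub, ← map_sub, ← map_add,
        H.E_mul_L_mul_E_mul_L, H.E_mul_L_mul_E_mul_L, ← mul_smul_comm, ← H.comm_LL, mul_sub]
      congr 1
      abel
    have e1 : P = U ^ m * V ^ m * (X ^ m * Y ^ m) :=
      ((hUX.mul_right hUY).mul_left (hVX.mul_right hVY)).symm.eq
    have e3 : P = X ^ m * Y ^ m * U ^ m * V ^ m := by simp only [P, mul_assoc]
    have e4 : P = X ^ m * (U ^ m * V ^ m) * Y ^ m := by
      rw [mul_assoc (X ^ m) (U ^ m * V ^ m), (hUY.mul_left hVY).eq, ← mul_assoc]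
    rw [hΘ, map_add, map_sub, map_sub]
    nth_rw 1 [e1]
    nth_rw 2 [e3]
    nth_rw 2 [e4]
    simp only [P, Module.End.mul_apply] at h1 h2 ⊢
    rw [h1, h2, h3, h4]
    simp
  have hΨ : P (fun p => q (quadraticSymbol L E x y p)) = 0 := by
    have hs : ∀ g, P (shiftEnd g Θ) = 0 := fun g => by
      have hc : ∀ g', Commute (diffEnd g' ^ m : End ℂ (ℤ × ℤ × ℤ × ℤ → End ℂ M ⧸ S * S))
        (shiftEnd g) := fun g' => (diffEnd_commute_shiftEnd g' g).pow_left m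
      have hc' : Commute P (shiftEnd g) :=
        ((hc _).mul_left (hc _)).mul_left ((hc _).mul_left (hc _))
      rw [← Module.End.mul_apply, hc'.eq, Module.End.mul_apply, hPΘ, map_zero]
    have h : (fun p => q (quadraticSymbol L E x y p)) =
        (1 / 2 : ℂ) • (shiftEnd (0, 0, 0, 1) Θ - shiftEnd (0, 0, 1, 0) Θ) := by
      ext1 p
      simp only [Θ, Pi.smul_apply, Pi.sub_apply, shiftEnd_apply, quadraticSymbol, α, α', β, β',
        AddMonoidHom.coe_fst, AddMonoidHom.coe_snd, AddMonoidHom.comp_apply, Prod.fst_add,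
        Prod.snd_add, add_zero, Int.cast_add, Int.cast_one, ← add_assoc]
      rw [add_right_comm p.2.2.1 1]
      module
    rw [h, map_smul, map_sub, hs, hs, sub_zero, smul_zero]
  have hXU : (U ^ m) (fun p => q (quadraticSymbol L E x y p)) =
      (X ^ m) fun p => q (quadraticSymbol L E x y p) :=
    diffEnd_pow_congr (fun p => by simp [quadraticSymbol, add_right_comm, add_assoc]) m
  have hVYq : (Y ^ m) (fun p => q (quadraticSymbol L E x y p)) =
      (V ^ m) fun p => q (quadraticSymbol L E x y p) :=
    diffEnd_pow_congr (fun p => by simp [quadraticSymbol, add_right_comm, add_assoc]) m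
  change (X ^ (2 * m) * V ^ (2 * m)) (fun p => q (quadraticSymbol L E x y p)) = 0
  have hc : ∀ {A B : End ℂ (ℤ × ℤ × ℤ × ℤ → End ℂ M ⧸ S * S)}, Commute A B →
      ∀ f, A (B f) = B (A f) := fun h f => LinearMap.congr_fun h.eq f
  rw [← hΨ, two_mul, pow_add, pow_add]
  simp only [P, Module.End.mul_apply]
  rw [hc hVU.symm, hXU, hc hVX, hc hYX, hc hVY.symm, hVYq]

end QuadraticGluing

section DifferentiatorPowers

variable {𝔰 M : Type} [LieRing 𝔰] [LieAlgebra ℂ 𝔰] [AddCommGroup M] [Module ℂ M]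
  {L : ℤ → End ℂ M} {E : ℤ → 𝔰 →ₗ[ℂ] End ℂ M}

theorem LoopRep.differentiator_lie_mem (H : LoopRep L E) {m : ℕ} (hm : 2 ≤ m) (x y : 𝔰)
    (s b : ℤ) : differentiator L E (4 * m) ⁅x, y⁆ s b ∈
      differentiatorSpan L E m * differentiatorSpan L E m := by
  obtain ⟨S, hS⟩ : ∃ S, S = differentiatorSpan L E m := ⟨_, rfl⟩
  rw [← hS, ← Submodule.Quotient.mk_eq_zero]
  let σ : ℤ × ℤ × ℤ × ℤ →+ ℤ × ℤ × ℤ × ℤ :=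
    { toFun := fun p => (p.2.1, p.1, p.2.2)
      map_zero' := rfl
      map_add' := fun _ _ => rfl }
  let X : End ℂ (ℤ × ℤ × ℤ × ℤ → End ℂ M ⧸ S * S) := diffEnd (-1, 0, 1, 0)
  let V : End ℂ (ℤ × ℤ × ℤ × ℤ → End ℂ M ⧸ S * S) := diffEnd (0, -1, 1, 0)
  let Φ : ℤ × ℤ × ℤ × ℤ → End ℂ M ⧸ S * S := fun p =>
    (S * S).mkQ (E (p.1 + p.2.1) ⁅x, y⁆ * L (p.2.2.1 + p.2.2.2 + 1))
  have h1 := H.diffEnd_pow_quadraticSymbol hm x y S hS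
  have h2 : (V ^ (2 * m) * X ^ (2 * m))
      (fun p => (S * S).mkQ (quadraticSymbol L E y x (σ p))) = 0 := by
    have h := H.diffEnd_pow_quadraticSymbol hm y x S hS
    rw [Module.End.mul_apply] at h ⊢
    rw [diffEnd_pow_comp_addMonoidHom σ _ _ fun p => (S * S).mkQ (quadraticSymbol L E y x p),
      diffEnd_pow_comp_addMonoidHom σ]
    ext1 p
    exact congrFun h (σ p)
  have h3 : (X ^ (2 * m) * V ^ (2 * m)) Φ = 0 := by
    have hΦ : Φ = (fun p => (S * S).mkQ (quadraticSymbol L E x y p)) -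
        fun p => (S * S).mkQ (quadraticSymbol L E y x (σ p)) := by
      ext1 p
      simp only [Φ, Pi.sub_apply]
      rw [← map_sub, ← H.comm_EE, sub_mul]
      rfl
    have hc : Commute (X ^ (2 * m)) (V ^ (2 * m)) := (diffEnd_commute _ _).pow_pow _ _
    rw [hΦ, map_sub, h1, hc.eq, h2, sub_zero]
  have hVX : (V ^ (2 * m)) Φ = (X ^ (2 * m)) Φ :=
    diffEnd_pow_congr (fun p => by simp [Φ, ← add_assoc, add_right_comm]) _
  have h4 : (X ^ (4 * m)) Φ = 0 := by
    rw [← h3, Module.End.mul_apply, hVX, ← Module.End.mul_apply, ← pow_add]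
    congr 2
    ring
  have h5 := diffEnd_pow_apply_path (g := ((-1, 0, 1, 0) : ℤ × ℤ × ℤ × ℤ))
    (ι := fun k : ℤ => (s - k, 0, k - 1, 0)) (fun k => by simp; ring) (4 * m) Φ b
  rw [show (diffEnd (-1, 0, 1, 0) ^ (4 * m)) Φ = 0 from h4] at h5
  simp only [Φ, add_zero, sub_add_cancel] at h5
  rw [diffEnd_pow_comp] at h5
  exact h5.symm

theorem differentiator_mem_of_span {m : ℕ} {T : Submodule ℂ (End ℂ M)} {s b : ℤ} {X : Set 𝔰}
    (h : ∀ x ∈ X, differentiator L E m x s b ∈ T) {x : 𝔰} (hx : x ∈ Submodule.span ℂ X) :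
    differentiator L E m x s b ∈ T := by
  let f : 𝔰 →ₗ[ℂ] End ℂ M :=
    { toFun := fun x => differentiator L E m x s b
      map_add' := fun x y => by
        simp only [differentiator, map_add, add_mul]
        exact congrFun (map_add (diffEnd 1 ^ m) _ _) b
      map_smul' := fun c x => by
        simp only [differentiator, map_smul, smul_mul_assoc]
        exact congrFun (map_smul (diffEnd 1 ^ m) c _) b }
  exact (Submodule.span_le (p := T.comap f)).2 h hx

theorem LoopRep.differentiatorSpan_le_mul (H : LoopRep L E)
    (hperf : ∀ x : 𝔰, x ∈ Submodule.span ℂ {z | ∃ x y : 𝔰, z = ⁅x, y⁆}) {m : ℕ} (hm : 2 ≤ m) :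
    differentiatorSpan L E (4 * m) ≤ differentiatorSpan L E m * differentiatorSpan L E m := by
  rw [differentiatorSpan, Submodule.span_le]
  rintro _ ⟨x, s, b, rfl⟩
  refine differentiator_mem_of_span ?_ (hperf x)
  rintro _ ⟨x, y, rfl⟩
  exact H.differentiator_lie_mem hm x y s b

theorem LoopRep.differentiatorSpan_le_pow (H : LoopRep L E)
    (hperf : ∀ x : 𝔰, x ∈ Submodule.span ℂ {z | ∃ x y : 𝔰, z = ⁅x, y⁆}) {m : ℕ} (hm : 2 ≤ m)
    (j : ℕ) : differentiatorSpan L E (4 ^ j * m) ≤ differentiatorSpan L E m ^ 2 ^ j := by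
  induction j with
  | zero => simp
  | succ j ih =>
    have hm' : 2 ≤ 4 ^ j * m := hm.trans (Nat.le_mul_of_pos_left m (by positivity))
    rw [pow_succ' 4, mul_assoc, pow_succ 2, mul_two,
      Submodule.pow_add _ (pow_ne_zero j two_ne_zero)]
    exact (H.differentiatorSpan_le_mul hperf hm').trans (mul_le_mul' ih ih)

theorem LoopRep.differentiator_eq_zero (H : LoopRep L E) {h e f : 𝔰} (ht : IsSl2Triple h e f)
    (hspan : ∀ x : 𝔰, ∃ a b c : ℂ, x = a • e + b • h + c • f) {lam : ℂ} {d : ℕ}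
    (hM : CosetBounded (L 0) lam d) (x : 𝔰) (s b : ℤ) :
    differentiator L E (4 ^ (2 * d) * (4 * (d ^ 2 + 2))) x s b = 0 := by
  have hperf : ∀ x : 𝔰, x ∈ Submodule.span ℂ {z | ∃ x y : 𝔰, z = ⁅x, y⁆} := fun x => by
    obtain ⟨a, b, c, rfl⟩ := hspan x
    have hb : ∀ y z : 𝔰, ⁅y, z⁆ ∈ Submodule.span ℂ {z | ∃ x y : 𝔰, z = ⁅x, y⁆} := fun y z =>
      Submodule.subset_span ⟨y, z, rfl⟩
    have he : e = (1 / 2 : ℂ) • ⁅h, e⁆ := by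
      rw [ht.lie_h_e_nsmul, ← Nat.cast_smul_eq_nsmul ℂ, smul_smul]
      norm_num
    have hf : f = (-1 / 2 : ℂ) • ⁅h, f⁆ := by
      rw [ht.lie_h_f_nsmul, ← Nat.cast_smul_eq_nsmul ℂ, smul_neg, smul_smul]
      norm_num
    refine add_mem (add_mem (Submodule.smul_mem _ _ ?_) (Submodule.smul_mem _ _ ?_))
      (Submodule.smul_mem _ _ ?_)
    · rw [he]
      exact Submodule.smul_mem _ _ (hb _ _)
    · rw [← ht.lie_e_f]
      exact hb _ _
    · rw [hf]
      exact Submodule.smul_mem _ _ (hb _ _)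
  have hker := H.differentiatorKernel_eq_top ht hspan le_rfl hM
    (Nat.lt_two_pow_self (n := 2 * d)).le
  ext v
  exact apply_eq_zero_of_mem_differentiatorSpan_pow
    (H.differentiatorSpan_le_pow hperf (by omega) _ (differentiator_mem_span L E _ x s b))
    (hker ▸ Submodule.mem_top)

end DifferentiatorPowers

section SimpleLieAlgebra

variable {𝔨 : Type} [LieRing 𝔨] [LieAlgebra ℂ 𝔨]

theorem exists_isSl2Triple [FiniteDimensional ℂ 𝔨] [LieAlgebra.IsSimple ℂ 𝔨] :
    ∃ h e f : 𝔨, IsSl2Triple h e f := by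
  obtain ⟨x, hx⟩ := LieAlgebra.exists_isCartanSubalgebra_engel ℂ 𝔨
  let H := LieSubalgebra.engel ℂ x
  have : H.IsCartanSubalgebra := hx
  have hirr : (LieAlgebra.IsKilling.rootSystem H).IsIrreducible := inferInstance
  have : Nontrivial (Dual ℂ H) := hirr.nontrivial
  obtain ⟨α, hα⟩ : ∃ α : LieModule.Weight ℂ H 𝔨, α.IsNonZero := by
    by_contra! h
    have hspan := LieAlgebra.IsKilling.span_weight_isNonZero_eq_top ℂ 𝔨 H
    rw [show {α : LieModule.Weight ℂ H 𝔨 | α.IsNonZero} = ∅ by ext α; simpa using h α,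
      Set.image_empty, Submodule.span_empty] at hspan
    exact bot_ne_top hspan
  obtain ⟨h, e, f, ht, -⟩ := LieAlgebra.IsKilling.exists_isSl2Triple_of_weight_isNonZero hα
  exact ⟨h, e, f, ht⟩

theorem eq_top_of_lie_mem [LieAlgebra.IsSimple ℂ 𝔨] {N : Submodule ℂ 𝔨}
    (hN : ∀ x y : 𝔨, y ∈ N → ⁅x, y⁆ ∈ N) {x : 𝔨} (hx : x ∈ N) (hx0 : x ≠ 0) : N = ⊤ := by
  let I : LieIdeal ℂ 𝔨 := { N with lie_mem := fun {x y} => hN x y }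
  rcases LieAlgebra.IsSimple.eq_bot_or_eq_top I with h | h
  · have hI : x ∈ I := hx
    rw [h] at hI
    exact absurd hI hx0
  · rw [eq_top_iff]
    intro y _
    have hI : y ∈ I := h ▸ LieSubmodule.mem_top y
    exact hI

end SimpleLieAlgebra

section Cuspidal

theorem cosetBounded_restrict_iSup {X : Type} [AddCommGroup X] [Module ℂ X] {A : End ℂ X} {d : ℕ}
    (hA : ∀ μ : ℂ, Module.rank ℂ (A.eigenspace μ) ≤ d) (lam : ℂ)
    (hK : ∀ v ∈ ⨆ n : ℤ, A.eigenspace (lam + n), A v ∈ ⨆ n : ℤ, A.eigenspace (lam + n)) :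
    CosetBounded (A.restrict hK) lam d := by
  have hfin : ∀ n : ℤ, FiniteDimensional ℂ (A.eigenspace (lam + n)) := fun n =>
    Module.rank_lt_aleph0_iff.1 ((hA _).trans_lt (Cardinal.natCast_lt_aleph0))
  refine ⟨?_, fun n => ?_, fun n => ?_⟩
  · rw [eq_top_iff]
    rintro x -
    have hle : ⨆ n : ℤ, A.eigenspace (lam + n) ≤
        (⨆ n : ℤ, Module.End.eigenspace (A.restrict hK) (lam + n)).map (Submodule.subtype _) := by
      refine iSup_le fun n v hv => ?_
      refine ⟨⟨v, Submodule.mem_iSup_of_mem n hv⟩, Submodule.mem_iSup_of_mem n ?_, rfl⟩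
      rw [Module.End.mem_eigenspace_iff]
      ext
      simpa using Module.End.mem_eigenspace_iff.1 hv
    obtain ⟨y, hy, hyx⟩ := hle x.2
    rwa [← Subtype.ext (hyx : (y : X) = x)]
  · obtain ⟨f, hf⟩ := exists_injective_eigenspace_restrict hK (lam + n)
    exact FiniteDimensional.of_injective f hf
  · obtain ⟨f, hf⟩ := exists_injective_eigenspace_restrict hK (lam + n)
    have := hfin n
    exact (LinearMap.finrank_le_finrank_of_injective hf).trans
      (Module.finrank_le_of_rank_le (hA _))

namespace LoopRep

variable {𝔨 M : Type} [LieRing 𝔨] [LieAlgebra ℂ 𝔨] [AddCommGroup M] [Module ℂ M]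
  {L : ℤ → End ℂ M} {E : ℤ → 𝔨 →ₗ[ℂ] End ℂ M}

theorem comp_subtype (H : LoopRep L E) (𝔰 : LieSubalgebra ℂ 𝔨) :
    LoopRep L fun j => E j ∘ₗ (𝔰.incl : 𝔰 →ₗ[ℂ] 𝔨) where
  comm_LL := H.comm_LL
  comm_LE i j x := H.comm_LE i j x
  comm_EE i j x y := H.comm_EE i j x y

/-- The operators `E` on a stable subspace. -/
def restrictE {K : Submodule ℂ M} (hK : LoopStable L E K) (j : ℤ) : 𝔨 →ₗ[ℂ] End ℂ K where
  toFun x := (E j x).restrict (hK.E_mem j x)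
  map_add' x y := by
    ext v
    simp
  map_smul' c x := by
    ext v
    simp

theorem restrict (H : LoopRep L E) {K : Submodule ℂ M} (hK : LoopStable L E K) :
    LoopRep (fun i => (L i).restrict (hK.L_mem i)) (restrictE hK) where
  comm_LL i j := by
    ext v
    exact LinearMap.congr_fun (H.comm_LL i j) v
  comm_LE i j x := by
    ext v
    exact LinearMap.congr_fun (H.comm_LE i j x) v
  comm_EE i j x y := by
    ext v
    exact LinearMap.congr_fun (H.comm_EE i j x y) v

theorem differentiator_restrict {K : Submodule ℂ M} (hK : LoopStable L E K) (m : ℕ) (x : 𝔨)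
    (s b : ℤ) (v : K) :
    (differentiator (fun i => (L i).restrict (hK.L_mem i)) (restrictE hK) m x s b v : M) =
      differentiator L E m x s b v := by
  rw [differentiator_apply, differentiator_apply]
  exact (congrFun (diffEnd_pow_comp K.subtype 1 m _) b).symm

theorem stable_iSup_eigenspace (H : LoopRep L E) (lam : ℂ) :
    LoopStable L E (⨆ n : ℤ, (L 0).eigenspace (lam + n)) := by
  have key : ∀ (A : End ℂ M) (j : ℤ), L 0 * A - A * L 0 = (j : ℂ) • A →
      ∀ v ∈ ⨆ n : ℤ, (L 0).eigenspace (lam + n), A v ∈ ⨆ n : ℤ, (L 0).eigenspace (lam + n) := by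
    intro A j hA
    refine iSup_le (a := (⨆ n : ℤ, (L 0).eigenspace (lam + n)).comap A) fun n v hv => ?_
    refine Submodule.mem_iSup_of_mem (n + j) (Module.End.mem_eigenspace_iff.2 ?_)
    have h := LinearMap.congr_fun hA v
    simp only [LinearMap.sub_apply, Module.End.mul_apply, LinearMap.smul_apply,
      Module.End.mem_eigenspace_iff.1 hv, map_smul] at h
    rw [sub_eq_iff_eq_add.1 h]
    push_cast
    module
  refine ⟨fun i => key _ i ?_, fun j x => key _ j ?_⟩
  · simpa using H.comm_LL 0 i
  · simpa using H.comm_LE 0 j x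

theorem differentiator_e_eq_zero (H : LoopRep L E) {h e f : 𝔨} (ht : IsSl2Triple h e f) {d : ℕ}
    (htop : ⨆ μ : ℂ, (L 0).eigenspace μ = ⊤)
    (hd : ∀ μ : ℂ, Module.rank ℂ ((L 0).eigenspace μ) ≤ d) (s b : ℤ) :
    differentiator L E (4 ^ (2 * d) * (4 * (d ^ 2 + 2))) e s b = 0 := by
  let 𝔰 := ht.toLieSubalgebra ℂ
  have he : e ∈ 𝔰 := IsSl2Triple.mem_toLieSubalgebra_iff.2 ⟨1, 0, 0, by simp⟩
  have hf : f ∈ 𝔰 := IsSl2Triple.mem_toLieSubalgebra_iff.2 ⟨0, 1, 0, by simp⟩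
  have hh : h ∈ 𝔰 := IsSl2Triple.mem_toLieSubalgebra_iff.2 ⟨0, 0, 1, by simp [ht.lie_e_f]⟩
  have ht' : IsSl2Triple (⟨h, hh⟩ : 𝔰) ⟨e, he⟩ ⟨f, hf⟩ :=
    { h_ne_zero := fun h0 => ht.h_ne_zero (congrArg Subtype.val h0)
      lie_e_f := Subtype.ext ht.lie_e_f
      lie_h_e_nsmul := Subtype.ext ht.lie_h_e_nsmul
      lie_h_f_nsmul := Subtype.ext ht.lie_h_f_nsmul }
  have hspan : ∀ x : 𝔰, ∃ a b c : ℂ,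
      x = a • (⟨e, he⟩ : 𝔰) + b • (⟨h, hh⟩ : 𝔰) + c • (⟨f, hf⟩ : 𝔰) := fun x => by
    obtain ⟨a, c, b, hx⟩ := IsSl2Triple.mem_toLieSubalgebra_iff.1 x.2
    refine ⟨a, b, c, Subtype.ext ?_⟩
    rw [hx, ht.lie_e_f]
    exact add_right_comm _ _ _
  rw [← LinearMap.ker_eq_top, eq_top_iff, ← htop]
  refine iSup_le fun lam v hv => ?_
  have H' := H.comp_subtype 𝔰
  have hK := H'.stable_iSup_eigenspace lam
  have h0 := (H'.restrict hK).differentiator_eq_zero ht' hspan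
    (cosetBounded_restrict_iSup hd lam (hK.L_mem 0)) ⟨e, he⟩ s b
  have hvK : v ∈ ⨆ n : ℤ, (L 0).eigenspace (lam + n) :=
    Submodule.mem_iSup_of_mem 0 (by simpa using hv)
  have h1 := differentiator_restrict hK (4 ^ (2 * d) * (4 * (d ^ 2 + 2))) ⟨e, he⟩ s b ⟨v, hvK⟩
  rw [h0] at h1
  exact h1.symm

theorem differentiator_lie (H : LoopRep L E) (m : ℕ) (x y : 𝔨) (s b : ℤ) :
    differentiator L E m ⁅y, x⁆ s b =
      E 0 y * differentiator L E m x s b - differentiator L E m x s b * E 0 y := by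
  have h := congrFun (diffEnd_pow_comp (LinearMap.mulLeft ℂ (E 0 y) - LinearMap.mulRight ℂ (E 0 y))
    1 m fun b : ℤ => E (s - b) x * L b) b
  simp only [LinearMap.sub_apply, LinearMap.mulLeft_apply, LinearMap.mulRight_apply] at h
  have hL : ∀ b : ℤ, L b * E 0 y = E 0 y * L b := fun b => by
    simpa [sub_eq_zero] using H.comm_LE b 0 y
  simp only [mul_assoc, hL] at h
  simp only [← mul_assoc, ← sub_mul, H.comm_EE, zero_add] at h
  exact h

theorem differentiator_eq_zero_of_isSimple [FiniteDimensional ℂ 𝔨] [LieAlgebra.IsSimple ℂ 𝔨]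
    (H : LoopRep L E) {d : ℕ} (htop : ⨆ μ : ℂ, (L 0).eigenspace μ = ⊤)
    (hd : ∀ μ : ℂ, Module.rank ℂ ((L 0).eigenspace μ) ≤ d) (x : 𝔨) (s b : ℤ) :
    differentiator L E (4 ^ (2 * d) * (4 * (d ^ 2 + 2))) x s b = 0 := by
  obtain ⟨h, e, f, ht⟩ := exists_isSl2Triple (𝔨 := 𝔨)
  generalize hm : 4 ^ (2 * d) * (4 * (d ^ 2 + 2)) = m
  let X : Set 𝔨 := {x | ∀ s b, differentiator L E m x s b = 0}
  have hX : ∀ x ∈ Submodule.span ℂ X, x ∈ X := fun x hx s b =>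
    (Submodule.mem_bot ℂ).1 <| differentiator_mem_of_span
      (fun x (hx : x ∈ X) => (Submodule.mem_bot ℂ).2 (hx s b)) hx
  have hspan : Submodule.span ℂ X = ⊤ :=
    eq_top_of_lie_mem (fun y x hx => Submodule.subset_span fun s b => by
        rw [H.differentiator_lie, hX x hx s b, mul_zero, zero_mul, sub_zero])
      (Submodule.subset_span fun s b => hm ▸ H.differentiator_e_eq_zero ht htop hd s b) ht.e_ne_zero
  exact hX x (hspan ▸ Submodule.mem_top) s b

end LoopRep

end Cuspidal

section OddCurrents

variable {𝔨 M : Type} [LieRing 𝔨] [LieAlgebra ℂ 𝔨] [AddCommGroup M] [Module ℂ M]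
  {L : ℤ → End ℂ M} {E F : ℤ → 𝔨 →ₗ[ℂ] End ℂ M}

theorem span_lie_eq_top [LieAlgebra.IsSimple ℂ 𝔨] :
    Submodule.span ℂ {z | ∃ x y : 𝔨, z = ⁅x, y⁆} = ⊤ := by
  obtain ⟨x, y, hxy⟩ : ∃ x y : 𝔨, ⁅x, y⁆ ≠ 0 := by
    by_contra! h
    exact LieAlgebra.IsSimple.non_abelian ℂ (L := 𝔨) ⟨h⟩
  exact eq_top_of_lie_mem (fun x y _ => Submodule.subset_span ⟨x, y, rfl⟩)
    (Submodule.subset_span ⟨x, y, rfl⟩) hxy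

theorem differentiator_add_two_eq_zero {m : ℕ} {x : 𝔨}
    (h : ∀ s b, differentiator L E m x s b = 0) (s b : ℤ) :
    differentiator L E (m + 2) x s b = 0 := by
  have h0 : (diffEnd 1 ^ m) (fun b : ℤ => E (s - b) x * L b) = 0 := funext fun b => h s b
  rw [differentiator, add_comm, pow_add, Module.End.mul_apply, h0, map_zero]
  rfl

theorem odd_differentiator_lie_eq_zero
    (hLF : ∀ (i j : ℤ) (x : 𝔨),
      L i * F j x - F j x * L i = ((j : ℂ) + (i : ℂ) / 2) • F (i + j) x)
    (hFE : ∀ (i j : ℤ) (x y : 𝔨), F i x * E j y - E j y * F i x = F (i + j) ⁅x, y⁆) {m : ℕ}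
    {x : 𝔨} (h : ∀ s b, differentiator L E m x s b = 0) (y : 𝔨) (s b : ℤ) :
    differentiator L F (m + 2) ⁅y, x⁆ s b = 0 := by
  let w : ℤ → End ℂ M := fun c => E (s - c) x * F c y
  have key : ∀ j b : ℤ, F (s - b) ⁅y, x⁆ * L b =
      (LinearMap.mulLeft ℂ (F j y) - LinearMap.mulRight ℂ (F j y)) (E (s - j - b) x * L b) +
        (1 / 2 : ℂ) • (((b + j : ℤ) : ℂ) • w (b + j) + (j : ℂ) • w (b + j)) := fun j b => by
    have h1 : F j y * E (s - j - b) x = E (s - j - b) x * F j y + F (s - b) ⁅y, x⁆ := by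
      rw [show s - b = j + (s - j - b) by ring, ← hFE]
      abel
    have h2 : L b * F j y = F j y * L b + ((j : ℂ) + (b : ℂ) / 2) • F (b + j) y := by
      rw [← hLF]
      abel
    simp only [LinearMap.sub_apply, LinearMap.mulLeft_apply, LinearMap.mulRight_apply, w]
    rw [← mul_assoc, h1, mul_assoc (E (s - j - b) x) (L b), h2, add_mul, mul_add, mul_smul_comm,
      show s - (b + j) = s - j - b by ring, ← mul_assoc]
    push_cast
    module
  let A := (diffEnd 1 ^ m) (fun c : ℤ => (c : ℂ) • w c) 0
  let B := (diffEnd 1 ^ m) w 0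
  have hu : (diffEnd 1 ^ m) (fun b : ℤ => F (s - b) ⁅y, x⁆ * L b) =
      fun b : ℤ => (1 / 2 : ℂ) • (A + ((-b : ℤ) : ℂ) • B) := by
    ext1 b
    have h1 := congrFun (diffEnd_pow_comp
      (LinearMap.mulLeft ℂ (F (-b) y) - LinearMap.mulRight ℂ (F (-b) y)) 1 m
      fun k : ℤ => E (s - -b - k) x * L k) b
    have h2 : (diffEnd 1 ^ m) (fun k : ℤ => E (s - -b - k) x * L k) b = 0 := h (s - -b) b
    rw [h2, map_zero] at h1
    have h3 := diffEnd_pow_apply_path (g := (1 : ℤ)) (ι := fun k : ℤ => k + -b)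
      (fun k => by ring) m
      ((1 / 2 : ℂ) • ((fun c : ℤ => (c : ℂ) • w c) + ((-b : ℤ) : ℂ) • w)) b
    rw [map_smul, map_add, map_smul] at h3
    simp only [add_neg_cancel] at h3
    have h4 : (fun k : ℤ => F (s - k) ⁅y, x⁆ * L k) =
        (fun k => (LinearMap.mulLeft ℂ (F (-b) y) - LinearMap.mulRight ℂ (F (-b) y))
          (E (s - -b - k) x * L k)) +
        fun k => ((1 / 2 : ℂ) • ((fun c : ℤ => (c : ℂ) • w c) + ((-b : ℤ) : ℂ) • w)) (k + -b) :=
      funext fun k => key (-b) k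
    rw [h4, map_add, Pi.add_apply, h1, zero_add, ← h3]
    rfl
  have h5 : (diffEnd 1 ^ 2) (fun b : ℤ => (1 / 2 : ℂ) • (A + ((-b : ℤ) : ℂ) • B)) = 0 := by
    ext1 b
    rw [pow_two, Module.End.mul_apply]
    simp only [diffEnd_apply, Pi.zero_apply]
    push_cast
    module
  rw [differentiator, add_comm, pow_add, Module.End.mul_apply, hu, h5]
  rfl

theorem sum_eq_smul_differentiator (E : ℤ → 𝔨 →ₗ[ℂ] End ℂ M) (m : ℕ) (x : 𝔨) (k p : ℤ) :
    ∑ i ∈ Finset.range (m + 1),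
      ((-1 : ℂ) ^ i * (m.choose i : ℂ)) • (E (k - (i : ℤ)) x * L (p + (i : ℤ))) =
    (-1 : ℂ) ^ m • differentiator L E m x (k + p) p := by
  rw [differentiator, diffEnd_pow_eq_sum, Finset.smul_sum]
  refine Finset.sum_congr rfl fun i hi => ?_
  obtain ⟨j, rfl⟩ := Nat.exists_eq_add_of_le (Finset.mem_range_succ_iff.1 hi)
  rw [smul_smul, ← mul_assoc, ← pow_add, Nat.add_sub_cancel_left, add_assoc, pow_add _ i,
    Even.neg_one_pow ⟨j, rfl⟩, mul_one, show k + p - (p + i) = k - i by ring]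

end OddCurrents

/-- **Statement 6.** Let `M` be a cuspidal `g`-module.  Then there exists `m ∈ ℕ`
such that for all `k, p ∈ ℤ` and `x ∈ ġ`, the operators
`Σ_{i=0}^{m} (−1)ⁱ (m choose i) (x ⊗ t^{k−i}) L_{p+i}` and
`Σ_{i=0}^{m} (−1)ⁱ (m choose i) (x ⊗ t^{k−i} ξ) L_{p+i}` annihilate `M`. -/
theorem cuspidal_differentiator_annihilates
    (𝕘 : Type) [LieRing 𝕘] [LieAlgebra ℂ 𝕘] [FiniteDimensional ℂ 𝕘]
    [LieAlgebra.IsSimple ℂ 𝕘]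
    (M : Type) [AddCommGroup M] [Module ℂ M]
    (L G : ℤ → End ℂ M) (E F : ℤ → 𝕘 →ₗ[ℂ] End ℂ M)
    (hrep : IsGRep 𝕘 L G E F)
    (hcusp : IsCuspidalMod (L 0)) :
    ∃ m : ℕ, ∀ (k p : ℤ) (x : 𝕘),
      (∑ i ∈ Finset.range (m + 1),
        ((-1 : ℂ) ^ i * (m.choose i : ℂ)) • (E (k - (i : ℤ)) x * L (p + (i : ℤ)))) = 0 ∧
      (∑ i ∈ Finset.range (m + 1),
        ((-1 : ℂ) ^ i * (m.choose i : ℂ)) • (F (k - (i : ℤ)) x * L (p + (i : ℤ)))) = 0 := by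
  obtain ⟨hw, d, hd⟩ := hcusp
  have H : LoopRep L E := ⟨hrep.comm_LL, hrep.comm_LE, hrep.comm_EE⟩
  obtain ⟨m, hm⟩ : ∃ m, ∀ x s b, differentiator L E m x s b = 0 :=
    ⟨_, H.differentiator_eq_zero_of_isSimple hw hd⟩
  refine ⟨m + 2, fun k p x => ⟨?_, ?_⟩⟩
  · rw [sum_eq_smul_differentiator, differentiator_add_two_eq_zero (hm x), smul_zero]
  · have hx : x ∈ Submodule.span ℂ {z | ∃ x y : 𝕘, z = ⁅x, y⁆} := by
      rw [span_lie_eq_top]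
      exact Submodule.mem_top
    have hF : differentiator L F (m + 2) x (k + p) p ∈ (⊥ : Submodule ℂ (End ℂ M)) := by
      refine differentiator_mem_of_span ?_ hx
      rintro _ ⟨y, x, rfl⟩
      exact odd_differentiator_lie_eq_zero hrep.comm_LF hrep.comm_FE (hm x) y _ _
    rw [sum_eq_smul_differentiator, (Submodule.mem_bot ℂ).1 hF, smul_zero]
end
end
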